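/- arXiv:2410.15867 — 2 statements merged into one kernel-verified Lean document; each statement's English description precedes it below -/
import Mathlib

section
/- In addition to (T1)–(T4), let b_i : [0,∞)×ℝ → ℝ, c_{ijlp}, d_{ijlq}, I_i : [0,∞) → ℝ and τ_{ijp}, σ_{ilp} : [0,∞) → [0,∞) be continuous, let (H) denote the system obtained from (Ĥ) by replacing b̂_i, ĉ_{ijlp}, d̂_{ijlq}, Î_i, τ̂_{ijp}, σ̂_{ilp} with these unhatted functions, and assume: there is a continuous β_i : [0,∞) → [0,∞) with (b_i(t,u)−b_i(t,v))/(u−v) ≥ β_i(t) for all t ≥ 0, u ≠ v; and, as t → +∞: β_i(t)−β̂_i(t) → 0, b_i(t,w(t))−b̂_i(t,w(t)) → 0 for every bounded continuous w : ℝ → ℝ, c_{ijlp}(t)−ĉ_{ijlp}(t) → 0, d_{ijlq}(t)−d̂_{ijlq}(t) → 0, τ_{ijp}(t)−τ̂_{ijp}(t) → 0, σ_{ilp}(t)−σ̂_{ilp}(t) → 0, I_i(t)−Î_i(t) → 0. Suppose there exist d₁,…,d_n > 0 satisfying, for all t ∈ [0,ω] and all i, both β̂_i(t) > Σ_{j,l=1}^{n}[Σ_{p=1}^{P}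 ζ_i|ĉ_{ijlp}(t)|((d_j/d_i)γ¹_{ijlp} + (d_l/d_i)γ²_{ijlp}) + Σ_{q=1}^{Q} ς_i|d̂_{ijlq}(t)|((d_j/d_i)μ¹_{ijlq}ξ_{ijq} + (d_l/d_i)μ²_{ijlq}Ξ_{ilq})] and −(β̂_i(t)+A_i(t))a̲_i + Σ_{j,l=1}^{n}[Σ_{p=1}^{P} ζ_i|ĉ_{ijlp}(t)|(γ¹_{ijlp}ā_j(d_j/d_i) + γ²_{ijlp}ā_l(d_l/d_i)) + Σ_{q=1}^{Q} ς_i|d̂_{ijlq}(t)|(μ¹_{ijlq}ξ_{ijq}ā_j(d_j/d_i) + μ²_{ijlq}Ξ_{ilq}ā_l(d_l/d_i))] < 0. Then there exists an ω-periodic solution x̂ of (Ĥ) (continuous ω-periodic x̂ : ℝ → ℝ^n, differentiable, satisfying (Ĥ) for all t > 0) such that every solution x of (H) with bounded initial condition (continuous on ℝ, bounded on (−∞,t₀] for some t₀ ≥ 0, differentiable on (t₀,∞), satisfying (H) for t > t₀) verifies lim_{t→+∞} |x(t) − x̂(t)| = 0 in the max norm. -/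
open MeasureTheory Filter

/-- Data of the high-order Cohen--Grossberg system, with `n+1` neurons,
`P+1` discrete-delay blocks and `Q+1` distributed-delay blocks. -/
structure HOData (n P Q : ℕ) where
  a : Fin (n+1) → ℝ → ℝ → ℝ
  b : Fin (n+1) → ℝ → ℝ → ℝ
  Gf : Fin (n+1) → ℝ → ℝ
  Hf : Fin (n+1) → ℝ → ℝ
  c : Fin (n+1) → Fin (n+1) → Fin (n+1) → Fin (P+1) → ℝ → ℝ
  d : Fin (n+1) → Fin (n+1) → Fin (n+1) → Fin (Q+1) → ℝ → ℝ
  I : Fin (n+1) → ℝ → ℝ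
  τ : Fin (n+1) → Fin (n+1) → Fin (P+1) → ℝ → ℝ
  σ : Fin (n+1) → Fin (n+1) → Fin (P+1) → ℝ → ℝ
  h : Fin (n+1) → Fin (n+1) → Fin (n+1) → Fin (P+1) → ℝ → ℝ → ℝ
  f : Fin (n+1) → Fin (n+1) → Fin (n+1) → Fin (Q+1) → ℝ → ℝ → ℝ
  g : Fin (n+1) → Fin (n+1) → Fin (Q+1) → ℝ → ℝ
  G : Fin (n+1) → Fin (n+1) → Fin (Q+1) → ℝ → ℝ
  η : Fin (n+1) → Fin (n+1) → Fin (Q+1) → Measure ℝ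
  ρ : Fin (n+1) → Fin (n+1) → Fin (Q+1) → Measure ℝ

namespace HOData

variable {n P Q : ℕ}

/-- Right-hand side of the high-order system. -/
noncomputable def rhs (S : HOData n P Q) (x : Fin (n+1) → ℝ → ℝ) (i : Fin (n+1)) (t : ℝ) : ℝ :=
  S.a i t (x i t) * (-(S.b i t (x i t))
    + S.Gf i (∑ p : Fin (P+1), ∑ j : Fin (n+1), ∑ l : Fin (n+1),
        S.c i j l p t * S.h i j l p (x j (t - S.τ i j p t)) (x l (t - S.σ i l p t)))
    + S.Hf i (∑ q : Fin (Q+1), ∑ j : Fin (n+1), ∑ l : Fin (n+1),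
        S.d i j l q t * S.f i j l q
          (∫ s in Set.Iic (0:ℝ), S.g i j q (x j (t + s)) ∂(S.η i j q))
          (∫ s in Set.Iic (0:ℝ), S.G i l q (x l (t + s)) ∂(S.ρ i l q)))
    + S.I i t)

/-- Standing regularity assumptions. -/
def Regular (S : HOData n P Q) : Prop :=
  (∀ i, ContinuousOn (fun q : ℝ × ℝ => S.a i q.1 q.2) (Set.Ici 0 ×ˢ Set.univ)) ∧
  (∀ i, ∀ t ≥ (0:ℝ), ∀ v, 0 < S.a i t v) ∧
  (∀ i, ContinuousOn (fun q : ℝ × ℝ => S.b i q.1 q.2) (Set.Ici 0 ×ˢ Set.univ)) ∧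
  (∀ i, Continuous (S.Gf i)) ∧ (∀ i, Continuous (S.Hf i)) ∧
  (∀ i j l p, ContinuousOn (S.c i j l p) (Set.Ici 0)) ∧
  (∀ i j l q, ContinuousOn (S.d i j l q) (Set.Ici 0)) ∧
  (∀ i, ContinuousOn (S.I i) (Set.Ici 0)) ∧
  (∀ i j p, ContinuousOn (S.τ i j p) (Set.Ici 0)) ∧
  (∀ i l p, ContinuousOn (S.σ i l p) (Set.Ici 0)) ∧
  (∀ i j p, ∀ t ≥ (0:ℝ), 0 ≤ S.τ i j p t) ∧
  (∀ i l p, ∀ t ≥ (0:ℝ), 0 ≤ S.σ i l p t) ∧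
  (∀ i j l p, Continuous (fun q : ℝ × ℝ => S.h i j l p q.1 q.2)) ∧
  (∀ i j l q, Continuous (fun r : ℝ × ℝ => S.f i j l q r.1 r.2)) ∧
  (∀ i j q, Continuous (S.g i j q)) ∧
  (∀ i l q, Continuous (S.G i l q)) ∧
  (∀ i j q, IsProbabilityMeasure (S.η i j q) ∧ S.η i j q (Set.Ioi 0) = 0) ∧
  (∀ i l q, IsProbabilityMeasure (S.ρ i l q) ∧ S.ρ i l q (Set.Ioi 0) = 0)

/-- A solution on `ℝ` with bounded initial condition at `t₀`. -/
def IsSolution (S : HOData n P Q) (t₀ : ℝ) (x : Fin (n+1) → ℝ → ℝ) : Prop :=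
  (∀ i, Continuous (x i)) ∧
  (∃ M, ∀ i, ∀ t ≤ t₀, |x i t| ≤ M) ∧
  (∀ i, ∀ t, t₀ < t → HasDerivAt (x i) (S.rhs x i t) t)

/-- Assumption (T1). -/
def T1 (S : HOData n P Q) (aL aU : Fin (n+1) → ℝ) (A : Fin (n+1) → ℝ → ℝ) : Prop :=
  (∀ i, 0 < aL i) ∧ (∀ i, aL i ≤ aU i) ∧
  (∀ i, ∀ t ≥ (0:ℝ), ∀ v, aL i ≤ S.a i t v ∧ S.a i t v ≤ aU i) ∧
  (∀ i, ∀ v : ℝ, ∀ t ≥ (0:ℝ),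
    ∃ da, HasDerivAt (fun s => S.a i s v) da t ∧ A i t * (S.a i t v) ^ 2 ≤ da)

/-- Assumption (T2): Lipschitz estimates. -/
def T2 (S : HOData n P Q)
    (γ1 γ2 : Fin (n+1) → Fin (n+1) → Fin (n+1) → Fin (P+1) → ℝ)
    (μ1 μ2 : Fin (n+1) → Fin (n+1) → Fin (n+1) → Fin (Q+1) → ℝ)
    (ξ Ξ : Fin (n+1) → Fin (n+1) → Fin (Q+1) → ℝ) (ζ ς : Fin (n+1) → ℝ) : Prop :=
  (∀ i j l p, 0 < γ1 i j l p ∧ 0 < γ2 i j l p) ∧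
  (∀ i j l q, 0 < μ1 i j l q ∧ 0 < μ2 i j l q) ∧
  (∀ i j q, 0 < ξ i j q) ∧ (∀ i l q, 0 < Ξ i l q) ∧ (∀ i, 0 < ζ i ∧ 0 < ς i) ∧
  (∀ i j l p u1 u2 v1 v2,
    |S.h i j l p u1 u2 - S.h i j l p v1 v2| ≤ γ1 i j l p * |u1 - v1| + γ2 i j l p * |u2 - v2|) ∧
  (∀ i j l q u1 u2 v1 v2,
    |S.f i j l q u1 u2 - S.f i j l q v1 v2| ≤ μ1 i j l q * |u1 - v1| + μ2 i j l q * |u2 - v2|) ∧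
  (∀ i j q u v, |S.g i j q u - S.g i j q v| ≤ ξ i j q * |u - v|) ∧
  (∀ i l q u v, |S.G i l q u - S.G i l q v| ≤ Ξ i l q * |u - v|) ∧
  (∀ i u v, |S.Gf i u - S.Gf i v| ≤ ζ i * |u - v|) ∧
  (∀ i u v, |S.Hf i u - S.Hf i v| ≤ ς i * |u - v|)

/-- Assumption (T3): ω-periodicity of the data. -/
def T3 (S : HOData n P Q) (ω : ℝ) : Prop :=
  (∀ i, ∀ t ≥ (0:ℝ), ∀ u, S.a i (t + ω) u = S.a i t u) ∧
  (∀ i, ∀ t ≥ (0:ℝ), ∀ u, S.b i (t + ω) u = S.b i t u) ∧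
  (∀ i j l p, ∀ t ≥ (0:ℝ), S.c i j l p (t + ω) = S.c i j l p t) ∧
  (∀ i j l q, ∀ t ≥ (0:ℝ), S.d i j l q (t + ω) = S.d i j l q t) ∧
  (∀ i j p, ∀ t ≥ (0:ℝ), S.τ i j p (t + ω) = S.τ i j p t) ∧
  (∀ i l p, ∀ t ≥ (0:ℝ), S.σ i l p (t + ω) = S.σ i l p t) ∧
  (∀ i, ∀ t ≥ (0:ℝ), S.I i (t + ω) = S.I i t)

/-- Assumption (T4): two-sided sector bounds on `b` by ω-periodic positive functions. -/
def T4 (S : HOData n P Q) (ω : ℝ) (β βs : Fin (n+1) → ℝ → ℝ) : Prop :=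
  (∀ i, ContinuousOn (β i) (Set.Ici 0)) ∧ (∀ i, ContinuousOn (βs i) (Set.Ici 0)) ∧
  (∀ i, ∀ t ≥ (0:ℝ), 0 < β i t ∧ 0 < βs i t) ∧
  (∀ i, ∀ t ≥ (0:ℝ), β i (t + ω) = β i t ∧ βs i (t + ω) = βs i t) ∧
  (∀ i, ∀ t ≥ (0:ℝ), ∀ u v : ℝ, u ≠ v →
    β i t ≤ (S.b i t u - S.b i t v) / (u - v) ∧ (S.b i t u - S.b i t v) / (u - v) ≤ βs i t)

end HOData

open HOData

/-- An `ω`-periodic Cohen--Grossberg type functional differential equation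
`x i ' = a i t (x i) * (-(b i t (x i)) + N i x t)` on the whole line, with a causal nonlocal
term `N`, satisfying a diagonal dominance condition with weights `w`. -/
structure PeriodicSystem (ι : Type*) where
  ω : ℝ
  a : ι → ℝ → ℝ → ℝ
  b : ι → ℝ → ℝ → ℝ
  N : ι → (ι → ℝ → ℝ) → ℝ → ℝ
  aL : ι → ℝ
  aU : ι → ℝ
  w : ι → ℝ
  β : ι → ℝ → ℝ
  A : ι → ℝ → ℝ
  κ : ι → ℝ → ℝ
  ω_pos : 0 < ω
  a_cont : ∀ i, Continuous fun q : ℝ × ℝ => a i q.1 q.2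
  b_cont : ∀ i, Continuous fun q : ℝ × ℝ => b i q.1 q.2
  a_per : ∀ i (m : ℤ) t v, a i (t + m * ω) v = a i t v
  b_per : ∀ i (m : ℤ) t v, b i (t + m * ω) v = b i t v
  aL_pos : ∀ i, 0 < aL i
  aL_le : ∀ i t v, aL i ≤ a i t v
  le_aU : ∀ i t v, a i t v ≤ aU i
  w_pos : ∀ i, 0 < w i
  sector : ∀ i, ∀ t ∈ Set.Ioc 0 ω, ∀ u v, v < u → β i t * (u - v) ≤ b i t u - b i t v
  β_bdd : ∀ i, ∃ B, ∀ t ∈ Set.Ioc 0 ω, β i t ≤ B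
  a_deriv : ∀ i v, ∀ t ∈ Set.Ioc 0 ω, ∃ da,
    HasDerivAt (fun s => a i s v) da t ∧ A i t * (a i t v) ^ 2 ≤ da
  κ_nonneg : ∀ i, ∀ t ∈ Set.Ioc 0 ω, 0 ≤ κ i t
  dom : ∀ i, ∀ t ∈ Set.Ioc 0 ω, -((β i t + A i t) * aL i) + κ i t < 0
  N_cont : ∀ i x M, (∀ j, Continuous (x j)) → (∀ j t, |x j t| ≤ M) → Continuous (N i x)
  N_lim : ∀ i (z : ℕ → ι → ℝ → ℝ) x M t, (∀ k j, Continuous (z k j)) →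
    (∀ k j s, |z k j s| ≤ M) → (∀ j s, Tendsto (fun k => z k j s) atTop (nhds (x j s))) →
    Tendsto (fun k => N i (z k) t) atTop (nhds (N i x t))
  N_causal : ∀ i x y t, (∀ j, ∀ s ≤ t, x j s = y j s) → N i x t = N i y t
  N_per : ∀ i x (m : ℤ) t, N i x (t + m * ω) = N i (fun j s => x j (s + m * ω)) t
  N_lip : ∀ i x y M L, ∀ t ∈ Set.Ioc 0 ω, (∀ j, Continuous (x j)) → (∀ j, Continuous (y j)) →
    (∀ j s, |x j s| ≤ M) → (∀ j s, |y j s| ≤ M) → 0 ≤ L →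
    (∀ j s, |x j s - y j s| ≤ L * (aU j * w j)) → |N i x t - N i y t| ≤ L * (w i * κ i t)
  bounded : ∀ M, ∃ C, ∀ i x, (∀ j, Continuous (x j)) → (∀ j t, |x j t| ≤ M) →
    ∀ t, |a i t (x i t) * (-(b i t (x i t)) + N i x t)| ≤ C
  dissip : ∃ M, 0 < M ∧ ∀ i x, (∀ j, Continuous (x j)) → (∀ j s, |x j s| ≤ M * w j) →
    ∀ t, |x i t| = M * w i → x i t * (-(b i t (x i t)) + N i x t) < 0

/-- Difference quotients of integrals with moving endpoints and a parameter. -/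
theorem tendsto_integral_div_of_hasDerivAt {φ : ℝ → ℝ → ℝ}
    (hφ : Continuous fun q : ℝ × ℝ => φ q.1 q.2) {u : ℝ → ℝ} {u' t : ℝ} (hu : HasDerivAt u u' t)
    {s : ℕ → ℝ} (hs : Tendsto s atTop (nhds t)) (hne : ∀ k, s k ≠ t) :
    Tendsto (fun k => (∫ v in (u (s k))..(u t), φ (s k) v) / (t - s k)) atTop
      (nhds (φ t (u t) * u')) := by
  have hcont : Continuous fun q : ℝ × ℝ => ∫ θ in (0:ℝ)..1, φ q.1 (q.2 + (u t - q.2) * θ) := by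
    refine intervalIntegral.continuous_parametric_intervalIntegral_of_continuous'
      (f := fun (q : ℝ × ℝ) θ => φ q.1 (q.2 + (u t - q.2) * θ)) ?_ 0 1
    exact hφ.comp (f := fun r : (ℝ × ℝ) × ℝ => (r.1.1, r.1.2 + (u t - r.1.2) * r.2))
      (by fun_prop)
  have hus : Tendsto (fun k => u (s k)) atTop (nhds (u t)) := hu.continuousAt.tendsto.comp hs
  have h1 := (hcont.tendsto (t, u t)).comp (hs.prodMk_nhds hus)
  have h2 : Tendsto (fun k => slope u t (s k)) atTop (nhds u') :=
    (hasDerivAt_iff_tendsto_slope.1 hu).comp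
      (tendsto_nhdsWithin_iff.2 ⟨hs, Eventually.of_forall hne⟩)
  have h3 := h1.mul h2
  simp only [sub_self, zero_mul, add_zero, intervalIntegral.integral_const, sub_zero, one_smul]
    at h3
  refine h3.congr fun k => ?_
  have h4 := intervalIntegral.smul_integral_comp_add_mul (a := 0) (b := 1) (fun v => φ (s k) v)
    (u t - u (s k)) (u (s k))
  simp only [mul_zero, add_zero, mul_one, add_sub_cancel, smul_eq_mul] at h4
  rw [← h4, slope_def_field]
  have : s k - t ≠ 0 := sub_ne_zero.2 (hne k)
  have : t - s k ≠ 0 := sub_ne_zero.2 (hne k).symm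
  simp only [Function.comp]
  field_simp
  ring

/-- A one-sided Fatou estimate: if difference quotients are bounded above and converge to a limit
at most `-A`, their integrals are eventually at most `-A * (q - p) + o(1)`. -/
theorem exists_tendsto_integral_upper_bound {ψ : ℕ → ℝ → ℝ} {p q A B : ℝ} (hpq : p ≤ q)
    (hc : ∀ k, Continuous (ψ k)) (hB : ∀ k v, ψ k v ≤ B)
    (hlim : ∀ v, ∃ ℓ ≤ -A, Tendsto (fun k => ψ k v) atTop (nhds ℓ)) :
    ∃ I : ℕ → ℝ, (∀ k, ∫ v in p..q, ψ k v ≤ I k) ∧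
      Tendsto I atTop (nhds (-A * (q - p))) := by
  refine ⟨fun k => ∫ v in p..q, max (ψ k v) (-A), fun k => ?_, ?_⟩
  · exact intervalIntegral.integral_mono_on hpq ((hc k).intervalIntegrable _ _)
      (((hc k).max continuous_const).intervalIntegrable _ _) fun v _ => le_max_left _ _
  · have h : ∫ v in p..q, (-A) = -A * (q - p) := by simp; ring
    rw [← h]
    refine intervalIntegral.tendsto_integral_filter_of_dominated_convergence
      (fun _ => |B| + |A|) ?_ ?_ (by simp) ?_
    · exact Eventually.of_forall fun k =>
        ((hc k).max continuous_const).aestronglyMeasurable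
    · refine Eventually.of_forall fun k => Eventually.of_forall fun v _ => ?_
      rw [Real.norm_eq_abs, abs_le]
      constructor
      · have := le_max_right (ψ k v) (-A)
        have := le_abs_self A
        have := abs_nonneg B
        linarith
      · refine max_le ?_ ?_
        · linarith [hB k v, le_abs_self B, abs_nonneg A]
        · linarith [neg_abs_le A, abs_nonneg B]
    · refine Eventually.of_forall fun v _ => ?_
      obtain ⟨ℓ, hℓ, ht⟩ := hlim v
      have := ht.max (tendsto_const_nhds (x := -A))
      rwa [max_eq_right hℓ] at this

namespace PeriodicSystem

variable {ι : Type*} (Z : PeriodicSystem ι)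

/-- The right-hand side of the system. -/
def R (i : ι) (x : ι → ℝ → ℝ) (t : ℝ) : ℝ :=
  Z.a i t (x i t) * (-(Z.b i t (x i t)) + Z.N i x t)

/-- Complete solutions, bounded by `M`. -/
def IsComplete (M : ℝ) (x : ι → ℝ → ℝ) : Prop :=
  (∀ i t, |x i t| ≤ M) ∧ ∀ i t, HasDerivAt (x i) (Z.R i x t) t

/-- The transformed distance `∫ 1 / a` between two functions. -/
noncomputable def gap (x y : ι → ℝ → ℝ) (i : ι) (t : ℝ) : ℝ :=
  ∫ v in (y i t)..(x i t), (Z.a i t v)⁻¹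

variable {Z}

theorem a_pos (i : ι) (t v : ℝ) : 0 < Z.a i t v := (Z.aL_pos i).trans_le (Z.aL_le i t v)

theorem continuous_inv_a (i : ι) : Continuous fun q : ℝ × ℝ => (Z.a i q.1 q.2)⁻¹ :=
  (Z.a_cont i).inv₀ fun q => (a_pos i q.1 q.2).ne'

theorem continuous_inv_a_right (i : ι) (t : ℝ) : Continuous fun v => (Z.a i t v)⁻¹ :=
  (continuous_inv_a i).comp (f := fun v => (t, v)) (by fun_prop)

theorem R_add_period (i : ι) (x : ι → ℝ → ℝ) (m : ℤ) (t : ℝ) :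
    Z.R i x (t + m * Z.ω) = Z.R i (fun j s => x j (s + m * Z.ω)) t := by
  simp only [R, Z.a_per, Z.b_per, Z.N_per]

theorem IsComplete.shift {M : ℝ} {x : ι → ℝ → ℝ} (h : Z.IsComplete M x) (m : ℤ) :
    Z.IsComplete M (fun i t => x i (t + m * Z.ω)) := by
  refine ⟨fun i t => h.1 i _, fun i t => ?_⟩
  rw [← R_add_period]
  exact (h.2 i (t + m * Z.ω)).comp_add_const t (m * Z.ω)

theorem IsComplete.continuous {M : ℝ} {x : ι → ℝ → ℝ} (h : Z.IsComplete M x) (i : ι) :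
    Continuous (x i) :=
  continuous_iff_continuousAt.2 fun t => (h.2 i t).continuousAt

theorem gap_swap (x y : ι → ℝ → ℝ) (i : ι) (t : ℝ) : Z.gap y x i t = -Z.gap x y i t := by
  rw [gap, gap, intervalIntegral.integral_symm]

theorem gap_shift (x y : ι → ℝ → ℝ) (i : ι) (m : ℤ) (t : ℝ) :
    Z.gap (fun j s => x j (s + m * Z.ω)) (fun j s => y j (s + m * Z.ω)) i t
      = Z.gap x y i (t + m * Z.ω) := by
  simp only [gap, Z.a_per]

theorem gap_bounds {x y : ι → ℝ → ℝ} {i : ι} {t : ℝ} (h : y i t ≤ x i t) :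
    x i t - y i t ≤ Z.aU i * Z.gap x y i t ∧ Z.aL i * Z.gap x y i t ≤ x i t - y i t := by
  have hi : IntervalIntegrable (fun v => (Z.a i t v)⁻¹) volume (y i t) (x i t) :=
    (continuous_inv_a_right i t).intervalIntegrable _ _
  have hU : 0 < Z.aU i := (a_pos i t 0).trans_le (Z.le_aU i t 0)
  have hL := Z.aL_pos i
  constructor
  · have h1 : ∫ v in (y i t)..(x i t), (Z.aU i)⁻¹ ≤ Z.gap x y i t :=
      intervalIntegral.integral_mono_on h (by simp) hi fun v _ =>
        inv_anti₀ (a_pos i t v) (Z.le_aU i t v)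
    simp only [intervalIntegral.integral_const, smul_eq_mul] at h1
    calc x i t - y i t = Z.aU i * ((x i t - y i t) * (Z.aU i)⁻¹) := by field_simp
      _ ≤ _ := by gcongr
  · have h1 : Z.gap x y i t ≤ ∫ v in (y i t)..(x i t), (Z.aL i)⁻¹ :=
      intervalIntegral.integral_mono_on h hi (by simp) fun v _ =>
        inv_anti₀ hL (Z.aL_le i t v)
    simp only [intervalIntegral.integral_const, smul_eq_mul] at h1
    calc Z.aL i * Z.gap x y i t ≤ Z.aL i * ((x i t - y i t) * (Z.aL i)⁻¹) := by gcongr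
      _ = _ := by field_simp

theorem abs_gap_bounds (x y : ι → ℝ → ℝ) (i : ι) (t : ℝ) :
    |x i t - y i t| ≤ Z.aU i * |Z.gap x y i t| ∧ Z.aL i * |Z.gap x y i t| ≤ |x i t - y i t| := by
  have hL := Z.aL_pos i
  have hU : 0 < Z.aU i := (a_pos i t 0).trans_le (Z.le_aU i t 0)
  have key : ∀ x y : ι → ℝ → ℝ, y i t ≤ x i t → |x i t - y i t| ≤ Z.aU i * |Z.gap x y i t| ∧
      Z.aL i * |Z.gap x y i t| ≤ |x i t - y i t| := by
    intro x y h
    obtain ⟨h1, h2⟩ := gap_bounds (Z := Z) h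
    have h0 : 0 ≤ Z.gap x y i t :=
      nonneg_of_mul_nonneg_right ((sub_nonneg.2 h).trans h1) hU
    rw [abs_of_nonneg (sub_nonneg.2 h), abs_of_nonneg h0]
    exact ⟨h1, h2⟩
  rcases le_total (y i t) (x i t) with h | h
  · exact key x y h
  · have := key y x h
    rwa [gap_swap, abs_neg, abs_sub_comm] at this

/-- The difference quotients of `1 / a` in time are bounded above on a period. -/
theorem inv_a_sub_le {i : ι} {B : ℝ} (hB : ∀ t ∈ Set.Ioc 0 Z.ω, Z.β i t ≤ B) (v : ℝ) {s t : ℝ}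
    (hs : 0 < s) (hst : s < t) (ht : t ≤ Z.ω) :
    ((Z.a i t v)⁻¹ - (Z.a i s v)⁻¹) / (t - s) ≤ B := by
  have hd : ∀ r ∈ Set.Ioc 0 Z.ω, ∃ d ≤ -Z.A i r, HasDerivAt (fun s => (Z.a i s v)⁻¹) d r := by
    intro r hr
    obtain ⟨da, h1, h2⟩ := Z.a_deriv i v r hr
    refine ⟨_, ?_, h1.inv (a_pos i r v).ne'⟩
    rw [neg_div, neg_le_neg_iff, le_div_iff₀ (pow_pos (a_pos i r v) 2)]
    exact h2
  choose! d hd1 hd2 using hd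
  have hsub : ∀ r ∈ Set.Icc s t, r ∈ Set.Ioc 0 Z.ω := fun r hr =>
    ⟨hs.trans_le hr.1, hr.2.trans ht⟩
  obtain ⟨c, hc, hc'⟩ := exists_hasDerivAt_eq_slope (fun s => (Z.a i s v)⁻¹) d hst
    (fun r hr => (hd2 r (hsub r hr)).continuousAt.continuousWithinAt)
    (fun r hr => hd2 r (hsub r (Set.Ioo_subset_Icc_self hr)))
  have hcm := hsub c (Set.Ioo_subset_Icc_self hc)
  rw [← hc']
  have h1 := Z.dom i c hcm
  have h2 := Z.κ_nonneg i c hcm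
  have h3 : 0 < Z.β i c + Z.A i c := by
    by_contra h
    nlinarith [Z.aL_pos i]
  linarith [hd1 c hcm, hB c hcm]

/-- Two complete bounded solutions cannot have a positive maximal gap inside a period. -/
theorem IsComplete.gap_ne_max {M L : ℝ} {x y : ι → ℝ → ℝ} (hx : Z.IsComplete M x)
    (hy : Z.IsComplete M y) (hL : 0 < L) (hmax : ∀ j s, |Z.gap x y j s| ≤ L * Z.w j)
    {i : ι} {t : ℝ} (ht : t ∈ Set.Ioc 0 Z.ω) : Z.gap x y i t ≠ L * Z.w i := by
  intro heq
  have hw := Z.w_pos i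
  have haL := Z.aL_pos i
  have hlt : y i t < x i t := by
    by_contra h
    have := (gap_bounds (Z := Z) (x := y) (y := x) (not_lt.1 h)).1
    have hU : 0 < Z.aU i := (a_pos i t 0).trans_le (Z.le_aU i t 0)
    have h1 : 0 < Z.aU i * (L * Z.w i) := by positivity
    rw [gap_swap, heq] at this
    linarith [not_lt.1 h]
  obtain ⟨B, hB⟩ := Z.β_bdd i
  set s : ℕ → ℝ := fun k => t - t / (k + 2) with hs
  have hs0 : ∀ k, 0 < s k := fun k => by
    have : t / (k + 2) < t := div_lt_self ht.1 (by have : (0:ℝ) ≤ k := k.cast_nonneg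
                                                   linarith)
    simp only [hs]; linarith
  have hst : ∀ k, s k < t := fun k => by
    have : 0 < t / ((k:ℝ) + 2) := div_pos ht.1 (by positivity)
    simp only [hs]; linarith
  have hslim : Tendsto s atTop (nhds t) := by
    have : Tendsto (fun k : ℕ => t / ((k:ℝ) + 2)) atTop (nhds 0) :=
      tendsto_const_nhds.div_atTop
        (tendsto_atTop_add_const_right _ _ tendsto_natCast_atTop_atTop)
    simpa [hs] using tendsto_const_nhds (x := t) |>.sub this
  set φ : ℝ → ℝ → ℝ := fun s v => (Z.a i s v)⁻¹ with hφ
  have hφc : Continuous fun q : ℝ × ℝ => φ q.1 q.2 := continuous_inv_a i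
  have hφr : ∀ s, Continuous (φ s) := continuous_inv_a_right i
  have hPx := tendsto_integral_div_of_hasDerivAt hφc (hx.2 i t) hslim fun k => (hst k).ne
  have hPy := tendsto_integral_div_of_hasDerivAt hφc (hy.2 i t) hslim fun k => (hst k).ne
  obtain ⟨I, hI, hIlim⟩ := exists_tendsto_integral_upper_bound
    (ψ := fun k v => (φ t v - φ (s k) v) / (t - s k)) (A := Z.A i t) (B := B) hlt.le
    (fun k => ((hφr t).sub (hφr (s k))).div_const _)
    (fun k v => inv_a_sub_le hB v (hs0 k) (hst k) ht.2)
    (fun v => by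
      obtain ⟨da, h1, h2⟩ := Z.a_deriv i v t ht
      refine ⟨-da / Z.a i t v ^ 2, ?_, ?_⟩
      · rw [neg_div, neg_le_neg_iff, le_div_iff₀ (pow_pos (a_pos i t v) 2)]
        exact h2
      · have h3 := (hasDerivAt_iff_tendsto_slope.1 (h1.inv (a_pos i t v).ne')).comp
          (tendsto_nhdsWithin_iff.2 ⟨hslim, Eventually.of_forall fun k => (hst k).ne⟩)
        refine h3.congr fun k => ?_
        simp only [Function.comp, slope_def_field, hφ, Pi.inv_apply]
        rw [← neg_sub (s k) t, div_neg, ← neg_div, neg_sub])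
  have hnonneg : ∀ k, 0 ≤ I k + (∫ v in (x i (s k))..(x i t), φ (s k) v) / (t - s k)
      - (∫ v in (y i (s k))..(y i t), φ (s k) v) / (t - s k) := by
    intro k
    refine le_trans ?_ (sub_le_sub_right (add_le_add_left (hI k) _) _)
    rw [intervalIntegral.integral_div, intervalIntegral.integral_sub
      ((hφr t).intervalIntegrable _ _) ((hφr (s k)).intervalIntegrable _ _)]
    have hii : ∀ p q, IntervalIntegrable (φ (s k)) volume p q := fun p q =>
      (hφr (s k)).intervalIntegrable _ _
    have e1 := intervalIntegral.integral_add_adjacent_intervals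
      (hii (y i (s k)) (y i t)) (hii (y i t) (x i t))
    have e2 := intervalIntegral.integral_add_adjacent_intervals
      (hii (y i (s k)) (x i (s k))) (hii (x i (s k)) (x i t))
    have h1 : Z.gap x y i (s k) ≤ Z.gap x y i t := by
      rw [heq]; exact (le_abs_self _).trans (hmax i (s k))
    simp only [gap] at h1
    rw [← add_div, ← sub_div]
    refine div_nonneg ?_ (sub_nonneg.2 (hst k).le)
    simp only [hφ] at *
    linarith
  have hfin := ge_of_tendsto' ((hIlim.add hPx).sub hPy) hnonneg
  have hR : ∀ z : ι → ℝ → ℝ, φ t (z i t) * Z.R i z t = -(Z.b i t (z i t)) + Z.N i z t := by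
    intro z
    have := (a_pos (Z := Z) i t (z i t)).ne'
    simp only [hφ, R]
    field_simp
  rw [hR, hR] at hfin
  have hN := Z.N_lip i x y M L t ht hx.continuous hy.continuous hx.1 hy.1 hL.le fun j s => by
    refine (abs_gap_bounds (Z := Z) x y j s).1.trans ?_
    have hU : 0 ≤ Z.aU j := ((a_pos j t 0).trans_le (Z.le_aU j t 0)).le
    calc Z.aU j * |Z.gap x y j s| ≤ Z.aU j * (L * Z.w j) := by gcongr; exact hmax j s
      _ = _ := by ring
  have hsec := Z.sector i t ht _ _ hlt
  have hdom := Z.dom i t ht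
  have hκ := Z.κ_nonneg i t ht
  have hpos : 0 < Z.β i t + Z.A i t := by
    by_contra h
    nlinarith
  have hg := (gap_bounds (Z := Z) hlt.le).2
  rw [heq] at hg
  have h1 := (abs_le.1 hN).2
  have h2 := mul_le_mul_of_nonneg_left hg hpos.le
  have h3 : 0 < L * Z.w i := by positivity
  nlinarith

end PeriodicSystem

namespace PeriodicSystem

variable {ι : Type*} {Z : PeriodicSystem ι}

theorem continuous_R {x : ι → ℝ → ℝ} {M : ℝ} (hx : ∀ j, Continuous (x j))
    (hM : ∀ j t, |x j t| ≤ M) (i : ι) : Continuous (Z.R i x) := by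
  have h1 : Continuous fun t => Z.a i t (x i t) :=
    (Z.a_cont i).comp (f := fun t => (t, x i t)) (continuous_id.prodMk (hx i))
  have h2 : Continuous fun t => Z.b i t (x i t) :=
    (Z.b_cont i).comp (f := fun t => (t, x i t)) (continuous_id.prodMk (hx i))
  exact h1.mul (h2.neg.add (Z.N_cont i x M hx hM))

theorem tendsto_R {z : ℕ → ι → ℝ → ℝ} {x : ι → ℝ → ℝ} {M : ℝ} (hz : ∀ k j, Continuous (z k j))
    (hM : ∀ k j s, |z k j s| ≤ M)
    (hlim : ∀ j s, Tendsto (fun k => z k j s) atTop (nhds (x j s))) (i : ι) (t : ℝ) :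
    Tendsto (fun k => Z.R i (z k) t) atTop (nhds (Z.R i x t)) := by
  have h0 : Tendsto (fun k => (t, z k i t)) atTop (nhds (t, x i t)) :=
    tendsto_const_nhds.prodMk_nhds (hlim i t)
  have h1 := ((Z.a_cont i).tendsto (t, x i t)).comp h0
  have h2 := ((Z.b_cont i).tendsto (t, x i t)).comp h0
  exact h1.mul (h2.neg.add (Z.N_lim i z x M t hz hM hlim))

theorem tendsto_gap_integral (i : ι) {s : ℕ → ℝ} {p q : ℕ → ℝ} {s₀ p₀ q₀ : ℝ}
    (hs : Tendsto s atTop (nhds s₀)) (hp : Tendsto p atTop (nhds p₀))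
    (hq : Tendsto q atTop (nhds q₀)) :
    Tendsto (fun k => ∫ v in (q k)..(p k), (Z.a i (s k) v)⁻¹) atTop
      (nhds (∫ v in q₀..p₀, (Z.a i s₀ v)⁻¹)) := by
  have hc : Continuous fun r : ℝ × ℝ => ∫ v in (0:ℝ)..r.2, (Z.a i r.1 v)⁻¹ :=
    intervalIntegral.continuous_parametric_intervalIntegral_of_continuous
      (f := fun (r : ℝ × ℝ) v => (Z.a i r.1 v)⁻¹)
      ((continuous_inv_a i).comp (f := fun r : (ℝ × ℝ) × ℝ => (r.1.1, r.2)) (by fun_prop))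
      continuous_snd
  have h1 := (hc.tendsto (s₀, p₀)).comp (hs.prodMk_nhds hp)
  have h2 := (hc.tendsto (s₀, q₀)).comp (hs.prodMk_nhds hq)
  have hi : ∀ s p q, IntervalIntegrable (fun v => (Z.a i s v)⁻¹) volume p q := fun s p q =>
    (continuous_inv_a_right i s).intervalIntegrable _ _
  have e : ∀ s p q, ∫ v in q..p, (Z.a i s v)⁻¹
      = (∫ v in (0:ℝ)..p, (Z.a i s v)⁻¹) - ∫ v in (0:ℝ)..q, (Z.a i s v)⁻¹ := fun s p q =>
    (intervalIntegral.integral_interval_sub_left (hi _ _ _) (hi _ _ _)).symm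
  rw [e s₀]
  exact (h1.sub h2).congr fun k => (e _ _ _).symm

/-- Approximate solutions on expanding intervals are eventually equi-Lipschitz. -/
theorem eventually_lipschitz {z x : ℕ → ι → ℝ → ℝ} {M C : ℝ} (hz : ∀ k i, Continuous (z k i))
    (hzM : ∀ k i t, |z k i t| ≤ M)
    (hC : ∀ i x, (∀ j, Continuous (x j)) → (∀ j t, |x j t| ≤ M) → ∀ t, |Z.R i x t| ≤ C)
    (hd : ∀ T ε : ℝ, 0 < ε → ∀ᶠ k in atTop, ∀ i, ∀ t ∈ Set.Icc (-T) T,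
      ∃ D, HasDerivAt (x k i) D t ∧ |D - Z.R i (z k) t| ≤ ε) (T : ℝ) :
    ∀ᶠ k in atTop, ∀ i, ∀ s ∈ Set.Icc (-T) T, ∀ t ∈ Set.Icc (-T) T,
      |x k i t - x k i s| ≤ (C + 1) * |t - s| := by
  filter_upwards [hd T 1 one_pos] with k hk i s hs t ht
  choose! D h1 h2 using hk i
  refine Convex.norm_image_sub_le_of_norm_hasDerivWithin_le (s := Set.Icc (-T) T)
    (fun r hr => (h1 r hr).hasDerivWithinAt) (fun r hr => ?_) (convex_Icc _ _) hs ht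
  have h3 := hC i (z k) (hz k) (hzM k) r
  have h4 := h2 r hr
  rw [Real.norm_eq_abs]
  calc |D r| = |(D r - Z.R i (z k) r) + Z.R i (z k) r| := by ring_nf
    _ ≤ _ := (abs_add_le _ _).trans (by linarith)

/-- A pointwise bounded, locally equi-Lipschitz sequence has a pointwise convergent
subsequence. -/
theorem exists_pointwise_limit [Finite ι] {z x : ℕ → ι → ℝ → ℝ} {M K : ℝ}
    (hzM : ∀ k i t, |z k i t| ≤ M)
    (hxz : ∀ i t, Tendsto (fun k => x k i t - z k i t) atTop (nhds 0))
    (hlip : ∀ T : ℝ, ∀ᶠ k in atTop, ∀ i, ∀ s ∈ Set.Icc (-T) T, ∀ t ∈ Set.Icc (-T) T,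
      |x k i t - x k i s| ≤ K * |t - s|) :
    ∃ φ : ℕ → ℕ, StrictMono φ ∧ ∃ X : ι → ℝ → ℝ,
      ∀ i t, Tendsto (fun k => x (φ k) i t) atTop (nhds (X i t)) := by
  have hcomp : IsCompact (Set.pi Set.univ fun _ : ι × ℚ => Set.Icc (-M) M) :=
    isCompact_univ_pi fun _ => isCompact_Icc
  obtain ⟨y, -, φ, hφ, hy⟩ := hcomp.tendsto_subseq (x := fun k (p : ι × ℚ) => z k p.1 p.2)
    fun k p _ => abs_le.1 (hzM k p.1 p.2)
  have hq : ∀ i (q : ℚ), Tendsto (fun k => x (φ k) i q) atTop (nhds (y (i, q))) := by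
    intro i q
    have h1 := (tendsto_pi_nhds.1 hy) (i, q)
    have h2 := (hxz i q).comp hφ.tendsto_atTop
    simpa [Function.comp_def] using h1.add h2
  refine ⟨φ, hφ, ?_⟩
  have hcau : ∀ i t, ∃ ℓ, Tendsto (fun k => x (φ k) i t) atTop (nhds ℓ) := by
    intro i t
    refine cauchySeq_tendsto_of_complete (Metric.cauchySeq_iff'.2 fun ε hε => ?_)
    have hK : 0 < |K| + 1 := by positivity
    obtain ⟨q, hq1, hq2⟩ := exists_rat_btwn (show t < t + ε / (8 * (|K| + 1)) by
      linarith [show 0 < ε / (8 * (|K| + 1)) by positivity])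
    have hqt : |t - q| ≤ ε / (8 * (|K| + 1)) := by
      rw [abs_le]; constructor <;> linarith
    have hsmall : K * |t - q| ≤ ε / 8 := by
      calc K * |t - q| ≤ (|K| + 1) * (ε / (8 * (|K| + 1))) := by
            gcongr
            linarith [le_abs_self K]
        _ = ε / 8 := by field_simp
    have hT := hφ.tendsto_atTop.eventually (hlip (max |t| |(q:ℝ)|))
    have hc := Metric.cauchySeq_iff.1 (hq i q).cauchySeq (ε / 4) (by positivity)
    obtain ⟨N1, hN1⟩ := hc
    obtain ⟨N2, hN2⟩ := eventually_atTop.1 hT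
    have ht : t ∈ Set.Icc (-(max |t| |(q:ℝ)|)) (max |t| |(q:ℝ)|) :=
      abs_le.1 (le_max_left _ _)
    have hqm : (q:ℝ) ∈ Set.Icc (-(max |t| |(q:ℝ)|)) (max |t| |(q:ℝ)|) :=
      abs_le.1 (le_max_right _ _)
    refine ⟨max N1 N2, fun n hn => ?_⟩
    have a1 := hN1 n ((le_max_left _ _).trans hn) (max N1 N2) (le_max_left _ _)
    have a2 := hN2 n ((le_max_right _ _).trans hn) i q hqm t ht
    have a3 := hN2 (max N1 N2) (le_max_right _ _) i q hqm t ht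
    rw [Real.dist_eq] at a1 ⊢
    have b1 := abs_lt.1 a1
    have b2 := abs_le.1 a2
    have b3 := abs_le.1 a3
    rw [abs_lt]
    constructor <;> linarith
  choose X hX using hcau
  exact ⟨X, hX⟩

/-- Approximate solutions on expanding intervals subconverge to a complete solution. -/
theorem exists_complete_limit [Finite ι] {z x : ℕ → ι → ℝ → ℝ} {M : ℝ}
    (hz : ∀ k i, Continuous (z k i)) (hzM : ∀ k i t, |z k i t| ≤ M)
    (hxz : ∀ i t, Tendsto (fun k => x k i t - z k i t) atTop (nhds 0))
    (hd : ∀ T ε : ℝ, 0 < ε → ∀ᶠ k in atTop, ∀ i, ∀ t ∈ Set.Icc (-T) T,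
      ∃ D, HasDerivAt (x k i) D t ∧ |D - Z.R i (z k) t| ≤ ε) :
    ∃ φ : ℕ → ℕ, StrictMono φ ∧ ∃ X : ι → ℝ → ℝ, Z.IsComplete M X ∧
      ∀ i (ψ : ℕ → ℕ) (s : ℕ → ℝ) s₀, Tendsto ψ atTop atTop → Tendsto s atTop (nhds s₀) →
        Tendsto (fun k => x (φ (ψ k)) i (s k)) atTop (nhds (X i s₀)) := by
  obtain ⟨C, hC⟩ := Z.bounded M
  have hlip := eventually_lipschitz hz hzM hC hd
  obtain ⟨φ, hφ, X, hX⟩ := exists_pointwise_limit hzM hxz hlip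
  have hzX : ∀ i t, Tendsto (fun k => z (φ k) i t) atTop (nhds (X i t)) := fun i t => by
    simpa using (hX i t).sub ((hxz i t).comp hφ.tendsto_atTop)
  have hXM : ∀ i t, |X i t| ≤ M := fun i t =>
    le_of_tendsto' (hzX i t).abs fun k => hzM _ _ _
  have hXlip : ∀ i s t, |X i t - X i s| ≤ (C + 1) * |t - s| := by
    intro i s t
    refine le_of_tendsto ((hX i t).sub (hX i s)).abs ?_
    filter_upwards [hφ.tendsto_atTop.eventually (hlip (max |s| |t|))] with k hk
    exact hk i s (abs_le.1 (le_max_left _ _)) t (abs_le.1 (le_max_right _ _))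
  have hC0 : ∀ i : ι, 0 ≤ C + 1 := fun i =>
    (abs_nonneg (X i 1 - X i 0)).trans (by simpa using hXlip i 0 1)
  have hXc : ∀ i, Continuous (X i) := fun i =>
    (LipschitzWith.of_dist_le_mul (K := ⟨C + 1, hC0 i⟩) fun s t => by
      rw [Real.dist_eq, Real.dist_eq]; exact hXlip i t s).continuous
  have hint : ∀ i t, X i t - X i 0 = ∫ r in (0:ℝ)..t, Z.R i X r := by
    intro i t
    have h1 : Tendsto (fun k => ∫ r in (0:ℝ)..t, Z.R i (z (φ k)) r) atTop
        (nhds (∫ r in (0:ℝ)..t, Z.R i X r)) := by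
      refine intervalIntegral.tendsto_integral_filter_of_dominated_convergence (fun _ => C)
        ?_ ?_ (by simp) ?_
      · exact Eventually.of_forall fun k =>
          (continuous_R (hz _) (hzM _) i).aestronglyMeasurable
      · exact Eventually.of_forall fun k => Eventually.of_forall fun r _ =>
          hC i _ (hz _) (hzM _) r
      · exact Eventually.of_forall fun r _ =>
          tendsto_R (fun k => hz _) (fun k => hzM _) hzX i r
    have h2 := (hX i t).sub (hX i 0)
    refine tendsto_nhds_unique h2 (?_ : Tendsto _ _ _)
    have h3 : Tendsto (fun k => (x (φ k) i t - x (φ k) i 0)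
        - ∫ r in (0:ℝ)..t, Z.R i (z (φ k)) r) atTop (nhds 0) := by
      rw [Metric.tendsto_atTop']
      intro ε hε
      have hε' : 0 < ε / (2 * (|t| + 1)) := by positivity
      obtain ⟨n, hn⟩ := eventually_atTop.1
        (hφ.tendsto_atTop.eventually (hd |t| (ε / (2 * (|t| + 1))) hε'))
      refine ⟨n, fun k hk => ?_⟩
      choose! D h4 h5 using hn k hk.le i
      have h6 := Convex.norm_image_sub_le_of_norm_hasDerivWithin_le
        (f := fun r => x (φ k) i r - ∫ u in (0:ℝ)..r, Z.R i (z (φ k)) u)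
        (s := Set.Icc (-|t|) |t|) (x := 0) (y := t)
        (fun r hr => ((h4 r hr).sub ((continuous_R (hz _) (hzM _)
          i).integral_hasStrictDerivAt 0 r).hasDerivAt).hasDerivWithinAt)
        (fun r hr => h5 r hr) (convex_Icc _ _) ⟨by simp, by simp⟩ (abs_le.1 le_rfl)
      simp only [intervalIntegral.integral_same, sub_zero, Real.norm_eq_abs] at h6
      rw [Real.dist_eq, sub_zero]
      calc _ = |(x (φ k) i t - ∫ r in (0:ℝ)..t, Z.R i (z (φ k)) r) - x (φ k) i 0| := by
            congr 1; ring
        _ ≤ ε / (2 * (|t| + 1)) * |t| := h6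
        _ ≤ ε / (2 * (|t| + 1)) * (|t| + 1) := by gcongr; linarith
        _ = ε / 2 := by field_simp
        _ < ε := by linarith
    simpa using h3.add h1
  refine ⟨φ, hφ, X, ⟨hXM, fun i t => ?_⟩, fun i ψ s s₀ hψ hs => ?_⟩
  · have h1 : X i = fun t => X i 0 + ∫ r in (0:ℝ)..t, Z.R i X r := by
      funext t; rw [← hint]; ring
    rw [h1]
    exact (((continuous_R hXc hXM i).integral_hasStrictDerivAt 0 t).hasDerivAt).const_add _
  · have h1 : Tendsto (fun k => x (φ (ψ k)) i (s k) - x (φ (ψ k)) i s₀) atTop (nhds 0) := by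
      refine squeeze_zero_norm' (a := fun k => (C + 1) * |s k - s₀|) ?_ ?_
      · have e1 := (hφ.tendsto_atTop.comp hψ).eventually (hlip (|s₀| + 1))
        have e2 := hs.eventually (Metric.ball_mem_nhds s₀ one_pos)
        filter_upwards [e1, e2] with k hk1 hk2
        replace hk2 : |s k - s₀| < 1 := hk2
        have hk3 := abs_lt.1 hk2
        refine hk1 i s₀ ⟨?_, ?_⟩ (s k) ⟨?_, ?_⟩
        · linarith [neg_abs_le s₀]
        · linarith [le_abs_self s₀]
        · linarith [neg_abs_le s₀]
        · linarith [le_abs_self s₀]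
      · have := ((hs.sub_const s₀).abs).const_mul (C + 1)
        simpa using this
    simpa using h1.add ((hX i s₀).comp hψ)

/-- Translates of complete solutions subconverge. -/
theorem IsComplete.exists_limit_shift [Finite ι] {M : ℝ} {x : ι → ℝ → ℝ}
    (hx : Z.IsComplete M x) (m : ℕ → ℤ) :
    ∃ φ : ℕ → ℕ, StrictMono φ ∧ ∃ X : ι → ℝ → ℝ, Z.IsComplete M X ∧
      ∀ i (ψ : ℕ → ℕ) (s : ℕ → ℝ) s₀, Tendsto ψ atTop atTop → Tendsto s atTop (nhds s₀) →
        Tendsto (fun k => x i (s k + m (φ (ψ k)) * Z.ω)) atTop (nhds (X i s₀)) :=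
  exists_complete_limit (z := fun k i t => x i (t + m k * Z.ω))
    (x := fun k i t => x i (t + m k * Z.ω)) (fun k i => (hx.shift (m k)).continuous i)
    (fun k => (hx.shift (m k)).1) (fun i t => by simp)
    (fun T ε hε => Eventually.of_forall fun k i t _ =>
      ⟨_, (hx.shift (m k)).2 i t, by simpa using hε.le⟩)

/-- The maximal gap between two complete solutions cannot be attained and positive. -/
theorem IsComplete.abs_gap_ne_max {M L : ℝ} {x y : ι → ℝ → ℝ} (hx : Z.IsComplete M x)
    (hy : Z.IsComplete M y) (hL : 0 < L) (hmax : ∀ j s, |Z.gap x y j s| ≤ L * Z.w j)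
    (i : ι) (t : ℝ) : |Z.gap x y i t| ≠ L * Z.w i := by
  intro h
  obtain ⟨m, hm, -⟩ := existsUnique_add_zsmul_mem_Ioc Z.ω_pos t 0
  rw [zero_add, zsmul_eq_mul] at hm
  have key : ∀ x y : ι → ℝ → ℝ, Z.IsComplete M x → Z.IsComplete M y →
      (∀ j s, |Z.gap x y j s| ≤ L * Z.w j) → Z.gap x y i t ≠ L * Z.w i := by
    intro x y hx hy hmax h
    refine (hx.shift (-m)).gap_ne_max (hy.shift (-m)) hL (fun j s => ?_) hm (i := i) ?_
    · rw [gap_shift]; exact hmax j _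
    · rw [gap_shift, ← h]; congr 1; push_cast; ring
  rcases abs_choice (Z.gap x y i t) with h1 | h1
  · exact key x y hx hy hmax (h1 ▸ h)
  · refine key y x hy hx (fun j s => ?_) ?_
    · rw [gap_swap, abs_neg]; exact hmax j s
    · rw [gap_swap, ← h1, h]

/-- Complete bounded solutions are unique. -/
theorem IsComplete.unique [Finite ι] {M : ℝ} {x y : ι → ℝ → ℝ} (hx : Z.IsComplete M x)
    (hy : Z.IsComplete M y) : x = y := by
  rcases isEmpty_or_nonempty ι with hι | hι
  · exact Subsingleton.elim _ _
  set f : ι → ℝ → ℝ := fun i t => |Z.gap x y i t| / Z.w i with hf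
  have hbdd : ∀ i, BddAbove (Set.range (f i)) := by
    intro i
    refine ⟨2 * M / Z.aL i / Z.w i, ?_⟩
    rintro _ ⟨t, rfl⟩
    simp only [hf]
    have hw := Z.w_pos i
    have haL := Z.aL_pos i
    have h1 := (abs_gap_bounds (Z := Z) x y i t).2
    have h2 := abs_sub (x i t) (y i t)
    gcongr
    rw [le_div_iff₀ haL]
    linarith [hx.1 i t, hy.1 i t]
  obtain ⟨i, hi⟩ := Finite.exists_max fun i => sSup (Set.range (f i))
  set L := sSup (Set.range (f i)) with hL
  have hle : ∀ j s, |Z.gap x y j s| ≤ L * Z.w j := fun j s => by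
    rw [← div_le_iff₀ (Z.w_pos j)]
    exact (le_csSup (hbdd j) ⟨s, rfl⟩).trans (hi j)
  rcases le_or_gt L 0 with h0 | h0
  · funext j s
    have h1 := hle j s
    have h2 : |Z.gap x y j s| ≤ 0 := h1.trans (mul_nonpos_of_nonpos_of_nonneg h0 (Z.w_pos j).le)
    have h3 := (abs_gap_bounds (Z := Z) x y j s).1
    rw [le_antisymm h2 (abs_nonneg _), mul_zero] at h3
    exact sub_eq_zero.1 (abs_eq_zero.1 (le_antisymm h3 (abs_nonneg _)))
  exfalso
  obtain ⟨u, -, hu, hmem⟩ := exists_seq_tendsto_sSup (Set.range_nonempty (f i)) (hbdd i)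
  choose t ht using hmem
  have hfl : ∀ k, ∃ m : ℤ, t k - m * Z.ω ∈ Set.Icc 0 Z.ω := fun k => by
    obtain ⟨m, hm, -⟩ := existsUnique_sub_zsmul_mem_Ioc Z.ω_pos (t k) 0
    rw [zero_add, zsmul_eq_mul] at hm
    exact ⟨m, Set.Ioc_subset_Icc_self hm⟩
  choose m hm using hfl
  obtain ⟨s₀, -, φ, hφ, hs⟩ := isCompact_Icc.tendsto_subseq hm
  obtain ⟨φ₁, hφ₁, X, hX, hXlim⟩ := hx.exists_limit_shift (m ∘ φ)
  obtain ⟨φ₂, hφ₂, Y, hY, hYlim⟩ := hy.exists_limit_shift (m ∘ φ ∘ φ₁)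
  have hgap : ∀ j (s : ℕ → ℝ) s₀, Tendsto s atTop (nhds s₀) →
      Tendsto (fun k => |Z.gap x y j (s k + m (φ (φ₁ (φ₂ k))) * Z.ω)|) atTop
        (nhds |Z.gap X Y j s₀|) := by
    intro j s s₀ hs
    have h1 := hXlim j φ₂ s s₀ hφ₂.tendsto_atTop hs
    have h2 := hYlim j id s s₀ tendsto_id hs
    simp only [Function.comp_def, id] at h1 h2
    have h3 := tendsto_gap_integral (Z := Z) j hs h1 h2
    refine h3.abs.congr fun k => ?_
    simp only [gap, Z.a_per]
  have hψ := (hφ₁.comp hφ₂).tendsto_atTop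
  refine hX.abs_gap_ne_max hY h0 (fun j s => ?_) i s₀ ?_
  · exact le_of_tendsto' (hgap j (fun _ => s) s tendsto_const_nhds) fun k => hle _ _
  · have h1 := hgap i _ s₀ (hs.comp hψ)
    have h2 := (hu.comp (hφ.tendsto_atTop.comp hψ)).mul_const (Z.w i)
    refine tendsto_nhds_unique h1 (h2.congr fun k => ?_)
    simp only [Function.comp, ← ht, hf, sub_add_cancel]
    rw [div_mul_cancel₀ _ (Z.w_pos i).ne']

theorem IsComplete.mono {M M' : ℝ} {x : ι → ℝ → ℝ} (hx : Z.IsComplete M x) (h : M ≤ M') :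
    Z.IsComplete M' x :=
  ⟨fun i t => (hx.1 i t).trans h, hx.2⟩

/-- Bounded asymptotic solutions converge to a complete bounded solution. -/
theorem IsComplete.tendsto [Finite ι] {M : ℝ} {y x : ι → ℝ → ℝ} (hy : Z.IsComplete M y)
    (hxc : ∀ i, Continuous (x i)) (hxM : ∀ i t, |x i t| ≤ M)
    (hx : ∀ ε : ℝ, 0 < ε → ∀ᶠ t in atTop, ∀ i, ∃ D, HasDerivAt (x i) D t ∧ |D - Z.R i x t| ≤ ε)
    (i : ι) : Tendsto (fun t => |x i t - y i t|) atTop (nhds 0) := by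
  by_contra hcon
  have hper : ∀ (m : ℤ) t, y i (t + m * Z.ω) = y i t := fun m t =>
    congrFun (congrFun ((hy.shift m).unique hy) i) t
  obtain ⟨ε, hε, hfr⟩ : ∃ ε > 0, ∀ n : ℕ, ∃ t ≥ (n:ℝ), ε ≤ |x i t - y i t| := by
    rw [Metric.tendsto_atTop] at hcon
    push Not at hcon
    obtain ⟨ε, hε, h⟩ := hcon
    refine ⟨ε, hε, fun n => ?_⟩
    obtain ⟨t, ht, h⟩ := h n
    exact ⟨t, ht, by simpa using h⟩
  choose t ht hgap using hfr
  have hfl : ∀ k, ∃ m : ℤ, t k - m * Z.ω ∈ Set.Icc 0 Z.ω := fun k => by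
    obtain ⟨m, hm, -⟩ := existsUnique_sub_zsmul_mem_Ioc Z.ω_pos (t k) 0
    rw [zero_add, zsmul_eq_mul] at hm
    exact ⟨m, Set.Ioc_subset_Icc_self hm⟩
  choose m hm using hfl
  obtain ⟨s₀, -, φ, hφ, hs⟩ := isCompact_Icc.tendsto_subseq hm
  have hmtop : Tendsto (fun k => (m (φ k) : ℝ) * Z.ω) atTop atTop := by
    have : Tendsto (fun k => (m k : ℝ) * Z.ω) atTop atTop := by
      refine tendsto_atTop_mono (f := fun k : ℕ => (k:ℝ) + -Z.ω) (fun k => ?_)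
        (tendsto_atTop_add_const_right _ _ tendsto_natCast_atTop_atTop)
      linarith [ht k, (hm k).2]
    exact this.comp hφ.tendsto_atTop
  obtain ⟨φ₁, hφ₁, X, hX, hlim⟩ := exists_complete_limit (Z := Z)
    (z := fun k i t => x i (t + m (φ k) * Z.ω)) (x := fun k i t => x i (t + m (φ k) * Z.ω))
    (M := M) (fun k j => (hxc j).comp (by fun_prop)) (fun k j s => hxM _ _)
    (fun i t => by simp) (fun T δ hδ => by
      obtain ⟨T₁, hT₁⟩ := eventually_atTop.1 (hx δ hδ)
      filter_upwards [hmtop.eventually_ge_atTop (T₁ + T)] with k hk j s hs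
      obtain ⟨D, h1, h2⟩ := hT₁ (s + m (φ k) * Z.ω) (by linarith [hs.1]) j
      refine ⟨D, h1.comp_add_const s _, ?_⟩
      rwa [← R_add_period])
  have hXy : X = y := hX.unique hy
  have h1 := hlim i id _ s₀ tendsto_id (hs.comp hφ₁.tendsto_atTop)
  have h2 := ((hy.continuous i).tendsto s₀).comp (hs.comp hφ₁.tendsto_atTop)
  have h3 := (h1.sub h2).abs
  rw [hXy, sub_self, abs_zero] at h3
  refine absurd (ge_of_tendsto' h3 fun k => ?_) (not_le.2 hε)
  simp only [Function.comp, id, sub_add_cancel]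
  have := hgap (φ (φ₁ k))
  rwa [← hper (m (φ (φ₁ k))), sub_add_cancel]

end PeriodicSystem

namespace PeriodicSystem

variable {ι : Type*} {Z : PeriodicSystem ι}

/-- Truncation of the components to `[-K * w j, K * w j]`, evaluated with a small delay. -/
def delayClip (Z : PeriodicSystem ι) (K δ : ℝ) (x : ι → ℝ → ℝ) : ι → ℝ → ℝ :=
  fun j s => max (-(K * Z.w j)) (min (K * Z.w j) (x j (s - δ)))

theorem continuous_delayClip {K δ : ℝ} {x : ι → ℝ → ℝ} (hx : ∀ j, Continuous (x j)) (j : ι) :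
    Continuous (Z.delayClip K δ x j) := by
  have := (hx j).comp (f := fun s => s - δ) (by fun_prop)
  exact continuous_const.max (continuous_const.min this)

theorem abs_delayClip_le {K δ : ℝ} (hK : 0 ≤ K) (x : ι → ℝ → ℝ) (j : ι) (s : ℝ) :
    |Z.delayClip K δ x j s| ≤ K * Z.w j := by
  have : 0 ≤ K * Z.w j := mul_nonneg hK (Z.w_pos j).le
  exact abs_le.2 ⟨le_max_left _ _, max_le (by linarith) (min_le_left _ _)⟩

/-- Tonelli iteration for the delayed and truncated system, started from rest at time `a`. -/
noncomputable def tonelli (Z : PeriodicSystem ι) (K δ a : ℝ) : ℕ → ι → ℝ → ℝ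
  | 0 => fun _ _ => 0
  | m + 1 => fun i t => ∫ s in a..(max t a), Z.R i (Z.delayClip K δ (tonelli Z K δ a m)) s

theorem tonelli_succ (K δ a : ℝ) (m : ℕ) (i : ι) (t : ℝ) : Z.tonelli K δ a (m + 1) i t =
    ∫ s in a..(max t a), Z.R i (Z.delayClip K δ (Z.tonelli K δ a m)) s := rfl

theorem tonelli_succ_eq {K δ a : ℝ} (m : ℕ) (i : ι) {t : ℝ} (ht : t ≤ a + m * δ) :
    Z.tonelli K δ a (m + 1) i t = Z.tonelli K δ a m i t := by
  induction m generalizing i t with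
  | zero =>
    have : max t a = a := max_eq_right (by simpa using ht)
    simp [tonelli, this]
  | succ m ih =>
    rw [tonelli_succ, tonelli_succ]
    rcases le_total t a with h | h
    · simp [max_eq_right h]
    · rw [max_eq_left h]
      refine intervalIntegral.integral_congr fun s hs => ?_
      rw [Set.uIcc_of_le h] at hs
      have hcl : ∀ j, ∀ r ≤ s, Z.delayClip K δ (Z.tonelli K δ a (m + 1)) j r
          = Z.delayClip K δ (Z.tonelli K δ a m) j r := by
        intro j r hr
        simp only [delayClip]
        rw [ih j]
        push_cast at ht
        linarith [hs.2]
      simp only [R]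
      rw [hcl i s le_rfl, Z.N_causal i _ _ s hcl]

section

variable {K δ a M C : ℝ} (hK : 0 ≤ K) (hM : ∀ j, K * Z.w j ≤ M)
  (hC : ∀ i x, (∀ j, Continuous (x j)) → (∀ j t, |x j t| ≤ M) → ∀ t, |Z.R i x t| ≤ C)
include hK hM

theorem continuous_R_delayClip {x : ι → ℝ → ℝ} (hx : ∀ j, Continuous (x j)) (i : ι) :
    Continuous (Z.R i (Z.delayClip K δ x)) :=
  continuous_R (continuous_delayClip hx)
    (fun j t => (abs_delayClip_le hK x j t).trans (hM j)) i

theorem continuous_tonelli (m : ℕ) (i : ι) : Continuous (Z.tonelli K δ a m i) := by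
  induction m generalizing i with
  | zero => exact continuous_const
  | succ m ih =>
    exact (intervalIntegral.continuous_primitive (fun p q =>
      (continuous_R_delayClip hK hM ih i).intervalIntegrable p q) a).comp
      (continuous_id.max continuous_const)

theorem hasDerivAt_tonelli (m : ℕ) (i : ι) {t : ℝ} (ht : a < t) :
    HasDerivAt (Z.tonelli K δ a (m + 1) i)
      (Z.R i (Z.delayClip K δ (Z.tonelli K δ a m)) t) t := by
  have h := ((continuous_R_delayClip (δ := δ) hK hM
    (continuous_tonelli (δ := δ) (a := a) hK hM m) i).integral_hasStrictDerivAt a t).hasDerivAt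
  refine h.congr_of_eventuallyEq ?_
  filter_upwards [lt_mem_nhds ht] with s hs
  rw [tonelli_succ, max_eq_left hs.le]

include hC

theorem tonelli_lipschitz (m : ℕ) (i : ι) (s t : ℝ) :
    |Z.tonelli K δ a (m + 1) i t - Z.tonelli K δ a (m + 1) i s| ≤ C * |t - s| := by
  have hc := continuous_tonelli (δ := δ) (a := a) hK hM m
  have hb : ∀ r, |Z.R i (Z.delayClip K δ (Z.tonelli K δ a m)) r| ≤ C := hC i _
    (continuous_delayClip hc) fun j r => (abs_delayClip_le hK _ j r).trans (hM j)
  have hi : ∀ p q, IntervalIntegrable (Z.R i (Z.delayClip K δ (Z.tonelli K δ a m))) volume p q :=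
    fun p q => (continuous_R_delayClip hK hM hc i).intervalIntegrable p q
  rw [tonelli_succ, tonelli_succ, intervalIntegral.integral_interval_sub_left (hi _ _) (hi _ _)]
  have hC0 : 0 ≤ C := (abs_nonneg _).trans (hb 0)
  have h := intervalIntegral.norm_integral_le_of_norm_le_const (a := max s a) (b := max t a)
    (C := C) (f := Z.R i (Z.delayClip K δ (Z.tonelli K δ a m))) fun r _ => hb r
  rw [Real.norm_eq_abs] at h
  exact h.trans (mul_le_mul_of_nonneg_left (abs_max_sub_max_le_abs t s a) hC0)

theorem tonelli_bound (hK0 : 0 < K) (hδ : 0 < δ)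
    (hdis : ∀ i x, (∀ j, Continuous (x j)) → (∀ j s, |x j s| ≤ K * Z.w j) →
      ∀ t, |x i t| = K * Z.w i → x i t * (-(Z.b i t (x i t)) + Z.N i x t) < 0)
    (m : ℕ) (i : ι) {t : ℝ} (ht : t ≤ a + m * δ) :
    |Z.tonelli K δ a (m + 1) i t| ≤ K * Z.w i + C * δ := by
  set u := Z.tonelli K δ a (m + 1) with hu
  have hw := Z.w_pos i
  have hKw : 0 < K * Z.w i := by positivity
  have hC0 : 0 ≤ C := (abs_nonneg _).trans (tonelli_lipschitz (δ := δ) (a := a) hK hM hC m i 0 1)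
    |>.trans_eq (by simp)
  have hua : ∀ r ≤ a, u i r = 0 := fun r hr => by simp [hu, tonelli, max_eq_right hr]
  rcases le_or_gt t a with h | h
  · rw [hua t h, abs_zero]; positivity
  have hcont : Continuous (u i) := continuous_tonelli hK hM (m + 1) i
  have hlip := tonelli_lipschitz (δ := δ) (a := a) hK hM hC m i
  rw [← hu] at hlip
  refine abs_le_of_sq_le_sq ?_ (by positivity)
  have hder : ∀ r, a < r → HasDerivAt (fun r => u i r ^ 2)
      (2 * u i r * Z.R i (Z.delayClip K δ (Z.tonelli K δ a m)) r) r := fun r hr => by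
    simpa using (hasDerivAt_tonelli (δ := δ) hK hM m i hr).fun_pow 2
  by_contra hcon
  rw [not_le] at hcon
  have hsq : Continuous fun r => u i r ^ 2 := hcont.pow 2
  obtain ⟨p, hp, hpB⟩ := intermediate_value_Icc h.le hsq.continuousOn
    (show (K * Z.w i + C * δ) ^ 2 ∈ Set.Icc (u i a ^ 2) (u i t ^ 2) from
      ⟨by rw [hua a le_rfl, zero_pow two_ne_zero]; positivity, hcon.le⟩)
  have hap : a < p := by
    rcases hp.1.eq_or_lt with h1 | h1
    · have h2 : 0 < (K * Z.w i + C * δ) ^ 2 := by positivity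
      rw [← h1] at hpB
      simp only [hua a le_rfl] at hpB
      linarith [hpB, h2]
    · exact h1
  have hle := image_le_of_deriv_right_lt_deriv_boundary (a := p) (b := t) hsq.continuousOn
    (f' := fun r => 2 * u i r * Z.R i (Z.delayClip K δ (Z.tonelli K δ a m)) r)
    (fun r hr => (hder r (hap.trans_le hr.1)).hasDerivWithinAt)
    (B := fun _ => (K * Z.w i + C * δ) ^ 2) (B' := fun _ => 0) hpB.le
    (fun r => hasDerivAt_const _ _) (fun r hr hB => ?_) (x := t) ⟨hp.2, le_rfl⟩
  · linarith
  · have hr' : r - δ ≤ a + m * δ := by linarith [hr.2]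
    have he : Z.tonelli K δ a m i (r - δ) = u i (r - δ) :=
      (tonelli_succ_eq m i hr').symm
    have h1 := abs_le.1 (hlip (r - δ) r)
    rw [sub_sub_cancel, abs_of_pos hδ] at h1
    have hd := hdis i (Z.delayClip K δ (Z.tonelli K δ a m))
      (continuous_delayClip (continuous_tonelli hK hM m)) (abs_delayClip_le hK _) r
    have hapos := a_pos (Z := Z) i r (Z.delayClip K δ (Z.tonelli K δ a m) i r)
    have hCδ : 0 ≤ C * δ := by positivity
    rcases sq_eq_sq_iff_eq_or_eq_neg.1 hB with h2 | h2
    · have hv : Z.delayClip K δ (Z.tonelli K δ a m) i r = K * Z.w i := by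
        simp only [delayClip, he]
        rw [min_eq_left (by linarith), max_eq_right (by linarith)]
      rw [hv] at hd hapos
      have h3 := hd (abs_of_pos hKw)
      have h4 : -(Z.b i r (K * Z.w i)) + Z.N i (Z.delayClip K δ (Z.tonelli K δ a m)) r < 0 := by
        by_contra h; nlinarith
      simp only [R]
      rw [hv, h2]
      have h5 : 0 < 2 * (K * Z.w i + C * δ) := by positivity
      exact mul_neg_of_pos_of_neg h5 (mul_neg_of_pos_of_neg hapos h4)
    · have hv : Z.delayClip K δ (Z.tonelli K δ a m) i r = -(K * Z.w i) := by
        simp only [delayClip, he]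
        rw [min_eq_right (by linarith), max_eq_left (by linarith)]
      rw [hv] at hd hapos
      have h3 := hd (by rw [abs_neg, abs_of_pos hKw])
      have h4 : 0 < -(Z.b i r (-(K * Z.w i)))
          + Z.N i (Z.delayClip K δ (Z.tonelli K δ a m)) r := by
        by_contra h; nlinarith
      simp only [R]
      rw [hv, h2]
      have h5 : 2 * -(K * Z.w i + C * δ) < 0 := by linarith
      exact mul_neg_of_neg_of_pos h5 (mul_pos hapos h4)

end

/-- Existence of a complete bounded solution. -/
theorem exists_complete [Finite ι] : ∃ M x, Z.IsComplete M x := by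
  obtain ⟨K, hK, hdis⟩ := Z.dissip
  obtain ⟨M, hM⟩ : ∃ M, ∀ j, K * Z.w j ≤ M := by
    obtain ⟨M, hM⟩ := (Set.finite_range fun j => K * Z.w j).bddAbove
    exact ⟨M, fun j => hM ⟨j, rfl⟩⟩
  obtain ⟨C, hC⟩ := Z.bounded M
  set δ : ℕ → ℝ := fun k => 1 / ((k:ℝ) + 1) with hδ
  have hδ0 : ∀ k, 0 < δ k := fun k => Nat.one_div_pos_of_nat
  have hδlim : Tendsto δ atTop (nhds 0) := tendsto_one_div_add_atTop_nhds_zero_nat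
  set m : ℕ → ℕ := fun k => 2 * k * (k + 1) with hm
  have hmδ : ∀ k : ℕ, -(k:ℝ) + m k * δ k = k := fun k => by
    have : (k:ℝ) + 1 ≠ 0 := by positivity
    simp only [hm, hδ]
    push_cast
    field_simp
    ring
  set z : ℕ → ι → ℝ → ℝ := fun k => Z.delayClip K (δ k) (Z.tonelli K (δ k) (-k) (m k)) with hz
  set x : ℕ → ι → ℝ → ℝ := fun k => Z.tonelli K (δ k) (-k) (m k + 1) with hx
  obtain ⟨-, -, X, hX, -⟩ := exists_complete_limit (Z := Z) (z := z) (x := x) (M := M)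
    (fun k i => continuous_delayClip (continuous_tonelli hK.le hM _) i)
    (fun k i t => (abs_delayClip_le hK.le _ i t).trans (hM i))
    (fun i t => by
      refine squeeze_zero_norm' (a := fun k => 2 * C * δ k) ?_ (by
        simpa using hδlim.const_mul (2 * C))
      filter_upwards [tendsto_natCast_atTop_atTop.eventually_ge_atTop t] with k hk
      have ht : t - δ k ≤ -(k:ℝ) + m k * δ k := by linarith [hmδ k, hδ0 k]
      have h1 := tonelli_bound hK.le hM hC hK (hδ0 k) hdis (m k) i ht
      have h2 := tonelli_lipschitz (δ := δ k) (a := -(k:ℝ)) hK.le hM hC (m k) i (t - δ k) t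
      rw [sub_sub_cancel, abs_of_pos (hδ0 k)] at h2
      have h3 := tonelli_succ_eq (Z := Z) (K := K) (δ := δ k) (a := -(k:ℝ)) (m k) i ht
      have hw := mul_pos hK (Z.w_pos i)
      simp only [hx, hz, delayClip]
      rw [← h3, Real.norm_eq_abs]
      set v := Z.tonelli K (δ k) (-k) (m k + 1) i (t - δ k)
      have h4 : |v - max (-(K * Z.w i)) (min (K * Z.w i) v)| ≤ C * δ k := by
        have hCδ : 0 ≤ C * δ k := (abs_nonneg _).trans h2
        have h5 := abs_le.1 h1
        rw [abs_le]
        rcases le_total (K * Z.w i) v with h6 | h6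
        · rw [min_eq_left h6, max_eq_right (by linarith)]
          constructor <;> linarith
        · rw [min_eq_right h6]
          rcases le_total (-(K * Z.w i)) v with h7 | h7
          · rw [max_eq_right h7]; constructor <;> linarith
          · rw [max_eq_left h7]; constructor <;> linarith
      refine (abs_sub_le _ v _).trans ?_
      linarith)
    (fun T ε hε => by
      filter_upwards [tendsto_natCast_atTop_atTop.eventually_gt_atTop T] with k hk i t ht
      exact ⟨_, hasDerivAt_tonelli hK.le hM (m k) i (by linarith [ht.1]), by
        simpa [hz] using hε.le⟩)
  exact ⟨M, X, hX⟩

/-- Existence of an attracting periodic solution. -/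
theorem exists_periodic_attractor [Finite ι] : ∃ y : ι → ℝ → ℝ,
    (∀ i, Continuous (y i)) ∧ (∀ i t, y i (t + Z.ω) = y i t) ∧
    (∀ i t, HasDerivAt (y i) (Z.R i y t) t) ∧
    ∀ x M, (∀ i, Continuous (x i)) → (∀ i t, |x i t| ≤ M) →
      (∀ ε : ℝ, 0 < ε → ∀ᶠ t in atTop, ∀ i, ∃ D, HasDerivAt (x i) D t ∧ |D - Z.R i x t| ≤ ε) →
      ∀ i, Tendsto (fun t => |x i t - y i t|) atTop (nhds 0) := by
  obtain ⟨M, y, hy⟩ := exists_complete (Z := Z)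
  refine ⟨y, hy.continuous, fun i t => ?_, hy.2, fun x M' hc hM hx i => ?_⟩
  · simpa using congrFun (congrFun ((hy.shift 1).unique hy) i) t
  · exact (hy.mono (le_max_left M M')).tendsto hc
      (fun i t => (hM i t).trans (le_max_right M M')) hx i

end PeriodicSystem

section Average

variable {μ : Measure ℝ} {g : ℝ → ℝ}

theorem integrableOn_comp_add [IsFiniteMeasure μ] (hg : Continuous g) {y : ℝ → ℝ} {M t : ℝ}
    (hy : Continuous y) (hM : ∀ s ≤ t, |y s| ≤ M) :
    IntegrableOn (fun s => g (y (t + s))) (Set.Iic 0) μ := by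
  obtain ⟨C, hC⟩ := (isCompact_Icc (a := -M) (b := M)).exists_bound_of_continuousOn
    hg.continuousOn
  refine (integrable_const C).mono' (by fun_prop) ?_
  filter_upwards [ae_restrict_mem measurableSet_Iic] with s hs
  exact hC _ (abs_le.1 (hM _ (by linarith [Set.mem_Iic.1 hs])))

theorem abs_integral_comp_add_sub_le [IsProbabilityMeasure μ] (hg : Continuous g) {ξ : ℝ}
    (hξ : 0 ≤ ξ) (hlip : ∀ u v, |g u - g v| ≤ ξ * |u - v|) {y z : ℝ → ℝ} {M t r : ℝ}
    (hy : Continuous y) (hz : Continuous z) (hyM : ∀ s ≤ t, |y s| ≤ M)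
    (hzM : ∀ s ≤ t, |z s| ≤ M) (hr : ∀ s ≤ t, |y s - z s| ≤ r) :
    |(∫ s in Set.Iic 0, g (y (t + s)) ∂μ) - ∫ s in Set.Iic 0, g (z (t + s)) ∂μ| ≤ ξ * r := by
  have hr0 : 0 ≤ r := (abs_nonneg _).trans (hr t le_rfl)
  rw [← integral_sub (integrableOn_comp_add hg hy hyM) (integrableOn_comp_add hg hz hzM)]
  have h := norm_setIntegral_le_of_norm_le_const (μ := μ) (s := Set.Iic (0:ℝ)) (C := ξ * r)
    (f := fun s => g (y (t + s)) - g (z (t + s))) (measure_lt_top _ _) fun s hs =>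
      (hlip _ _).trans (mul_le_mul_of_nonneg_left (hr _ (by linarith [Set.mem_Iic.1 hs])) hξ)
  rw [Real.norm_eq_abs] at h
  exact h.trans (mul_le_of_le_one_right (by positivity) measureReal_le_one)

theorem tendsto_integral_comp [IsFiniteMeasure μ] (hg : Continuous g) {α : Type*} {l : Filter α}
    [l.IsCountablyGenerated] {z : α → ℝ → ℝ} {x : ℝ → ℝ} {M : ℝ}
    (hz : ∀ k, Continuous (z k)) (hM : ∀ k s, |z k s| ≤ M)
    (hx : ∀ s, Tendsto (fun k => z k s) l (nhds (x s))) :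
    Tendsto (fun k => ∫ s in Set.Iic 0, g (z k s) ∂μ) l
      (nhds (∫ s in Set.Iic 0, g (x s) ∂μ)) := by
  obtain ⟨C, hC⟩ := (isCompact_Icc (a := -M) (b := M)).exists_bound_of_continuousOn
    hg.continuousOn
  refine tendsto_integral_filter_of_dominated_convergence (fun _ => C) ?_ ?_
    (integrable_const C) ?_
  · exact Eventually.of_forall fun k => (hg.comp (hz k)).aestronglyMeasurable
  · exact Eventually.of_forall fun k => Eventually.of_forall fun s => hC _ (abs_le.1 (hM k s))
  · exact Eventually.of_forall fun s => (hg.tendsto _).comp (hx s)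

end Average

/-- Lipschitz constants of the nonlinearities of a high-order network. -/
structure HOLip (n P Q : ℕ) where
  γ1 : Fin (n+1) → Fin (n+1) → Fin (n+1) → Fin (P+1) → ℝ
  γ2 : Fin (n+1) → Fin (n+1) → Fin (n+1) → Fin (P+1) → ℝ
  μ1 : Fin (n+1) → Fin (n+1) → Fin (n+1) → Fin (Q+1) → ℝ
  μ2 : Fin (n+1) → Fin (n+1) → Fin (n+1) → Fin (Q+1) → ℝ
  ξ : Fin (n+1) → Fin (n+1) → Fin (Q+1) → ℝ
  Ξ : Fin (n+1) → Fin (n+1) → Fin (Q+1) → ℝ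
  ζ : Fin (n+1) → ℝ
  ς : Fin (n+1) → ℝ

namespace HOData

variable {n P Q : ℕ} (S : HOData n P Q)

/-- Argument of the discrete-delay activation. -/
noncomputable def discrete (i : Fin (n+1)) (x : Fin (n+1) → ℝ → ℝ) (t : ℝ) : ℝ :=
  ∑ p : Fin (P+1), ∑ j : Fin (n+1), ∑ l : Fin (n+1),
    S.c i j l p t * S.h i j l p (x j (t - S.τ i j p t)) (x l (t - S.σ i l p t))

/-- Argument of the distributed-delay activation. -/
noncomputable def distributed (i : Fin (n+1)) (x : Fin (n+1) → ℝ → ℝ) (t : ℝ) : ℝ :=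
  ∑ q : Fin (Q+1), ∑ j : Fin (n+1), ∑ l : Fin (n+1),
    S.d i j l q t * S.f i j l q
      (∫ s in Set.Iic (0:ℝ), S.g i j q (x j (t + s)) ∂(S.η i j q))
      (∫ s in Set.Iic (0:ℝ), S.G i l q (x l (t + s)) ∂(S.ρ i l q))

/-- The total nonlocal input of a neuron. -/
noncomputable def net (i : Fin (n+1)) (x : Fin (n+1) → ℝ → ℝ) (t : ℝ) : ℝ :=
  S.Gf i (S.discrete i x t) + S.Hf i (S.distributed i x t) + S.I i t

theorem rhs_eq (x : Fin (n+1) → ℝ → ℝ) (i : Fin (n+1)) (t : ℝ) :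
    S.rhs x i t = S.a i t (x i t) * (-(S.b i t (x i t)) + S.net i x t) := by
  simp only [rhs, net, discrete, distributed]
  ring

/-- The Lipschitz modulus of the nonlocal input. -/
def modulus (K : HOLip n P Q) (i : Fin (n+1)) (r : Fin (n+1) → ℝ) (t : ℝ) : ℝ :=
  K.ζ i * (∑ p : Fin (P+1), ∑ j : Fin (n+1), ∑ l : Fin (n+1),
      |S.c i j l p t| * (K.γ1 i j l p * r j + K.γ2 i j l p * r l))
  + K.ς i * (∑ q : Fin (Q+1), ∑ j : Fin (n+1), ∑ l : Fin (n+1),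
      |S.d i j l q t| * (K.μ1 i j l q * (K.ξ i j q * r j) + K.μ2 i j l q * (K.Ξ i l q * r l)))

/-- Regularity of the time-independent part of the network. -/
structure Core (K : HOLip n P Q) : Prop where
  γ_pos : ∀ i j l p, 0 < K.γ1 i j l p ∧ 0 < K.γ2 i j l p
  μ_pos : ∀ i j l q, 0 < K.μ1 i j l q ∧ 0 < K.μ2 i j l q
  ξ_pos : ∀ i j q, 0 < K.ξ i j q
  Ξ_pos : ∀ i l q, 0 < K.Ξ i l q
  ζ_pos : ∀ i, 0 < K.ζ i ∧ 0 < K.ς i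
  h_lip : ∀ i j l p u1 u2 v1 v2, |S.h i j l p u1 u2 - S.h i j l p v1 v2|
    ≤ K.γ1 i j l p * |u1 - v1| + K.γ2 i j l p * |u2 - v2|
  f_lip : ∀ i j l q u1 u2 v1 v2, |S.f i j l q u1 u2 - S.f i j l q v1 v2|
    ≤ K.μ1 i j l q * |u1 - v1| + K.μ2 i j l q * |u2 - v2|
  g_lip : ∀ i j q u v, |S.g i j q u - S.g i j q v| ≤ K.ξ i j q * |u - v|
  G_lip : ∀ i l q u v, |S.G i l q u - S.G i l q v| ≤ K.Ξ i l q * |u - v|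
  Gf_lip : ∀ i u v, |S.Gf i u - S.Gf i v| ≤ K.ζ i * |u - v|
  Hf_lip : ∀ i u v, |S.Hf i u - S.Hf i v| ≤ K.ς i * |u - v|
  Gf_cont : ∀ i, Continuous (S.Gf i)
  Hf_cont : ∀ i, Continuous (S.Hf i)
  h_cont : ∀ i j l p, Continuous (fun q : ℝ × ℝ => S.h i j l p q.1 q.2)
  f_cont : ∀ i j l q, Continuous (fun r : ℝ × ℝ => S.f i j l q r.1 r.2)
  g_cont : ∀ i j q, Continuous (S.g i j q)
  G_cont : ∀ i l q, Continuous (S.G i l q)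
  η_prob : ∀ i j q, IsProbabilityMeasure (S.η i j q)
  ρ_prob : ∀ i l q, IsProbabilityMeasure (S.ρ i l q)

variable {S} {K : HOLip n P Q}

theorem Regular.core {K : HOLip n P Q} (h : S.Regular)
    (t2 : S.T2 K.γ1 K.γ2 K.μ1 K.μ2 K.ξ K.Ξ K.ζ K.ς) : S.Core K := by
  obtain ⟨-, -, -, h1, h2, -, -, -, -, -, -, -, h3, h4, h5, h6, h7, h8⟩ := h
  obtain ⟨k1, k2, k3, k4, k5, k6, k7, k8, k9, k10, k11⟩ := t2
  exact ⟨k1, k2, k3, k4, k5, k6, k7, k8, k9, k10, k11, h1, h2, h3, h4, h5, h6,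
    fun i j q => (h7 i j q).1, fun i j q => (h8 i j q).1⟩

theorem modulus_smul (L : ℝ) (i : Fin (n+1)) (r : Fin (n+1) → ℝ) (t : ℝ) :
    S.modulus K i (fun j => L * r j) t = L * S.modulus K i r t := by
  simp only [modulus, mul_add, Finset.mul_sum]
  congr 1 <;>
  exact Finset.sum_congr rfl fun p _ => Finset.sum_congr rfl fun j _ =>
    Finset.sum_congr rfl fun l _ => by ring

theorem modulus_eq (i : Fin (n+1)) (r : Fin (n+1) → ℝ) (t : ℝ) :
    S.modulus K i r t = ∑ j : Fin (n+1), ∑ l : Fin (n+1),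
      ((∑ p : Fin (P+1), K.ζ i * |S.c i j l p t| * (K.γ1 i j l p * r j + K.γ2 i j l p * r l))
        + ∑ q : Fin (Q+1), K.ς i * |S.d i j l q t| *
          (K.μ1 i j l q * (K.ξ i j q * r j) + K.μ2 i j l q * (K.Ξ i l q * r l))) := by
  simp only [modulus, Finset.mul_sum, Finset.sum_add_distrib]
  congr 1 <;> rw [Finset.sum_comm] <;> refine Finset.sum_congr rfl fun j _ => ?_ <;>
  rw [Finset.sum_comm] <;>
  exact Finset.sum_congr rfl fun p _ => Finset.sum_congr rfl fun l _ => by ring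

theorem Core.modulus_nonneg (hS : S.Core K) (i : Fin (n+1)) {r : Fin (n+1) → ℝ}
    (hr : ∀ j, 0 ≤ r j) (t : ℝ) : 0 ≤ S.modulus K i r t := by
  refine add_nonneg (mul_nonneg (hS.ζ_pos i).1.le ?_) (mul_nonneg (hS.ζ_pos i).2.le ?_)
  · refine Finset.sum_nonneg fun p _ => Finset.sum_nonneg fun j _ => Finset.sum_nonneg fun l _ => ?_
    have h1 := hS.γ_pos i j l p
    exact mul_nonneg (abs_nonneg _) (add_nonneg (mul_nonneg h1.1.le (hr j))
      (mul_nonneg h1.2.le (hr l)))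
  · refine Finset.sum_nonneg fun q _ => Finset.sum_nonneg fun j _ => Finset.sum_nonneg fun l _ => ?_
    have h1 := hS.μ_pos i j l q
    exact mul_nonneg (abs_nonneg _) (add_nonneg
      (mul_nonneg h1.1.le (mul_nonneg (hS.ξ_pos i j q).le (hr j)))
      (mul_nonneg h1.2.le (mul_nonneg (hS.Ξ_pos i l q).le (hr l))))

/-- The nonlocal input is Lipschitz with respect to the history. -/
theorem Core.abs_net_sub_le (hS : S.Core K) {t : ℝ} (hτ : ∀ i j p, 0 ≤ S.τ i j p t)
    (hσ : ∀ i l p, 0 ≤ S.σ i l p t) {x y : Fin (n+1) → ℝ → ℝ} {M : ℝ} {r : Fin (n+1) → ℝ}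
    (hx : ∀ j, Continuous (x j)) (hy : ∀ j, Continuous (y j))
    (hxM : ∀ j, ∀ s ≤ t, |x j s| ≤ M) (hyM : ∀ j, ∀ s ≤ t, |y j s| ≤ M)
    (hr : ∀ j, ∀ s ≤ t, |x j s - y j s| ≤ r j) (i : Fin (n+1)) :
    |S.net i x t - S.net i y t| ≤ S.modulus K i r t := by
  have h1 : |S.discrete i x t - S.discrete i y t| ≤
      ∑ p : Fin (P+1), ∑ j : Fin (n+1), ∑ l : Fin (n+1),
        |S.c i j l p t| * (K.γ1 i j l p * r j + K.γ2 i j l p * r l) := by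
    simp only [discrete, ← Finset.sum_sub_distrib, ← mul_sub]
    refine (Finset.abs_sum_le_sum_abs _ _).trans (Finset.sum_le_sum fun p _ => ?_)
    refine (Finset.abs_sum_le_sum_abs _ _).trans (Finset.sum_le_sum fun j _ => ?_)
    refine (Finset.abs_sum_le_sum_abs _ _).trans (Finset.sum_le_sum fun l _ => ?_)
    rw [abs_mul]
    refine mul_le_mul_of_nonneg_left ((hS.h_lip ..).trans ?_) (abs_nonneg _)
    have h2 := hS.γ_pos i j l p
    exact add_le_add (mul_le_mul_of_nonneg_left (hr j _ (by linarith [hτ i j p])) h2.1.le)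
      (mul_le_mul_of_nonneg_left (hr l _ (by linarith [hσ i l p])) h2.2.le)
  have h2 : |S.distributed i x t - S.distributed i y t| ≤
      ∑ q : Fin (Q+1), ∑ j : Fin (n+1), ∑ l : Fin (n+1),
        |S.d i j l q t| * (K.μ1 i j l q * (K.ξ i j q * r j)
          + K.μ2 i j l q * (K.Ξ i l q * r l)) := by
    simp only [distributed, ← Finset.sum_sub_distrib, ← mul_sub]
    refine (Finset.abs_sum_le_sum_abs _ _).trans (Finset.sum_le_sum fun q _ => ?_)
    refine (Finset.abs_sum_le_sum_abs _ _).trans (Finset.sum_le_sum fun j _ => ?_)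
    refine (Finset.abs_sum_le_sum_abs _ _).trans (Finset.sum_le_sum fun l _ => ?_)
    rw [abs_mul]
    refine mul_le_mul_of_nonneg_left ((hS.f_lip ..).trans ?_) (abs_nonneg _)
    have h2 := hS.μ_pos i j l q
    have := hS.η_prob i j q
    have := hS.ρ_prob i l q
    exact add_le_add
      (mul_le_mul_of_nonneg_left (abs_integral_comp_add_sub_le (hS.g_cont i j q)
        (hS.ξ_pos i j q).le (hS.g_lip i j q) (hx j) (hy j) (hxM j) (hyM j) (hr j)) h2.1.le)
      (mul_le_mul_of_nonneg_left (abs_integral_comp_add_sub_le (hS.G_cont i l q)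
        (hS.Ξ_pos i l q).le (hS.G_lip i l q) (hx l) (hy l) (hxM l) (hyM l) (hr l)) h2.2.le)
  have h3 := (hS.Gf_lip i (S.discrete i x t) (S.discrete i y t)).trans
    (mul_le_mul_of_nonneg_left h1 (hS.ζ_pos i).1.le)
  have h4 := (hS.Hf_lip i (S.distributed i x t) (S.distributed i y t)).trans
    (mul_le_mul_of_nonneg_left h2 (hS.ζ_pos i).2.le)
  have h5 := abs_add_le (S.Gf i (S.discrete i x t) - S.Gf i (S.discrete i y t))
    (S.Hf i (S.distributed i x t) - S.Hf i (S.distributed i y t))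
  have h6 : S.net i x t - S.net i y t =
      (S.Gf i (S.discrete i x t) - S.Gf i (S.discrete i y t))
        + (S.Hf i (S.distributed i x t) - S.Hf i (S.distributed i y t)) := by
    simp only [net]; ring
  rw [h6, modulus]
  exact h5.trans (add_le_add h3 h4)

/-- Sequential continuity of the nonlocal input. -/
theorem Core.tendsto_net (hS : S.Core K) {α : Type*} {l : Filter α} [l.IsCountablyGenerated]
    {z : α → Fin (n+1) → ℝ → ℝ} {x : Fin (n+1) → ℝ → ℝ} {M t : ℝ} {s : α → ℝ} {i : Fin (n+1)}
    (hz : ∀ k j, Continuous (z k j)) (hM : ∀ k j s, |z k j s| ≤ M)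
    (hc : ∀ j l' p, Tendsto (fun k => S.c i j l' p (s k)) l (nhds (S.c i j l' p t)))
    (hd : ∀ j l' q, Tendsto (fun k => S.d i j l' q (s k)) l (nhds (S.d i j l' q t)))
    (hI : Tendsto (fun k => S.I i (s k)) l (nhds (S.I i t)))
    (hτ : ∀ j p, Tendsto (fun k => z k j (s k - S.τ i j p (s k))) l
      (nhds (x j (t - S.τ i j p t))))
    (hσ : ∀ j p, Tendsto (fun k => z k j (s k - S.σ i j p (s k))) l
      (nhds (x j (t - S.σ i j p t))))
    (hx : ∀ j r, Tendsto (fun k => z k j (s k + r)) l (nhds (x j (t + r)))) :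
    Tendsto (fun k => S.net i (z k) (s k)) l (nhds (S.net i x t)) := by
  refine Tendsto.add (Tendsto.add (((hS.Gf_cont i).tendsto _).comp ?_)
    (((hS.Hf_cont i).tendsto _).comp ?_)) hI
  · refine tendsto_finsetSum _ fun p _ => tendsto_finsetSum _ fun j _ =>
      tendsto_finsetSum _ fun l' _ => (hc j l' p).mul ?_
    exact ((hS.h_cont i j l' p).tendsto (_, _)).comp ((hτ j p).prodMk_nhds (hσ l' p))
  · refine tendsto_finsetSum _ fun q _ => tendsto_finsetSum _ fun j _ =>
      tendsto_finsetSum _ fun l' _ => (hd j l' q).mul ?_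
    have := hS.η_prob i j q
    have := hS.ρ_prob i l' q
    refine ((hS.f_cont i j l' q).tendsto (_, _)).comp (Tendsto.prodMk_nhds ?_ ?_)
    · exact tendsto_integral_comp (hS.g_cont i j q) (z := fun k r => z k j (s k + r))
        (fun k => (hz k j).comp (continuous_const.add continuous_id))
        (fun k r => hM k j _) (hx j)
    · exact tendsto_integral_comp (hS.G_cont i l' q) (z := fun k r => z k l' (s k + r))
        (fun k => (hz k l').comp (continuous_const.add continuous_id))
        (fun k r => hM k l' _) (hx l')

/-- The nonlocal input depends on the past only. -/
theorem net_congr {i : Fin (n+1)} {t : ℝ} (hτ : ∀ j p, 0 ≤ S.τ i j p t)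
    (hσ : ∀ l p, 0 ≤ S.σ i l p t) {x y : Fin (n+1) → ℝ → ℝ}
    (h : ∀ j, ∀ s ≤ t, x j s = y j s) : S.net i x t = S.net i y t := by
  have h1 : S.discrete i x t = S.discrete i y t :=
    Finset.sum_congr rfl fun p _ => Finset.sum_congr rfl fun j _ =>
      Finset.sum_congr rfl fun l _ => by
        rw [h j _ (by linarith [hτ j p]), h l _ (by linarith [hσ l p])]
  have h2 : S.distributed i x t = S.distributed i y t :=
    Finset.sum_congr rfl fun q _ => Finset.sum_congr rfl fun j _ =>
      Finset.sum_congr rfl fun l _ => by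
        congr 2 <;> refine setIntegral_congr_fun measurableSet_Iic fun s hs => ?_
        · rw [h j _ (by linarith [Set.mem_Iic.1 hs])]
        · rw [h l _ (by linarith [Set.mem_Iic.1 hs])]
  simp only [net, h1, h2]

/-- Inward pointing of the vector field on the boundary of a large box. -/
theorem Core.dissip (hS : S.Core K) {t : ℝ} (hτ : ∀ i j p, 0 ≤ S.τ i j p t)
    (hσ : ∀ i l p, 0 ≤ S.σ i l p t) {x : Fin (n+1) → ℝ → ℝ} (hx : ∀ j, Continuous (x j))
    {M B ε C : ℝ} {w : Fin (n+1) → ℝ} (hM : 0 < M) (hw : ∀ j, 0 < w j)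
    (hxM : ∀ j, ∀ s ≤ t, |x j s| ≤ M * w j) {i : Fin (n+1)} (hi : |x i t| = M * w i)
    (hB : B * (x i t) ^ 2 ≤ x i t * (S.b i t (x i t) - S.b i t 0))
    (hε : S.modulus K i w t + ε * w i ≤ B * w i)
    (hC : |S.b i t 0| + |S.net i (fun _ _ => 0) t| ≤ C) (hMC : C < ε * M * w i) :
    x i t * (-(S.b i t (x i t)) + S.net i x t) < 0 := by
  obtain ⟨D, hD⟩ := (Set.finite_range fun j => M * w j).bddAbove
  have hD' : ∀ j, M * w j ≤ D := fun j => hD ⟨j, rfl⟩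
  have h1 := hS.abs_net_sub_le hτ hσ (M := D) (r := fun j => M * w j) hx
    (y := fun _ _ => 0) (fun _ => continuous_const) (fun j s hs => (hxM j s hs).trans (hD' j))
    (fun j s hs => by simpa using (mul_pos hM (hw j)).le.trans (hD' j))
    (fun j s hs => by simpa using hxM j s hs) i
  rw [modulus_smul] at h1
  have hpos : 0 < M * w i := mul_pos hM (hw i)
  set v := x i t
  have h2 : v * (S.net i x t - S.net i (fun _ _ => 0) t) ≤ |v| * (M * S.modulus K i w t) := by
    refine (le_abs_self _).trans ?_
    rw [abs_mul]
    exact mul_le_mul_of_nonneg_left h1 (abs_nonneg _)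
  have h3 : v * (-(S.b i t 0) + S.net i (fun _ _ => 0) t) ≤ |v| * C := by
    refine (le_abs_self _).trans ?_
    rw [abs_mul]
    refine mul_le_mul_of_nonneg_left ((abs_add_le _ _).trans ?_) (abs_nonneg _)
    rwa [abs_neg]
  have h4 : v * (-(S.b i t v) + S.net i x t) = -(v * (S.b i t v - S.b i t 0))
      + v * (S.net i x t - S.net i (fun _ _ => 0) t)
      + v * (-(S.b i t 0) + S.net i (fun _ _ => 0) t) := by ring
  have h5 : v ^ 2 = (M * w i) * (M * w i) := by rw [← sq_abs, hi]; ring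
  rw [hi] at h2 h3
  rw [h5] at hB
  rw [h4]
  have h6 : M * (S.modulus K i w t + ε * w i) ≤ M * (B * w i) :=
    mul_le_mul_of_nonneg_left hε hM.le
  have h7 : (M * w i) * (-(B * (M * w i)) + M * S.modulus K i w t + C) < 0 :=
    mul_neg_of_pos_of_neg hpos (by nlinarith)
  nlinarith

end HOData

/-- Extension to the line of the restriction of a function to `[0, ω)`. -/
noncomputable def periodicExtension {α : Type*} (ω : ℝ) (f : ℝ → α) (t : ℝ) : α :=
  f (ω * Int.fract (t / ω))

section PeriodicExtension

variable {α : Type*} {ω : ℝ} {f : ℝ → α}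

theorem mul_fract_div_mem (hω : 0 < ω) (t : ℝ) : ω * Int.fract (t / ω) ∈ Set.Icc 0 ω :=
  ⟨mul_nonneg hω.le (Int.fract_nonneg _), mul_le_of_le_one_right hω.le (Int.fract_lt_one _).le⟩

theorem mul_fract_div (hω : 0 < ω) (t : ℝ) :
    ω * Int.fract (t / ω) = t + (-⌊t / ω⌋ : ℤ) * ω := by
  rw [Int.fract]
  push_cast
  field_simp
  ring

theorem periodicExtension_add (hω : 0 < ω) (f : ℝ → α) (m : ℤ) (t : ℝ) :
    periodicExtension ω f (t + m * ω) = periodicExtension ω f t := by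
  have : (t + m * ω) / ω = t / ω + m := by field_simp
  rw [periodicExtension, this, Int.fract_add_intCast, periodicExtension]

theorem periodicExtension_eq (hω : 0 < ω) (hf : ∀ t ≥ 0, f (t + ω) = f t) {t : ℝ}
    (ht : 0 ≤ t) : periodicExtension ω f t = f t := by
  have hnat : ∀ (k : ℕ) (s : ℝ), 0 ≤ s → f (s + k * ω) = f s := by
    intro k
    induction k with
    | zero => simp
    | succ k ih =>
      intro s hs
      have : s + ((k + 1 : ℕ) : ℝ) * ω = s + k * ω + ω := by push_cast; ring
      rw [this, hf _ (by positivity), ih s hs]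
  have h0 : (0:ℤ) ≤ ⌊t / ω⌋ := Int.floor_nonneg.2 (by positivity)
  have h1 := hnat ⌊t / ω⌋.toNat (ω * Int.fract (t / ω)) (mul_fract_div_mem hω t).1
  have h2 : ((⌊t / ω⌋.toNat : ℕ) : ℝ) = (⌊t / ω⌋ : ℝ) := by
    exact_mod_cast congrArg (fun z : ℤ => (z : ℝ)) (Int.toNat_of_nonneg h0)
  have h3 : ω * Int.fract (t / ω) + ⌊t / ω⌋ * ω = t := by
    rw [mul_fract_div hω]
    push_cast
    ring
  rw [h2, h3] at h1
  exact h1.symm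

theorem continuous_periodicExtension {X Y : Type*} [TopologicalSpace X] [TopologicalSpace Y]
    (hω : 0 < ω) {f : ℝ → X → Y}
    (hc : ContinuousOn (fun q : ℝ × X => f q.1 q.2) (Set.Ici 0 ×ˢ Set.univ))
    (hf : ∀ t ≥ 0, f (t + ω) = f t) :
    Continuous fun q : ℝ × X => periodicExtension ω f q.1 q.2 := by
  rw [continuous_iff_continuousAt]
  rintro ⟨t, v⟩
  obtain ⟨m, hm⟩ := exists_nat_gt (-t / ω)
  have hpos : 0 < t + m * ω := by
    have := (div_lt_iff₀ hω).1 hm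
    linarith
  have h1 : ContinuousAt (fun q : ℝ × X => f q.1 q.2) (t + m * ω, v) :=
    hc.continuousAt (prod_mem_nhds (Ici_mem_nhds hpos) univ_mem)
  have h2 : ContinuousAt ((fun q : ℝ × X => f q.1 q.2) ∘ fun q : ℝ × X => (q.1 + m * ω, q.2))
      (t, v) := ContinuousAt.comp (x := (t, v)) h1 (by fun_prop)
  refine h2.congr ?_
  have h3 : ∀ᶠ q : ℝ × X in nhds (t, v), 0 < q.1 + m * ω :=
    (isOpen_lt continuous_const (continuous_fst.add continuous_const)).mem_nhds hpos
  filter_upwards [h3] with q hq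
  change f (q.1 + m * ω) q.2 = _
  rw [← periodicExtension_eq hω hf hq.le]
  exact congrFun (by exact_mod_cast periodicExtension_add hω f m q.1) q.2

theorem continuous_periodicExtension_real {Y : Type*} [TopologicalSpace Y] (hω : 0 < ω)
    {f : ℝ → Y} (hc : ContinuousOn f (Set.Ici 0)) (hf : ∀ t ≥ 0, f (t + ω) = f t) :
    Continuous (periodicExtension ω f) := by
  have := continuous_periodicExtension (X := Unit) hω (f := fun t _ => f t)
    (hc.comp continuousOn_fst fun q hq => hq.1) (fun t ht => funext fun _ => hf t ht)
  exact this.comp (f := fun t : ℝ => (t, ())) (by fun_prop)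

end PeriodicExtension

namespace HOData

variable {n P Q : ℕ} {S : HOData n P Q} {ω : ℝ} {K : HOLip n P Q}

/-- The network on the whole line obtained from the coefficients on `[0, ω)`. -/
noncomputable def periodize (S : HOData n P Q) (ω : ℝ) : HOData n P Q where
  a i := periodicExtension ω (S.a i)
  b i := periodicExtension ω (S.b i)
  Gf := S.Gf
  Hf := S.Hf
  c i j l p := periodicExtension ω (S.c i j l p)
  d i j l q := periodicExtension ω (S.d i j l q)
  I i := periodicExtension ω (S.I i)
  τ i j p := periodicExtension ω (S.τ i j p)
  σ i l p := periodicExtension ω (S.σ i l p)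
  h := S.h
  f := S.f
  g := S.g
  G := S.G
  η := S.η
  ρ := S.ρ

theorem Core.periodize (h : S.Core K) (ω : ℝ) : (S.periodize ω).Core K where
  γ_pos := h.γ_pos
  μ_pos := h.μ_pos
  ξ_pos := h.ξ_pos
  Ξ_pos := h.Ξ_pos
  ζ_pos := h.ζ_pos
  h_lip := h.h_lip
  f_lip := h.f_lip
  g_lip := h.g_lip
  G_lip := h.G_lip
  Gf_lip := h.Gf_lip
  Hf_lip := h.Hf_lip
  Gf_cont := h.Gf_cont
  Hf_cont := h.Hf_cont
  h_cont := h.h_cont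
  f_cont := h.f_cont
  g_cont := h.g_cont
  G_cont := h.G_cont
  η_prob := h.η_prob
  ρ_prob := h.ρ_prob

/-- Continuity of the coefficients on the whole line, and nonnegativity of the delays. -/
structure LineRegular (S : HOData n P Q) : Prop where
  a_cont : ∀ i, Continuous fun q : ℝ × ℝ => S.a i q.1 q.2
  b_cont : ∀ i, Continuous fun q : ℝ × ℝ => S.b i q.1 q.2
  c_cont : ∀ i j l p, Continuous (S.c i j l p)
  d_cont : ∀ i j l q, Continuous (S.d i j l q)
  I_cont : ∀ i, Continuous (S.I i)
  τ_cont : ∀ i j p, Continuous (S.τ i j p)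
  σ_cont : ∀ i l p, Continuous (S.σ i l p)
  τ_nonneg : ∀ i j p t, 0 ≤ S.τ i j p t
  σ_nonneg : ∀ i l p t, 0 ≤ S.σ i l p t

theorem Regular.periodize (hω : 0 < ω) (h : S.Regular) (t3 : S.T3 ω) :
    (S.periodize ω).LineRegular := by
  obtain ⟨ha, -, hb, -, -, hc, hd, hI, hτ, hσ, hτ0, hσ0, -⟩ := h
  obtain ⟨pa, pb, pc, pd, pτ, pσ, pI⟩ := t3
  exact {
    a_cont := fun i => continuous_periodicExtension hω (ha i) fun t ht => funext (pa i t ht)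
    b_cont := fun i => continuous_periodicExtension hω (hb i) fun t ht => funext (pb i t ht)
    c_cont := fun i j l p => continuous_periodicExtension_real hω (hc i j l p) (pc i j l p)
    d_cont := fun i j l q => continuous_periodicExtension_real hω (hd i j l q) (pd i j l q)
    I_cont := fun i => continuous_periodicExtension_real hω (hI i) (pI i)
    τ_cont := fun i j p => continuous_periodicExtension_real hω (hτ i j p) (pτ i j p)
    σ_cont := fun i l p => continuous_periodicExtension_real hω (hσ i l p) (pσ i l p)
    τ_nonneg := fun i j p t => hτ0 i j p _ (mul_fract_div_mem hω t).1
    σ_nonneg := fun i l p t => hσ0 i l p _ (mul_fract_div_mem hω t).1 }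

/-- For nonnegative times a periodic network agrees with its periodization. -/
theorem T3.periodize_eq (hω : 0 < ω) (t3 : S.T3 ω) {t : ℝ} (ht : 0 ≤ t) :
    (∀ i, (S.periodize ω).a i t = S.a i t) ∧ (∀ i, (S.periodize ω).b i t = S.b i t) ∧
    (∀ i x, (S.periodize ω).net i x t = S.net i x t) ∧
    (∀ i r, (S.periodize ω).modulus K i r t = S.modulus K i r t) ∧
    (∀ i j p, (S.periodize ω).τ i j p t = S.τ i j p t) ∧
    (∀ i j p, (S.periodize ω).σ i j p t = S.σ i j p t) ∧
    (∀ i j l p, (S.periodize ω).c i j l p t = S.c i j l p t) ∧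
    (∀ i j l q, (S.periodize ω).d i j l q t = S.d i j l q t) := by
  obtain ⟨pa, pb, pc, pd, pτ, pσ, pI⟩ := t3
  have hc i j l p : (S.periodize ω).c i j l p t = S.c i j l p t :=
    periodicExtension_eq hω (pc i j l p) ht
  have hd i j l q : (S.periodize ω).d i j l q t = S.d i j l q t :=
    periodicExtension_eq hω (pd i j l q) ht
  have hI i : (S.periodize ω).I i t = S.I i t := periodicExtension_eq hω (pI i) ht
  have hτ i j p : (S.periodize ω).τ i j p t = S.τ i j p t :=
    periodicExtension_eq hω (pτ i j p) ht
  have hσ i l p : (S.periodize ω).σ i l p t = S.σ i l p t :=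
    periodicExtension_eq hω (pσ i l p) ht
  refine ⟨fun i => periodicExtension_eq hω (fun s hs => funext (pa i s hs)) ht,
    fun i => periodicExtension_eq hω (fun s hs => funext (pb i s hs)) ht,
    fun i x => ?_, fun i r => ?_, hτ, hσ, hc, hd⟩
  · simp only [net, discrete, distributed, hc, hd, hI, hτ, hσ]
    rfl
  · simp only [modulus, hc, hd]

theorem periodize_net_add (hω : 0 < ω) (i : Fin (n+1)) (x : Fin (n+1) → ℝ → ℝ) (m : ℤ) (t : ℝ) :
    (S.periodize ω).net i x (t + m * ω)
      = (S.periodize ω).net i (fun j s => x j (s + m * ω)) t := by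
  have hc i j l p : (S.periodize ω).c i j l p (t + m * ω) = (S.periodize ω).c i j l p t :=
    periodicExtension_add hω _ m t
  have hd i j l q : (S.periodize ω).d i j l q (t + m * ω) = (S.periodize ω).d i j l q t :=
    periodicExtension_add hω _ m t
  have hI i : (S.periodize ω).I i (t + m * ω) = (S.periodize ω).I i t :=
    periodicExtension_add hω _ m t
  have hτ i j p : (S.periodize ω).τ i j p (t + m * ω) = (S.periodize ω).τ i j p t :=
    periodicExtension_add hω _ m t
  have hσ i l p : (S.periodize ω).σ i l p (t + m * ω) = (S.periodize ω).σ i l p t :=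
    periodicExtension_add hω _ m t
  simp only [net, discrete, distributed, hc, hd, hI, hτ, hσ, add_right_comm t, add_sub_right_comm]

theorem LineRegular.continuous_modulus (h : S.LineRegular) (i : Fin (n+1))
    (r : Fin (n+1) → ℝ) : Continuous (S.modulus K i r) := by
  have h1 := h.c_cont
  have h2 := h.d_cont
  unfold modulus
  fun_prop

theorem LineRegular.continuous_net (h : S.LineRegular) (hS : S.Core K) (i : Fin (n+1))
    {x : Fin (n+1) → ℝ → ℝ} {M : ℝ} (hx : ∀ j, Continuous (x j)) (hM : ∀ j t, |x j t| ≤ M) :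
    Continuous (S.net i x) := by
  refine continuous_iff_continuousAt.2 fun t => ?_
  refine hS.tendsto_net (z := fun _ => x) (M := M) (s := id) (fun _ => hx) (fun _ => hM)
    (fun j l p => (h.c_cont i j l p).tendsto t) (fun j l q => (h.d_cont i j l q).tendsto t)
    ((h.I_cont i).tendsto t) (fun j p => ?_) (fun j p => ?_) fun j r => ?_
  · exact ((hx j).comp (continuous_id.sub (h.τ_cont i j p))).tendsto t
  · exact ((hx j).comp (continuous_id.sub (h.σ_cont i j p))).tendsto t
  · exact ((hx j).comp (continuous_id.add continuous_const)).tendsto t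

/-- A periodic network has uniformly bounded rest input and uniform diagonal dominance. -/
theorem exists_uniform_bounds (hω : 0 < ω) (hreg : S.Regular) (hS : S.Core K) (t3 : S.T3 ω)
    {β : Fin (n+1) → ℝ → ℝ} (hβ : ∀ i, ContinuousOn (β i) (Set.Ici 0))
    (hβp : ∀ i, ∀ t ≥ (0:ℝ), β i (t + ω) = β i t) {w : Fin (n+1) → ℝ} (hw : ∀ i, 0 < w i)
    (hdom : ∀ i, ∀ t ∈ Set.Icc 0 ω, S.modulus K i w t < β i t * w i) :
    ∃ ε > 0, ∃ C, ∀ i, ∀ t ≥ (0:ℝ), S.modulus K i w t + ε * w i ≤ β i t * w i ∧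
      |S.b i t 0| + |S.net i (fun _ _ => 0) t| ≤ C := by
  have hL := hreg.periodize hω t3
  have hnet i : Continuous ((S.periodize ω).net i fun _ _ => 0) :=
    hL.continuous_net (hS.periodize ω) i (M := 0) (fun _ => continuous_const) (by simp)
  have hb i : Continuous fun t => (S.periodize ω).b i t 0 :=
    (hL.b_cont i).comp (f := fun t : ℝ => (t, (0:ℝ))) (by fun_prop)
  have hfun i : Continuous fun t => |(S.periodize ω).b i t 0|
      + |(S.periodize ω).net i (fun _ _ => 0) t| := (hb i).abs.add (hnet i).abs
  have hgapc i : ContinuousOn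
      (fun t => (β i t * w i - (S.periodize ω).modulus K i w t) / w i) (Set.Icc 0 ω) :=
    ((((hβ i).mono fun t ht => ht.1).mul continuousOn_const).sub
      (hL.continuous_modulus i w).continuousOn).div_const _
  have hgap i : ∃ ε > 0, ∀ t ∈ Set.Icc 0 ω,
      ε ≤ (β i t * w i - (S.periodize ω).modulus K i w t) / w i := by
    obtain ⟨t, ht, hmin⟩ := isCompact_Icc.exists_isMinOn ⟨0, le_rfl, hω.le⟩ (hgapc i)
    refine ⟨_, div_pos (sub_pos.2 ?_) (hw i), hmin⟩
    rw [(t3.periodize_eq (K := K) hω ht.1).2.2.2.1]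
    exact hdom i t ht
  have hbd i : ∃ C, ∀ t ∈ Set.Icc 0 ω, |(S.periodize ω).b i t 0|
      + |(S.periodize ω).net i (fun _ _ => 0) t| ≤ C := by
    obtain ⟨C, hC⟩ := (isCompact_Icc (a := (0:ℝ)) (b := ω)).bddAbove_image (hfun i).continuousOn
    exact ⟨C, fun t ht => hC ⟨t, ht, rfl⟩⟩
  choose ε hε0 hε using hgap
  choose C hC using hbd
  obtain ⟨D, hD⟩ := (Set.finite_range C).bddAbove
  refine ⟨Finset.univ.inf' Finset.univ_nonempty ε, by simpa using hε0, D, fun i t ht => ?_⟩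
  have hmem := mul_fract_div_mem hω t
  have h1 := t3.periodize_eq (K := K) hω ht
  have h2 := t3.periodize_eq (K := K) hω hmem.1
  have hθ := mul_fract_div hω t
  constructor
  · have h3 := hε i _ hmem
    have h4 : (S.periodize ω).modulus K i w (ω * Int.fract (t / ω)) = S.modulus K i w t := by
      rw [← h1.2.2.2.1]
      simp only [modulus]
      have hc i j l p : (S.periodize ω).c i j l p (ω * Int.fract (t / ω))
          = (S.periodize ω).c i j l p t := by rw [hθ]; exact periodicExtension_add hω _ _ t
      have hd i j l q : (S.periodize ω).d i j l q (ω * Int.fract (t / ω))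
          = (S.periodize ω).d i j l q t := by rw [hθ]; exact periodicExtension_add hω _ _ t
      simp only [hc, hd]
    have h5 : β i (ω * Int.fract (t / ω)) = β i t := periodicExtension_eq hω (hβp i) ht
    rw [h4, h5, le_div_iff₀ (hw i)] at h3
    have h6 : Finset.univ.inf' Finset.univ_nonempty ε ≤ ε i :=
      Finset.inf'_le _ (Finset.mem_univ i)
    nlinarith [hw i]
  · have h3 := hC i _ hmem
    have h4 : (S.periodize ω).net i (fun _ _ => 0) (ω * Int.fract (t / ω))
        = S.net i (fun _ _ => 0) t := by
      rw [hθ, periodize_net_add hω, h1.2.2.1]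
    have h5 : (S.periodize ω).b i (ω * Int.fract (t / ω)) 0 = S.b i t 0 := by
      rw [← h1.2.1, hθ]
      exact congrFun (periodicExtension_add hω _ _ t) 0
    rw [h4, h5] at h3
    exact h3.trans (hD ⟨i, rfl⟩)

end HOData

theorem exists_scale {ι : Type*} [Finite ι] {ε : ℝ} (hε : 0 < ε) {w : ι → ℝ} (hw : ∀ i, 0 < w i)
    (C D : ℝ) : ∃ M > 0, ∀ i, C < ε * M * w i ∧ D < M * w i := by
  obtain ⟨B, hB⟩ := (Set.finite_range fun i => C / (ε * w i)).bddAbove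
  obtain ⟨E, hE⟩ := (Set.finite_range fun i => D / w i).bddAbove
  refine ⟨max 0 (max B E) + 1, by positivity, fun i => ⟨?_, ?_⟩⟩
  · have h1 : C / (ε * w i) < max 0 (max B E) + 1 :=
      ((hB ⟨i, rfl⟩).trans ((le_max_left B E).trans (le_max_right _ _))).trans_lt (lt_add_one _)
    rw [div_lt_iff₀ (mul_pos hε (hw i))] at h1
    linarith
  · have h1 : D / w i < max 0 (max B E) + 1 :=
      ((hE ⟨i, rfl⟩).trans ((le_max_right B E).trans (le_max_right _ _))).trans_lt (lt_add_one _)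
    rwa [div_lt_iff₀ (hw i)] at h1

theorem Continuous.exists_bound_of_periodic {F : ℝ → ℝ} {ω : ℝ} (hF : Continuous F) (hω : 0 < ω)
    (hp : ∀ t, F (t + ω) = F t) : ∃ C, ∀ t, |F t| ≤ C := by
  obtain ⟨C, hC⟩ := (isCompact_Icc (a := (0:ℝ)) (b := ω)).exists_bound_of_continuousOn
    hF.continuousOn
  refine ⟨C, fun t => ?_⟩
  obtain ⟨s, hs, h⟩ := Function.Periodic.exists_mem_Ico₀ hp hω t
  rw [h]
  exact hC s ⟨hs.1, hs.2.le⟩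

namespace HOData

variable {n P Q : ℕ} {S : HOData n P Q} {ω : ℝ} {K : HOLip n P Q}

theorem sector_sq_le {b : ℝ → ℝ} {β : ℝ} (h : ∀ u v, u ≠ v → β ≤ (b u - b v) / (u - v)) (u : ℝ) :
    β * u ^ 2 ≤ u * (b u - b 0) := by
  rcases eq_or_ne u 0 with rfl | hu
  · simp
  · have h1 := h u 0 hu
    rw [sub_zero] at h1
    have h2 := mul_le_mul_of_nonneg_right h1 (sq_nonneg u)
    have h3 : (b u - b 0) / u * u ^ 2 = u * (b u - b 0) := by field_simp
    linarith

theorem exists_bound_modulus_periodize (hω : 0 < ω) (hL : (S.periodize ω).LineRegular)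
    (i : Fin (n+1)) (r : Fin (n+1) → ℝ) : ∃ C, ∀ t, |(S.periodize ω).modulus K i r t| ≤ C := by
  refine (hL.continuous_modulus i _).exists_bound_of_periodic hω fun t => ?_
  have hc i j l p : (S.periodize ω).c i j l p (t + ω) = (S.periodize ω).c i j l p t := by
    simpa [periodize] using periodicExtension_add hω (S.c i j l p) 1 t
  have hd i j l q : (S.periodize ω).d i j l q (t + ω) = (S.periodize ω).d i j l q t := by
    simpa [periodize] using periodicExtension_add hω (S.d i j l q) 1 t
  simp only [modulus, hc, hd]

theorem exists_bound_b_periodize (hω : 0 < ω) (hL : (S.periodize ω).LineRegular)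
    (i : Fin (n+1)) (M : ℝ) : ∃ C, ∀ t v, |v| ≤ M → |(S.periodize ω).b i t v| ≤ C := by
  obtain ⟨C, hC⟩ := ((isCompact_Icc (a := (0:ℝ)) (b := ω)).prod
    (isCompact_Icc (a := -M) (b := M))).exists_bound_of_continuousOn
    (hL.b_cont i).continuousOn
  refine ⟨C, fun t v hv => ?_⟩
  have h : (S.periodize ω).b i (ω * Int.fract (t / ω)) v = (S.periodize ω).b i t v := by
    rw [mul_fract_div hω]
    exact congrFun (periodicExtension_add hω (S.b i) _ t) v
  rw [← h]
  exact hC (_, v) ⟨mul_fract_div_mem hω t, abs_le.1 hv⟩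

/-- On bounded histories the right-hand side of a periodized network is uniformly bounded. -/
theorem exists_bound_periodize (hω : 0 < ω) (hL : (S.periodize ω).LineRegular) (hS : S.Core K)
    {aL aU : Fin (n+1) → ℝ} (haL : ∀ i, 0 < aL i)
    (ha : ∀ i, ∀ t ≥ (0:ℝ), ∀ v, aL i ≤ S.a i t v ∧ S.a i t v ≤ aU i) (M : ℝ) :
    ∃ C, ∀ i x, (∀ j, Continuous (x j)) → (∀ j t, |x j t| ≤ M) → ∀ t,
      |(S.periodize ω).a i t (x i t) * (-((S.periodize ω).b i t (x i t))
        + (S.periodize ω).net i x t)| ≤ C := by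
  have hS' := hS.periodize ω
  have h1 i : ∃ C, ∀ t, |(S.periodize ω).net i (fun _ _ => 0) t| ≤ C := by
    refine (hL.continuous_net hS' i (M := 0) (fun _ => continuous_const)
      (by simp)).exists_bound_of_periodic hω fun t => ?_
    simpa using periodize_net_add (S := S) hω i (fun _ _ => 0) 1 t
  have h2 i := exists_bound_modulus_periodize (K := K) hω hL i fun _ => M
  have h3 i := exists_bound_b_periodize hω hL i M
  choose C1 h1 using h1
  choose C2 h2 using h2
  choose C3 h3 using h3
  obtain ⟨C, hC⟩ := (Set.finite_range fun i => aU i * (C3 i + (C1 i + C2 i))).bddAbove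
  refine ⟨C, fun i x hx hM t => le_trans ?_ (hC ⟨i, rfl⟩)⟩
  have ha' := ha i _ (mul_fract_div_mem hω t).1 (x i t)
  have h4 := hS'.abs_net_sub_le (fun i j p => hL.τ_nonneg i j p t)
    (fun i j p => hL.σ_nonneg i j p t) (M := M) (r := fun _ => M) hx (y := fun _ _ => 0)
    (fun _ => continuous_const) (fun j s _ => hM j s)
    (fun j s _ => by simpa using (abs_nonneg _).trans (hM j s))
    (fun j s _ => by simpa using hM j s) i
  rw [abs_mul]
  have h5 : |(S.periodize ω).a i t (x i t)| ≤ aU i := by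
    change |S.a i (ω * Int.fract (t / ω)) (x i t)| ≤ aU i
    rw [abs_of_pos ((haL i).trans_le ha'.1)]
    exact ha'.2
  refine mul_le_mul h5 ?_ (abs_nonneg _) ((abs_nonneg _).trans h5)
  refine (abs_add_le _ _).trans (add_le_add ?_ ?_)
  · rw [abs_neg]
    exact h3 i t _ (hM i t)
  · have h6 := abs_sub_abs_le_abs_sub ((S.periodize ω).net i x t)
      ((S.periodize ω).net i (fun _ _ => 0) t)
    linarith [h1 i t, h2 i t, le_abs_self ((S.periodize ω).modulus K i (fun _ => M) t)]

/-- The periodization of a diagonally dominant periodic network. -/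
theorem exists_periodicSystem (hω : 0 < ω) (hreg : S.Regular) (hS : S.Core K) (t3 : S.T3 ω)
    {aL aU : Fin (n+1) → ℝ} {A β βs : Fin (n+1) → ℝ → ℝ} (t1 : S.T1 aL aU A)
    (t4 : S.T4 ω β βs) {w : Fin (n+1) → ℝ} (hw : ∀ i, 0 < w i)
    (hdom : ∀ i, ∀ t ∈ Set.Icc 0 ω, S.modulus K i w t < β i t * w i)
    (hdom2 : ∀ i, ∀ t ∈ Set.Icc 0 ω, -((β i t + A i t) * aL i)
      + S.modulus K i (fun j => aU j * w j) t / w i < 0) :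
    ∃ Z : PeriodicSystem (Fin (n+1)), Z.ω = ω ∧ Z.R = fun i x t => (S.periodize ω).rhs x i t := by
  have hL := hreg.periodize hω t3
  have hS' := hS.periodize ω
  obtain ⟨haL, haLU, ha, hda⟩ := t1
  obtain ⟨hβc, -, -, hβp, hsec⟩ := t4
  have hbd : ∃ M, 0 < M ∧ ∀ i x, (∀ j, Continuous (x j)) → (∀ j s, |x j s| ≤ M * w j) →
      ∀ t, |x i t| = M * w i →
      x i t * (-((S.periodize ω).b i t (x i t)) + (S.periodize ω).net i x t) < 0 := by
    obtain ⟨ε, hε, C, hC⟩ := exists_uniform_bounds hω hreg hS t3 hβc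
      (fun i t ht => (hβp i t ht).1) hw hdom
    obtain ⟨M, hM, hMC⟩ := exists_scale hε hw C 0
    refine ⟨M, hM, fun i x hx hxM t hi => ?_⟩
    have hm := (mul_fract_div_mem hω t).1
    exact hS'.dissip (fun i j p => hL.τ_nonneg i j p t) (fun i j p => hL.σ_nonneg i j p t) hx hM
      hw (fun j s _ => hxM j s) hi (sector_sq_le (fun u v h => (hsec i _ hm u v h).1) _)
      (hC i _ hm).1 (hC i _ hm).2 (hMC i).1
  refine ⟨{
    ω := ω
    a := (S.periodize ω).a
    b := (S.periodize ω).b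
    N := (S.periodize ω).net
    aL := aL
    aU := aU
    w := w
    β := β
    A := A
    κ := fun i t => S.modulus K i (fun j => aU j * w j) t / w i
    ω_pos := hω
    a_cont := hL.a_cont
    b_cont := hL.b_cont
    a_per := fun i m t v => congrFun (periodicExtension_add hω (S.a i) m t) v
    b_per := fun i m t v => congrFun (periodicExtension_add hω (S.b i) m t) v
    aL_pos := haL
    aL_le := fun i t v => (ha i _ (mul_fract_div_mem hω t).1 v).1
    le_aU := fun i t v => (ha i _ (mul_fract_div_mem hω t).1 v).2
    w_pos := hw
    sector := fun i t ht u v huv => by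
      have h := (hsec i t ht.1.le u v huv.ne').1
      rw [(t3.periodize_eq (K := K) hω ht.1.le).2.1]
      rwa [le_div_iff₀ (sub_pos.2 huv)] at h
    β_bdd := fun i => by
      obtain ⟨B, hB⟩ := (isCompact_Icc (a := (0:ℝ)) (b := ω)).bddAbove_image
        ((hβc i).mono fun t ht => ht.1)
      exact ⟨B, fun t ht => hB ⟨t, ⟨ht.1.le, ht.2⟩, rfl⟩⟩
    a_deriv := fun i v t ht => by
      obtain ⟨da, h1, h2⟩ := hda i v t ht.1.le
      refine ⟨da, h1.congr_of_eventuallyEq ?_, ?_⟩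
      · filter_upwards [lt_mem_nhds ht.1] with s hs
        rw [(t3.periodize_eq (K := K) hω hs.le).1]
      · rwa [(t3.periodize_eq (K := K) hω ht.1.le).1]
    κ_nonneg := fun i t _ => div_nonneg (hS.modulus_nonneg i
      (fun j => mul_nonneg ((haL j).le.trans (haLU j)) (hw j).le) t) (hw i).le
    dom := fun i t ht => hdom2 i t ⟨ht.1.le, ht.2⟩
    N_cont := fun i x M hx hM => hL.continuous_net hS' i hx hM
    N_lim := fun i z x M t hz hM hx => hS'.tendsto_net (s := fun _ => t) hz hM
      (fun _ _ _ => tendsto_const_nhds) (fun _ _ _ => tendsto_const_nhds) tendsto_const_nhds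
      (fun j p => hx j _) (fun j p => hx j _) fun j r => hx j _
    N_causal := fun i x y t h => net_congr (fun j p => hL.τ_nonneg i j p t)
      (fun j p => hL.σ_nonneg i j p t) h
    N_per := fun i x m t => periodize_net_add hω i x m t
    N_lip := fun i x y M L t ht hx hy hxM hyM hL0 h => by
      have h1 := hS'.abs_net_sub_le (fun i j p => hL.τ_nonneg i j p t)
        (fun i j p => hL.σ_nonneg i j p t) hx hy (fun j s _ => hxM j s) (fun j s _ => hyM j s)
        (fun j s _ => h j s) i
      rw [modulus_smul, (t3.periodize_eq hω ht.1.le).2.2.2.1] at h1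
      rwa [mul_div_cancel₀ _ (hw i).ne']
    bounded := exists_bound_periodize hω hL hS haL ha
    dissip := hbd }, rfl, ?_⟩
  funext i x t
  rw [rhs_eq]
  rfl

end HOData

/-- Functions that cannot leave a box through its boundary stay inside. -/
theorem abs_lt_of_inward {ι : Type*} [Finite ι] {x : ι → ℝ → ℝ} (hx : ∀ i, Continuous (x i))
    {r : ι → ℝ} {T : ℝ} (hT : ∀ i, ∀ t ≤ T, |x i t| < r i)
    (h : ∀ t > T, (∀ j, ∀ s ≤ t, |x j s| ≤ r j) → ∀ i, |x i t| = r i →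
      ∃ D, HasDerivAt (x i) D t ∧ x i t * D < 0) (i : ι) (t : ℝ) : |x i t| < r i := by
  by_contra! hcon
  set B : Set ℝ := {t | ∃ i, r i ≤ |x i t|} with hB
  have hBc : IsClosed B := by
    have : B = ⋃ i, {t | r i ≤ |x i t|} := by ext; simp [hB]
    rw [this]
    exact isClosed_iUnion_of_finite fun i => isClosed_le continuous_const (hx i).abs
  have hlow : ∀ s ∈ B, T < s := fun s ⟨j, hj⟩ => by
    by_contra! hs
    exact (hT j s hs).not_ge hj
  have hbdd : BddBelow B := ⟨T, fun s hs => (hlow s hs).le⟩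
  obtain ⟨j, hj⟩ := hBc.csInf_mem ⟨t, i, hcon⟩ hbdd
  set t₁ := sInf B
  have hbefore : ∀ k, ∀ s < t₁, |x k s| < r k := fun k s hs => by
    by_contra! hk
    exact (csInf_le hbdd ⟨k, hk⟩).not_gt hs
  have hle : ∀ k, ∀ s ≤ t₁, |x k s| ≤ r k := fun k s hs => by
    have : closure (Set.Iio t₁) ⊆ {s | |x k s| ≤ r k} :=
      closure_minimal (fun s hs => (hbefore k s hs).le) (isClosed_le (hx k).abs continuous_const)
    rw [closure_Iio] at this
    exact this hs
  have heq := (hle j t₁ le_rfl).antisymm hj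
  obtain ⟨D, hD, hneg⟩ := h t₁ (hlow _ (hBc.csInf_mem ⟨t, i, hcon⟩ hbdd)) hle j heq
  have hsq : HasDerivAt (fun s => x j s ^ 2) (2 * (x j t₁ * D)) t₁ :=
    (hD.pow 2).congr_deriv (by norm_num [mul_assoc])
  have h1 : 0 ≤ 2 * (x j t₁ * D) := by
    refine ge_of_tendsto ((hasDerivAt_iff_tendsto_slope_left_right.1 hsq).1) ?_
    filter_upwards [self_mem_nhdsWithin] with s hs
    have h2 : x j s ^ 2 ≤ x j t₁ ^ 2 := by
      rw [sq_le_sq, heq]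
      exact (hbefore j s hs).le
    rw [slope_def_field]
    exact div_nonneg_of_nonpos (by linarith) (by linarith [Set.mem_Iio.1 hs])
  linarith

theorem tendsto_mul_sub_mul {l : Filter ℝ} {c c' u u' : ℝ → ℝ}
    (hc : Tendsto (fun t => c t - c' t) l (nhds 0)) (hu : Tendsto (fun t => u t - u' t) l (nhds 0))
    {A B : ℝ} (hA : ∀ t, |u t| ≤ A) (hB : ∀ᶠ t in l, |c' t| ≤ B) :
    Tendsto (fun t => c t * u t - c' t * u' t) l (nhds 0) := by
  have h := (hc.abs.mul_const A).add (hu.abs.const_mul B)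
  simp only [abs_zero, zero_mul, mul_zero, add_zero] at h
  refine squeeze_zero_norm' ?_ h
  filter_upwards [hB] with t ht
  have : c t * u t - c' t * u' t = (c t - c' t) * u t + c' t * (u t - u' t) := by ring
  rw [Real.norm_eq_abs, this]
  refine (abs_add_le _ _).trans ?_
  rw [abs_mul, abs_mul]
  exact add_le_add (mul_le_mul_of_nonneg_left (hA t) (abs_nonneg _))
    (mul_le_mul_of_nonneg_right ht (abs_nonneg _))

theorem tendsto_abs_sub_abs {l : Filter ℝ} {c c' : ℝ → ℝ}
    (hc : Tendsto (fun t => c t - c' t) l (nhds 0)) :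
    Tendsto (fun t => |c t| - |c' t|) l (nhds 0) :=
  squeeze_zero_norm (fun t => abs_abs_sub_abs_le _ _) (by simpa using hc.abs)

theorem tendsto_sub_of_lipschitz {l : Filter ℝ} {F : ℝ → ℝ} {k : ℝ}
    (hF : ∀ u v, |F u - F v| ≤ k * |u - v|) {u v : ℝ → ℝ}
    (h : Tendsto (fun t => u t - v t) l (nhds 0)) :
    Tendsto (fun t => F (u t) - F (v t)) l (nhds 0) :=
  squeeze_zero_norm (fun t => hF _ _) (by simpa using h.abs.const_mul k)

theorem tendsto_sub_of_lipschitz₂ {l : Filter ℝ} {F : ℝ → ℝ → ℝ} {k₁ k₂ : ℝ}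
    (hF : ∀ u₁ u₂ v₁ v₂, |F u₁ u₂ - F v₁ v₂| ≤ k₁ * |u₁ - v₁| + k₂ * |u₂ - v₂|)
    {u₁ u₂ v₁ v₂ : ℝ → ℝ} (h₁ : Tendsto (fun t => u₁ t - v₁ t) l (nhds 0))
    (h₂ : Tendsto (fun t => u₂ t - v₂ t) l (nhds 0)) :
    Tendsto (fun t => F (u₁ t) (u₂ t) - F (v₁ t) (v₂ t)) l (nhds 0) :=
  squeeze_zero_norm (fun t => hF _ _ _ _)
    (by simpa using (h₁.abs.const_mul k₁).add (h₂.abs.const_mul k₂))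

theorem abs_le_of_lipschitz₂ {F : ℝ → ℝ → ℝ} {k₁ k₂ M₁ M₂ u v : ℝ} (hk₁ : 0 ≤ k₁) (hk₂ : 0 ≤ k₂)
    (hF : ∀ u₁ u₂ v₁ v₂, |F u₁ u₂ - F v₁ v₂| ≤ k₁ * |u₁ - v₁| + k₂ * |u₂ - v₂|)
    (hu : |u| ≤ M₁) (hv : |v| ≤ M₂) : |F u v| ≤ |F 0 0| + (k₁ * M₁ + k₂ * M₂) := by
  have h1 := hF u v 0 0
  rw [sub_zero, sub_zero] at h1
  have h2 := abs_sub_abs_le_abs_sub (F u v) (F 0 0)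
  have h3 := mul_le_mul_of_nonneg_left hu hk₁
  have h4 := mul_le_mul_of_nonneg_left hv hk₂
  linarith

theorem abs_integral_comp_le {μ : Measure ℝ} [IsProbabilityMeasure μ] {F z : ℝ → ℝ} {k M : ℝ}
    (hk : 0 ≤ k) (hF : ∀ u v, |F u - F v| ≤ k * |u - v|) (hz : ∀ s, |z s| ≤ M) :
    |∫ s in Set.Iic (0:ℝ), F (z s) ∂μ| ≤ |F 0| + k * M := by
  have h : ∀ s, |F (z s)| ≤ |F 0| + k * M := fun s => by
    have h1 := hF (z s) 0
    rw [sub_zero] at h1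
    have h2 := abs_sub_abs_le_abs_sub (F (z s)) (F 0)
    have h3 := mul_le_mul_of_nonneg_left (hz s) hk
    linarith
  refine (norm_setIntegral_le_of_norm_le_const (f := fun s => F (z s)) (measure_lt_top _ _)
    fun s _ => h s).trans ?_
  exact mul_le_of_le_one_right ((abs_nonneg _).trans (h 0)) measureReal_le_one

/-- Perturbing a vanishing amount of delay does not matter for eventually Lipschitz functions. -/
theorem tendsto_comp_delay_sub {x τ τ' : ℝ → ℝ} {L T B : ℝ}
    (hx : ∀ s ≥ T, ∀ t ≥ T, |x t - x s| ≤ L * |t - s|)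
    (hτ : Tendsto (fun t => τ t - τ' t) atTop (nhds 0)) (hB : ∀ t ≥ (0:ℝ), |τ' t| ≤ B) :
    Tendsto (fun t => x (t - τ t) - x (t - τ' t)) atTop (nhds 0) := by
  have h := hτ.abs.const_mul L
  simp only [abs_zero, mul_zero] at h
  refine squeeze_zero_norm' ?_ h
  filter_upwards [eventually_ge_atTop 0, eventually_ge_atTop (T + B + 1),
    hτ.abs.eventually_le_const (by simp : |(0:ℝ)| < 1)] with t h0 h1 h2
  have h3 := abs_le.1 (hB t h0)
  have h4 := abs_le.1 h2
  refine (hx _ (by linarith) _ (by linarith)).trans_eq ?_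
  rw [← abs_neg]
  ring_nf

theorem exists_bound_of_periodic_on {F : ℝ → ℝ} {ω : ℝ} (hω : 0 < ω)
    (hF : ContinuousOn F (Set.Ici 0)) (hp : ∀ t ≥ 0, F (t + ω) = F t) :
    ∃ C, ∀ t ≥ (0:ℝ), |F t| ≤ C := by
  obtain ⟨C, hC⟩ := (continuous_periodicExtension_real hω hF hp).exists_bound_of_periodic hω
    fun t => by simpa using periodicExtension_add hω F 1 t
  exact ⟨C, fun t ht => by simpa only [periodicExtension_eq hω hp ht] using hC t⟩

namespace HOData

variable {n P Q : ℕ} {S T : HOData n P Q} {ω : ℝ} {K : HOLip n P Q}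

/-- `T` is an asymptotic system of `S`, as far as the nonlocal inputs are concerned. -/
structure Asymptotic (S T : HOData n P Q) : Prop where
  Gf_eq : S.Gf = T.Gf
  Hf_eq : S.Hf = T.Hf
  h_eq : S.h = T.h
  f_eq : S.f = T.f
  g_eq : S.g = T.g
  G_eq : S.G = T.G
  η_eq : S.η = T.η
  ρ_eq : S.ρ = T.ρ
  c_lim : ∀ i j l p, Tendsto (fun t => S.c i j l p t - T.c i j l p t) atTop (nhds 0)
  d_lim : ∀ i j l q, Tendsto (fun t => S.d i j l q t - T.d i j l q t) atTop (nhds 0)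
  I_lim : ∀ i, Tendsto (fun t => S.I i t - T.I i t) atTop (nhds 0)

theorem Asymptotic.core (h : S.Asymptotic T) (hT : T.Core K) : S.Core K := by
  obtain ⟨h1, h2, h3, h4, h5, h6, h7, h8, -, -, -⟩ := h
  refine ⟨hT.γ_pos, hT.μ_pos, hT.ξ_pos, hT.Ξ_pos, hT.ζ_pos, ?_, ?_, ?_, ?_, ?_, ?_, ?_, ?_, ?_, ?_,
    ?_, ?_, ?_, ?_⟩ <;> simp only [h1, h2, h3, h4, h5, h6, h7, h8]
  exacts [hT.h_lip, hT.f_lip, hT.g_lip, hT.G_lip, hT.Gf_lip, hT.Hf_lip, hT.Gf_cont, hT.Hf_cont,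
    hT.h_cont, hT.f_cont, hT.g_cont, hT.G_cont, hT.η_prob, hT.ρ_prob]

theorem Asymptotic.tendsto_modulus_sub (h : S.Asymptotic T) (i : Fin (n+1))
    (r : Fin (n+1) → ℝ) :
    Tendsto (fun t => S.modulus K i r t - T.modulus K i r t) atTop (nhds 0) := by
  have h1 := tendsto_finsetSum (Finset.univ : Finset (Fin (P+1))) fun p _ =>
    tendsto_finsetSum (Finset.univ : Finset (Fin (n+1))) fun j _ =>
    tendsto_finsetSum (Finset.univ : Finset (Fin (n+1))) fun l _ =>
      (tendsto_abs_sub_abs (h.c_lim i j l p)).mul_const (K.γ1 i j l p * r j + K.γ2 i j l p * r l)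
  have h2 := tendsto_finsetSum (Finset.univ : Finset (Fin (Q+1))) fun q _ =>
    tendsto_finsetSum (Finset.univ : Finset (Fin (n+1))) fun j _ =>
    tendsto_finsetSum (Finset.univ : Finset (Fin (n+1))) fun l _ =>
      (tendsto_abs_sub_abs (h.d_lim i j l q)).mul_const
        (K.μ1 i j l q * (K.ξ i j q * r j) + K.μ2 i j l q * (K.Ξ i l q * r l))
  have h3 := (h1.const_mul (K.ζ i)).add (h2.const_mul (K.ς i))
  simp only [zero_mul, Finset.sum_const_zero, mul_zero, add_zero] at h3
  refine h3.congr fun t => ?_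
  simp only [modulus, sub_mul, Finset.sum_sub_distrib, mul_sub]
  ring

theorem Asymptotic.tendsto_net_sub (h : S.Asymptotic T) (hT : T.Core K)
    (hcB : ∀ i j l p, ∃ B, ∀ t ≥ (0:ℝ), |T.c i j l p t| ≤ B)
    (hdB : ∀ i j l q, ∃ B, ∀ t ≥ (0:ℝ), |T.d i j l q t| ≤ B)
    {x : Fin (n+1) → ℝ → ℝ} {M : ℝ} (hM : ∀ j t, |x j t| ≤ M) {i : Fin (n+1)}
    (hτ : ∀ j p, Tendsto (fun t => x j (t - S.τ i j p t) - x j (t - T.τ i j p t)) atTop (nhds 0))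
    (hσ : ∀ l p, Tendsto (fun t => x l (t - S.σ i l p t) - x l (t - T.σ i l p t)) atTop (nhds 0)) :
    Tendsto (fun t => S.net i x t - T.net i x t) atTop (nhds 0) := by
  have hM0 : 0 ≤ M := (abs_nonneg _).trans (hM i 0)
  have h1 : Tendsto (fun t => S.discrete i x t - T.discrete i x t) atTop (nhds 0) := by
    simp only [discrete, ← Finset.sum_sub_distrib, h.h_eq]
    have := tendsto_finsetSum (Finset.univ : Finset (Fin (P+1))) fun p _ =>
      tendsto_finsetSum (Finset.univ : Finset (Fin (n+1))) fun j _ =>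
      tendsto_finsetSum (Finset.univ : Finset (Fin (n+1))) fun l _ =>
        tendsto_mul_sub_mul (h.c_lim i j l p)
          (tendsto_sub_of_lipschitz₂ (hT.h_lip i j l p) (hτ j p) (hσ l p))
          (fun t => abs_le_of_lipschitz₂ (hT.γ_pos i j l p).1.le (hT.γ_pos i j l p).2.le
            (hT.h_lip i j l p) (hM j _) (hM l _))
          ((eventually_ge_atTop 0).mono (hcB i j l p).choose_spec)
    simpa using this
  have h2 : Tendsto (fun t => S.distributed i x t - T.distributed i x t) atTop (nhds 0) := by
    simp only [distributed, ← Finset.sum_sub_distrib, h.f_eq, h.g_eq, h.G_eq, h.η_eq, h.ρ_eq]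
    have := tendsto_finsetSum (Finset.univ : Finset (Fin (Q+1))) fun q _ =>
      tendsto_finsetSum (Finset.univ : Finset (Fin (n+1))) fun j _ =>
      tendsto_finsetSum (Finset.univ : Finset (Fin (n+1))) fun l _ => by
        have hη := hT.η_prob i j q
        have hρ := hT.ρ_prob i l q
        have hg : ∀ t, |∫ s in Set.Iic (0:ℝ), T.g i j q (x j (t + s)) ∂(T.η i j q)| ≤
            |T.g i j q 0| + K.ξ i j q * M := fun t =>
          abs_integral_comp_le (hT.ξ_pos i j q).le (hT.g_lip i j q) fun s => hM j _
        have hG : ∀ t, |∫ s in Set.Iic (0:ℝ), T.G i l q (x l (t + s)) ∂(T.ρ i l q)| ≤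
            |T.G i l q 0| + K.Ξ i l q * M := fun t =>
          abs_integral_comp_le (hT.Ξ_pos i l q).le (hT.G_lip i l q) fun s => hM l _
        exact tendsto_mul_sub_mul (h.d_lim i j l q)
          (u := fun t => T.f i j l q (∫ s in Set.Iic (0:ℝ), T.g i j q (x j (t + s)) ∂(T.η i j q))
            (∫ s in Set.Iic (0:ℝ), T.G i l q (x l (t + s)) ∂(T.ρ i l q)))
          (u' := fun t => T.f i j l q (∫ s in Set.Iic (0:ℝ), T.g i j q (x j (t + s)) ∂(T.η i j q))
            (∫ s in Set.Iic (0:ℝ), T.G i l q (x l (t + s)) ∂(T.ρ i l q)))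
          (by simp)
          (fun t => abs_le_of_lipschitz₂ (hT.μ_pos i j l q).1.le (hT.μ_pos i j l q).2.le
            (hT.f_lip i j l q) (hg t) (hG t))
          ((eventually_ge_atTop 0).mono (hdB i j l q).choose_spec)
    simpa using this
  have h3 := ((tendsto_sub_of_lipschitz (hT.Gf_lip i) h1).add
    (tendsto_sub_of_lipschitz (hT.Hf_lip i) h2)).add (h.I_lim i)
  simp only [add_zero] at h3
  refine h3.congr fun t => ?_
  simp only [net, h.Gf_eq, h.Hf_eq]
  ring

end HOData

namespace HOData

variable {n P Q : ℕ} {S T : HOData n P Q} {ω : ℝ} {K : HOLip n P Q} {x : Fin (n+1) → ℝ → ℝ}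

/-- Uniform diagonal dominance passes to asymptotically equal systems. -/
theorem Asymptotic.eventually_bounds (h : S.Asymptotic T) (hT : T.Core K)
    (hcB : ∀ i j l p, ∃ B, ∀ t ≥ (0:ℝ), |T.c i j l p t| ≤ B)
    (hdB : ∀ i j l q, ∃ B, ∀ t ≥ (0:ℝ), |T.d i j l q t| ≤ B) {β β' : Fin (n+1) → ℝ → ℝ}
    (hβ : ∀ i, Tendsto (fun t => β i t - β' i t) atTop (nhds 0))
    (hb : ∀ i, Tendsto (fun t => S.b i t 0 - T.b i t 0) atTop (nhds 0))
    {w : Fin (n+1) → ℝ} (hw : ∀ i, 0 < w i) {ε C : ℝ} (hε : 0 < ε)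
    (hbd : ∀ i, ∀ t ≥ (0:ℝ), T.modulus K i w t + ε * w i ≤ β' i t * w i ∧
      |T.b i t 0| + |T.net i (fun _ _ => 0) t| ≤ C) :
    ∀ᶠ t in atTop, ∀ i, S.modulus K i w t + ε / 2 * w i ≤ β i t * w i ∧
      |S.b i t 0| + |S.net i (fun _ _ => 0) t| ≤ C + 2 := by
  refine eventually_all.2 fun i => ?_
  have h1 := ((hβ i).mul_const (w i)).sub (h.tendsto_modulus_sub (K := K) i w)
  have h2 : Tendsto (fun t => S.net i (fun _ _ => 0) t - T.net i (fun _ _ => 0) t) atTop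
      (nhds 0) :=
    h.tendsto_net_sub hT hcB hdB (M := 0) (by simp) (by simp) (by simp)
  simp only [zero_mul, sub_zero] at h1
  have hpos : -(ε / 2 * w i) < 0 := by
    have := hw i
    rw [neg_lt_zero]
    positivity
  filter_upwards [eventually_ge_atTop 0, h1.eventually_const_le hpos,
    h2.abs.eventually_le_const (by simp : |(0:ℝ)| < 1),
    (hb i).abs.eventually_le_const (by simp : |(0:ℝ)| < 1)] with t ht k1 k2 k3
  have h3 := hbd i t ht
  have h4 := abs_sub_abs_le_abs_sub (S.b i t 0) (T.b i t 0)
  have h5 := abs_sub_abs_le_abs_sub (S.net i (fun _ _ => 0) t) (T.net i (fun _ _ => 0) t)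
  constructor
  · linarith
  · linarith

theorem Regular.delay_nonneg (h : S.Regular) {t : ℝ} (ht : 0 ≤ t) :
    (∀ i j p, 0 ≤ S.τ i j p t) ∧ ∀ i l p, 0 ≤ S.σ i l p t := by
  obtain ⟨-, -, -, -, -, -, -, -, -, -, hτ, hσ, -⟩ := h
  exact ⟨fun i j p => hτ i j p t ht, fun i l p => hσ i l p t ht⟩

/-- Solutions of an eventually diagonally dominant system are bounded. -/
theorem IsSolution.exists_bound {t₀ : ℝ} (hx : S.IsSolution t₀ x) (hreg : S.Regular)
    (hS : S.Core K) {β : Fin (n+1) → ℝ → ℝ}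
    (hsec : ∀ i, ∀ t ≥ (0:ℝ), ∀ u v : ℝ, u ≠ v → β i t ≤ (S.b i t u - S.b i t v) / (u - v))
    {w : Fin (n+1) → ℝ} (hw : ∀ i, 0 < w i) {ε C : ℝ} (hε : 0 < ε)
    (hbd : ∀ᶠ t in atTop, ∀ i, S.modulus K i w t + ε * w i ≤ β i t * w i ∧
      |S.b i t 0| + |S.net i (fun _ _ => 0) t| ≤ C) :
    ∃ M, ∀ i t, |x i t| ≤ M := by
  obtain ⟨hc, ⟨M₀, hM₀⟩, hd⟩ := hx
  obtain ⟨T₁, hT₁⟩ := eventually_atTop.1 hbd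
  set T := max (max T₁ t₀) 0 with hT
  have h1 i : ∃ D, ∀ t ≤ T, |x i t| ≤ D := by
    obtain ⟨D, hD⟩ := (isCompact_Icc (a := t₀) (b := T)).exists_bound_of_continuousOn
      (hc i).continuousOn
    refine ⟨max M₀ D, fun t ht => ?_⟩
    rcases le_total t t₀ with h | h
    · exact (hM₀ i t h).trans (le_max_left _ _)
    · exact (hD t ⟨h, ht⟩).trans (le_max_right _ _)
  choose D hD using h1
  obtain ⟨E, hE⟩ := (Set.finite_range D).bddAbove
  obtain ⟨M, hM, hMw⟩ := exists_scale hε hw C E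
  have key := abs_lt_of_inward (r := fun i => M * w i) hc (T := T)
    (fun i t ht => ((hD i t ht).trans (hE ⟨i, rfl⟩)).trans_lt (hMw i).2)
    fun t ht hle i hi => by
      have ht0 : 0 ≤ t := (le_max_right _ _).trans ht.le
      have htt₀ : t₀ < t := ((le_max_right _ _).trans (le_max_left _ _)).trans_lt ht
      have htT : T₁ ≤ t := ((le_max_left _ _).trans (le_max_left _ _)).trans ht.le
      obtain ⟨hτ, hσ⟩ := hreg.delay_nonneg ht0
      have h2 := hS.dissip hτ hσ hc hM hw hle hi (sector_sq_le (hsec i t ht0) _)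
        (hT₁ t htT i).1 (hT₁ t htT i).2 (hMw i).1
      refine ⟨_, hd i t htt₀, ?_⟩
      rw [rhs_eq, mul_left_comm]
      exact mul_neg_of_pos_of_neg (hreg.2.1 i t ht0 _) h2
  obtain ⟨F, hF⟩ := (Set.finite_range fun i => M * w i).bddAbove
  exact ⟨F, fun i t => (key i t).le.trans (hF ⟨i, rfl⟩)⟩

theorem lipschitz_of_hasDerivAt {y y' : ℝ → ℝ} {T L : ℝ}
    (hy : ∀ t ≥ T, HasDerivAt y (y' t) t) (hL : ∀ t ≥ T, |y' t| ≤ L) :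
    ∀ s ≥ T, ∀ t ≥ T, |y t - y s| ≤ L * |t - s| := fun _ hs _ ht =>
  (convex_Ici T).norm_image_sub_le_of_norm_hasDerivWithin_le
    (fun r hr => (hy r hr).hasDerivWithinAt) hL hs ht

/-- Bounded solutions are solutions of the periodic system up to a vanishing error. -/
theorem IsSolution.tendsto_rhs_sub {t₀ : ℝ} (hx : S.IsSolution t₀ x) (hω : 0 < ω)
    (h : S.Asymptotic T) (ha : S.a = T.a) (hT : T.Core K) (hregT : T.Regular) (t3 : T.T3 ω)
    (hregS : S.Regular) {aU : Fin (n+1) → ℝ} (haU : ∀ i, ∀ t ≥ (0:ℝ), ∀ v, T.a i t v ≤ aU i)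
    (hb : ∀ i, ∀ w : ℝ → ℝ, Continuous w → (∃ M, ∀ t, |w t| ≤ M) →
      Tendsto (fun t => S.b i t (w t) - T.b i t (w t)) atTop (nhds 0))
    (hτ : ∀ i j p, Tendsto (fun t => S.τ i j p t - T.τ i j p t) atTop (nhds 0))
    (hσ : ∀ i l p, Tendsto (fun t => S.σ i l p t - T.σ i l p t) atTop (nhds 0))
    {C : ℝ} (hC : ∀ᶠ t in atTop, ∀ i, |S.net i (fun _ _ => 0) t| ≤ C)
    {M : ℝ} (hM : ∀ i t, |x i t| ≤ M) (i : Fin (n+1)) :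
    Tendsto (fun t => S.rhs x i t - T.rhs x i t) atTop (nhds 0) := by
  obtain ⟨hc, -, hd⟩ := hx
  have hS := h.core hT
  have hL := hregT.periodize hω t3
  have hbi j := hb j (x j) (hc j) ⟨M, hM j⟩
  have hapos j t (ht : 0 ≤ t) v : |S.a j t v| ≤ aU j := by
    rw [abs_of_pos (hregS.2.1 j t ht v), ha]
    exact haU j t ht v
  have hlip j : ∃ L T₁ : ℝ, ∀ s ≥ T₁, ∀ t ≥ T₁, |x j t - x j s| ≤ L * |t - s| := by
    obtain ⟨B₁, hB₁⟩ := exists_bound_modulus_periodize (K := K) hω hL j fun _ => M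
    obtain ⟨B₂, hB₂⟩ := exists_bound_b_periodize hω hL j M
    obtain ⟨T₁, hT₁⟩ := eventually_atTop.1 (((hbi j).abs.eventually_le_const
      (by simp : |(0:ℝ)| < 1)).and ((hC.and (((h.tendsto_modulus_sub (K := K) j
        fun _ => M).eventually_le_const one_pos))).and ((eventually_gt_atTop t₀).and
        (eventually_ge_atTop 0))))
    refine ⟨aU j * (B₂ + 1 + (C + (B₁ + 1))), T₁,
      lipschitz_of_hasDerivAt (fun t ht => hd j t (hT₁ t ht).2.2.1) fun t ht => ?_⟩
    obtain ⟨k1, ⟨k2, k3⟩, -, ht0⟩ := hT₁ t ht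
    obtain ⟨pa, pb, pn, pm, -⟩ := t3.periodize_eq (K := K) hω ht0
    obtain ⟨hτ0, hσ0⟩ := hregS.delay_nonneg ht0
    have k4 := hB₁ t
    have k5 := hB₂ t (x j t) (hM j t)
    rw [pm] at k4
    rw [pb] at k5
    have k6 := hS.abs_net_sub_le hτ0 hσ0 (M := M) (r := fun _ => M) hc (y := fun _ _ => 0)
      (fun _ => continuous_const) (fun j s _ => hM j s)
      (fun j s _ => by simpa using (abs_nonneg _).trans (hM j s))
      (fun j s _ => by simpa using hM j s) j
    have k7 := abs_sub_abs_le_abs_sub (S.net j x t) (S.net j (fun _ _ => 0) t)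
    have k8 := abs_sub_abs_le_abs_sub (S.b j t (x j t)) (T.b j t (x j t))
    have k9 := k2 j
    rw [rhs_eq, abs_mul]
    refine mul_le_mul (hapos j t ht0 _) ((abs_add_le _ _).trans (add_le_add ?_ ?_))
      (abs_nonneg _) ((abs_nonneg _).trans (hapos j t ht0 0))
    · rw [abs_neg]
      linarith
    · linarith [le_abs_self (T.modulus K j (fun _ => M) t)]
  obtain ⟨-, -, -, -, -, qc, qd, -, qτ, qσ, -⟩ := hregT
  obtain ⟨-, -, pc, pd, pτ, pσ, -⟩ := t3
  have hnet : Tendsto (fun t => S.net i x t - T.net i x t) atTop (nhds 0) := by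
    refine h.tendsto_net_sub hT
      (fun i j l p => exists_bound_of_periodic_on hω (qc i j l p) (pc i j l p))
      (fun i j l q => exists_bound_of_periodic_on hω (qd i j l q) (pd i j l q)) hM
      (fun j p => ?_) (fun j p => ?_)
    · obtain ⟨L, T₁, hl⟩ := hlip j
      obtain ⟨B, hB⟩ := exists_bound_of_periodic_on hω (qτ i j p) (pτ i j p)
      exact tendsto_comp_delay_sub hl (hτ i j p) hB
    · obtain ⟨L, T₁, hl⟩ := hlip j
      obtain ⟨B, hB⟩ := exists_bound_of_periodic_on hω (qσ i j p) (pσ i j p)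
      exact tendsto_comp_delay_sub hl (hσ i j p) hB
  have h1 := ((hnet.sub (hbi i)).abs).const_mul (aU i)
  simp only [sub_zero, abs_zero, mul_zero] at h1
  refine squeeze_zero_norm' ?_ h1
  filter_upwards [eventually_ge_atTop 0] with t ht
  have h2 : S.rhs x i t - T.rhs x i t = S.a i t (x i t) *
      (S.net i x t - T.net i x t - (S.b i t (x i t) - T.b i t (x i t))) := by
    rw [rhs_eq, rhs_eq, ha]
    ring
  rw [Real.norm_eq_abs, h2, abs_mul]
  exact mul_le_mul_of_nonneg_right (hapos i t ht _) (abs_nonneg _)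

end HOData

/-- Corollary 4.4: all solutions of the (not necessarily periodic) high-order system (H)
converge to an ω-periodic solution of its periodic asymptotic system (Ĥ). -/
theorem ho_convergence_to_periodic_solution {n P Q : ℕ} (ω : ℝ) (hω : 0 < ω)
    (Sh S : HOData n P Q)
    (hsame : S.a = Sh.a ∧ S.Gf = Sh.Gf ∧ S.Hf = Sh.Hf ∧ S.h = Sh.h ∧ S.f = Sh.f ∧
      S.g = Sh.g ∧ S.G = Sh.G ∧ S.η = Sh.η ∧ S.ρ = Sh.ρ)
    (aL aU : Fin (n+1) → ℝ) (A : Fin (n+1) → ℝ → ℝ) (βh βs : Fin (n+1) → ℝ → ℝ)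
    (γ1 γ2 : Fin (n+1) → Fin (n+1) → Fin (n+1) → Fin (P+1) → ℝ)
    (μ1 μ2 : Fin (n+1) → Fin (n+1) → Fin (n+1) → Fin (Q+1) → ℝ)
    (ξ Ξ : Fin (n+1) → Fin (n+1) → Fin (Q+1) → ℝ) (ζ ς : Fin (n+1) → ℝ)
    (hregh : Sh.Regular) (hregS : S.Regular)
    (t1 : Sh.T1 aL aU A) (t2 : Sh.T2 γ1 γ2 μ1 μ2 ξ Ξ ζ ς) (t3 : Sh.T3 ω)
    (t4 : Sh.T4 ω βh βs)
    (β : Fin (n+1) → ℝ → ℝ)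
    (hβc : ∀ i, ContinuousOn (β i) (Set.Ici 0)) (hβ0 : ∀ i, ∀ t ≥ (0:ℝ), 0 ≤ β i t)
    (hbsec : ∀ i, ∀ t ≥ (0:ℝ), ∀ u v : ℝ, u ≠ v → β i t ≤ (S.b i t u - S.b i t v) / (u - v))
    (hβconv : ∀ i, Tendsto (fun t => β i t - βh i t) atTop (nhds 0))
    (hbconv : ∀ i, ∀ w : ℝ → ℝ, Continuous w → (∃ M, ∀ t, |w t| ≤ M) →
      Tendsto (fun t => S.b i t (w t) - Sh.b i t (w t)) atTop (nhds 0))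
    (hcconv : ∀ i j l p, Tendsto (fun t => S.c i j l p t - Sh.c i j l p t) atTop (nhds 0))
    (hdconv : ∀ i j l q, Tendsto (fun t => S.d i j l q t - Sh.d i j l q t) atTop (nhds 0))
    (hτconv : ∀ i j p, Tendsto (fun t => S.τ i j p t - Sh.τ i j p t) atTop (nhds 0))
    (hσconv : ∀ i l p, Tendsto (fun t => S.σ i l p t - Sh.σ i l p t) atTop (nhds 0))
    (hIconv : ∀ i, Tendsto (fun t => S.I i t - Sh.I i t) atTop (nhds 0))
    (dv : Fin (n+1) → ℝ) (hdv : ∀ i, 0 < dv i)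
    (hdom : ∀ i, ∀ t ∈ Set.Icc (0:ℝ) ω,
      (∑ j : Fin (n+1), ∑ l : Fin (n+1),
        ((∑ p : Fin (P+1), ζ i * |Sh.c i j l p t| *
            ((dv j / dv i) * γ1 i j l p + (dv l / dv i) * γ2 i j l p))
          + ∑ q : Fin (Q+1), ς i * |Sh.d i j l q t| *
            ((dv j / dv i) * μ1 i j l q * ξ i j q + (dv l / dv i) * μ2 i j l q * Ξ i l q)))
        < βh i t)
    (hdom2 : ∀ i, ∀ t ∈ Set.Icc (0:ℝ) ω,
      -((βh i t + A i t) * aL i) +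
        (∑ j : Fin (n+1), ∑ l : Fin (n+1),
          ((∑ p : Fin (P+1), ζ i * |Sh.c i j l p t| *
              (γ1 i j l p * aU j * (dv j / dv i) + γ2 i j l p * aU l * (dv l / dv i)))
            + ∑ q : Fin (Q+1), ς i * |Sh.d i j l q t| *
              (μ1 i j l q * ξ i j q * aU j * (dv j / dv i)
                + μ2 i j l q * Ξ i l q * aU l * (dv l / dv i)))) < 0) :
    ∃ xper : Fin (n+1) → ℝ → ℝ,
      (∀ i, Continuous (xper i)) ∧
      (∀ i, ∀ t : ℝ, xper i (t + ω) = xper i t) ∧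
      (∀ i, ∀ t : ℝ, 0 < t → HasDerivAt (xper i) (Sh.rhs xper i t) t) ∧
      (∀ t₀ : ℝ, 0 ≤ t₀ → ∀ x : Fin (n+1) → ℝ → ℝ, S.IsSolution t₀ x →
        Tendsto (fun t => Finset.univ.sup' Finset.univ_nonempty
          (fun i => |x i t - xper i t|)) atTop (nhds 0)) := by
  obtain ⟨ea, eG, eH, eh, ef, eg, eGG, eη, eρ⟩ := hsame
  set K : HOLip n P Q := ⟨γ1, γ2, μ1, μ2, ξ, Ξ, ζ, ς⟩ with hK
  have hcore : Sh.Core K := hregh.core t2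
  have hA : S.Asymptotic Sh :=
    ⟨eG, eH, eh, ef, eg, eGG, eη, eρ, hcconv, hdconv, hIconv⟩
  have hmod (r : Fin (n+1) → ℝ) i t : Sh.modulus K i r t / dv i =
      Sh.modulus K i (fun j => r j / dv i) t := by
    have h := modulus_smul (S := Sh) (K := K) (dv i)⁻¹ i r t
    simp only [div_eq_inv_mul]
    exact h.symm
  have hdom' : ∀ i, ∀ t ∈ Set.Icc 0 ω, Sh.modulus K i dv t < βh i t * dv i := fun i t ht => by
    rw [← div_lt_iff₀ (hdv i), hmod, modulus_eq]
    refine lt_of_eq_of_lt ?_ (hdom i t ht)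
    refine Finset.sum_congr rfl fun j _ => Finset.sum_congr rfl fun l _ => congrArg₂ _ ?_ ?_ <;>
      exact Finset.sum_congr rfl fun _ _ => by ring
  have hdom2' : ∀ i, ∀ t ∈ Set.Icc 0 ω, -((βh i t + A i t) * aL i)
      + Sh.modulus K i (fun j => aU j * dv j) t / dv i < 0 := fun i t ht => by
    rw [hmod, modulus_eq]
    refine lt_of_eq_of_lt (congrArg _ ?_) (hdom2 i t ht)
    refine Finset.sum_congr rfl fun j _ => Finset.sum_congr rfl fun l _ => congrArg₂ _ ?_ ?_ <;>
      exact Finset.sum_congr rfl fun _ _ => by ring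
  obtain ⟨Z, hZω, hZR⟩ := exists_periodicSystem hω hregh hcore t3 t1 t4 hdv hdom' hdom2'
  obtain ⟨y, hyc, hyp, hyd, hy⟩ := Z.exists_periodic_attractor
  have hR (x : Fin (n+1) → ℝ → ℝ) i {t : ℝ} (ht : 0 ≤ t) : Z.R i x t = Sh.rhs x i t := by
    obtain ⟨pa, pb, pn, -⟩ := t3.periodize_eq (K := K) hω ht
    rw [hZR]
    simp only [rhs_eq, pa, pb, pn]
  refine ⟨y, hyc, fun i t => hZω ▸ hyp i t, fun i t ht => hR y i ht.le ▸ hyd i t, ?_⟩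
  intro t₀ _ x hx
  obtain ⟨ε, hε, C, hC⟩ := exists_uniform_bounds hω hregh hcore t3 t4.1
    (fun i t ht => (t4.2.2.2.1 i t ht).1) hdv hdom'
  have hev := hA.eventually_bounds hcore
    (fun i j l p => exists_bound_of_periodic_on hω (hregh.2.2.2.2.2.1 i j l p)
      (t3.2.2.1 i j l p))
    (fun i j l q => exists_bound_of_periodic_on hω (hregh.2.2.2.2.2.2.1 i j l q)
      (t3.2.2.2.1 i j l q))
    hβconv (fun i => hbconv i (fun _ => 0) continuous_const ⟨0, by simp⟩) hdv hε hC
  obtain ⟨M, hM⟩ := hx.exists_bound hregS (hA.core hcore) hbsec hdv (half_pos hε) hev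
  have hnet : ∀ᶠ t in atTop, ∀ i, |S.net i (fun _ _ => 0) t| ≤ C + 2 :=
    hev.mono fun t h i => (le_add_of_nonneg_left (abs_nonneg _)).trans (h i).2
  have hlim := hx.tendsto_rhs_sub hω hA ea hcore hregh t3 hregS
    (fun i t ht v => (t1.2.2.1 i t ht v).2) hbconv hτconv hσconv hnet hM
  have hconv := hy x M hx.1 hM fun ε hε => by
    refine (((eventually_all.2 fun i => (hlim i).abs.eventually_le_const
      (by simpa using hε : |(0:ℝ)| < ε)).and (eventually_gt_atTop t₀)).and
      (eventually_ge_atTop 0)).mono fun t ht i => ⟨_, hx.2.2 i t ht.1.2, ?_⟩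
    rw [hR x i ht.2]
    exact ht.1.1 i
  have hsup := Filter.Tendsto.finset_sup'_nhds_apply (Finset.univ_nonempty (α := Fin (n+1)))
    fun i _ => hconv i
  simpa using hsup
end

section
/- Assume (A1)–(A4). If there exist d₁,…,d_n > 0 such that for all t ∈ [0,ω] and all i: β_i > Σ_{j=1}^{n} [(|c_{ij}(t)| + |d_{ij}(t)|)·μ_j·ρ_j·(d_j/d_i) + Σ_{l=1}^{n} |e_{ijl}(t)|·((d_j/d_i)·M_l·μ_j·ρ_j + (d_l/d_i)·M_j·μ_l·ρ_l)], then the model (M) has an ω-periodic solution, i.e. there is a continuous ω-periodic x̃ : ℝ → ℝ^n that is differentiable and satisfies (M) for all t > 0. -/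
open MeasureTheory Filter

/-- Right-hand side of the high-order Cohen--Grossberg model (M). -/
noncomputable def Mrhs (n : ℕ) (ρc : Fin (n+1) → ℝ) (a b : Fin (n+1) → ℝ → ℝ)
    (c d : Fin (n+1) → Fin (n+1) → ℝ → ℝ) (e : Fin (n+1) → Fin (n+1) → Fin (n+1) → ℝ → ℝ)
    (I : Fin (n+1) → ℝ → ℝ) (f : Fin (n+1) → ℝ → ℝ) (K : Fin (n+1) → Fin (n+1) → ℝ → ℝ)
    (x : Fin (n+1) → ℝ → ℝ) (i : Fin (n+1)) (t : ℝ) : ℝ :=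
  a i (x i t) * (-(b i (x i t))
    + (∑ j : Fin (n+1), c i j t * f j (ρc j * x j t))
    + (∑ j : Fin (n+1), d i j t * f j (ρc j * ∫ u in Set.Ioi (0:ℝ), K i j u * x j (t - u)))
    + (∑ j : Fin (n+1), ∑ l : Fin (n+1), e i j l t
        * f j (ρc j * ∫ u in Set.Ioi (0:ℝ), K i j u * x j (t - u))
        * f l (ρc l * ∫ u in Set.Ioi (0:ℝ), K i l u * x l (t - u)))
    + I i t)

/-- A solution of (M) on `ℝ` with bounded initial condition at `t₀`. -/
def MIsSolution (n : ℕ) (ρc : Fin (n+1) → ℝ) (a b : Fin (n+1) → ℝ → ℝ)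
    (c d : Fin (n+1) → Fin (n+1) → ℝ → ℝ) (e : Fin (n+1) → Fin (n+1) → Fin (n+1) → ℝ → ℝ)
    (I : Fin (n+1) → ℝ → ℝ) (f : Fin (n+1) → ℝ → ℝ) (K : Fin (n+1) → Fin (n+1) → ℝ → ℝ)
    (t₀ : ℝ) (x : Fin (n+1) → ℝ → ℝ) : Prop :=
  (∀ i, Continuous (x i)) ∧
  (∃ M, ∀ i, ∀ t ≤ t₀, |x i t| ≤ M) ∧
  (∀ i, ∀ t, t₀ < t → HasDerivAt (x i) (Mrhs n ρc a b c d e I f K x i t) t)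

/-- Standing regularity assumptions on the data of model (M). -/
def MRegular (n : ℕ) (ρc : Fin (n+1) → ℝ) (a b : Fin (n+1) → ℝ → ℝ)
    (c d : Fin (n+1) → Fin (n+1) → ℝ → ℝ) (e : Fin (n+1) → Fin (n+1) → Fin (n+1) → ℝ → ℝ)
    (I : Fin (n+1) → ℝ → ℝ) (f : Fin (n+1) → ℝ → ℝ)
    (K : Fin (n+1) → Fin (n+1) → ℝ → ℝ) : Prop :=
  (∀ j, 0 < ρc j) ∧
  (∀ i, Continuous (a i)) ∧ (∀ i u, 0 < a i u) ∧
  (∀ i, Continuous (b i)) ∧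
  (∀ i j, ContinuousOn (c i j) (Set.Ici 0)) ∧
  (∀ i j, ContinuousOn (d i j) (Set.Ici 0)) ∧
  (∀ i j l, ContinuousOn (e i j l) (Set.Ici 0)) ∧
  (∀ i, ContinuousOn (I i) (Set.Ici 0)) ∧
  (∀ j, Continuous (f j)) ∧
  (∀ i j, ContinuousOn (K i j) (Set.Ici 0)) ∧
  (∀ i j, ∀ u ≥ (0:ℝ), 0 ≤ K i j u) ∧
  (∀ i j, ∫ u in Set.Ioi (0:ℝ), K i j u = 1)

/-- Assumptions (A1)-(A4) on model (M). -/
def MAssumptions (n : ℕ) (ω : ℝ) (ρc : Fin (n+1) → ℝ) (a b : Fin (n+1) → ℝ → ℝ)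
    (c d : Fin (n+1) → Fin (n+1) → ℝ → ℝ) (e : Fin (n+1) → Fin (n+1) → Fin (n+1) → ℝ → ℝ)
    (I : Fin (n+1) → ℝ → ℝ) (f : Fin (n+1) → ℝ → ℝ)
    (aL aU β βs M μ : Fin (n+1) → ℝ) : Prop :=
  -- (A1) ω-periodicity of the coefficients
  (∀ i j, ∀ t ≥ (0:ℝ), c i j (t + ω) = c i j t) ∧
  (∀ i j, ∀ t ≥ (0:ℝ), d i j (t + ω) = d i j t) ∧
  (∀ i j l, ∀ t ≥ (0:ℝ), e i j l (t + ω) = e i j l t) ∧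
  (∀ i, ∀ t ≥ (0:ℝ), I i (t + ω) = I i t) ∧
  -- (A2)
  (∀ i, 0 < aL i) ∧ (∀ i, aL i ≤ aU i) ∧
  (∀ i, ∀ u : ℝ, aL i ≤ a i u ∧ a i u ≤ aU i) ∧
  -- (A3)
  (∀ i, 0 < β i) ∧ (∀ i, 0 < βs i) ∧
  (∀ i, ∀ u v : ℝ, u ≠ v → β i ≤ (b i u - b i v) / (u - v) ∧ (b i u - b i v) / (u - v) ≤ βs i) ∧
  -- (A4)
  (∀ i, 0 < M i) ∧ (∀ i, 0 < μ i) ∧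
  (∀ i, ∀ u v : ℝ, |f i u - f i v| ≤ μ i * |u - v|) ∧
  (∀ i, ∀ u : ℝ, |f i u| ≤ M i)

/-- `det (1 + t A)` is a polynomial in `t` of degree at most the dimension. -/
theorem exists_polynomial_eval_eq_det_one_add_smul {E : Type*} [NormedAddCommGroup E]
    [NormedSpace ℝ E] [FiniteDimensional ℝ E] (A : E →L[ℝ] E) :
    ∃ P : Polynomial ℝ, P.natDegree ≤ Module.finrank ℝ E ∧
      ∀ t : ℝ, P.eval t = (ContinuousLinearMap.id ℝ E + t • A).det := by
  classical
  let b := Module.finBasis ℝ E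
  let m := LinearMap.toMatrix b b (A : E →ₗ[ℝ] E)
  refine ⟨Matrix.det ((Polynomial.X : Polynomial ℝ) • m.map Polynomial.C +
    (1 : Matrix _ _ ℝ).map Polynomial.C), ?_, fun t => ?_⟩
  · simpa using Polynomial.natDegree_det_X_add_C_le m 1
  · have h1 : (ContinuousLinearMap.id ℝ E + t • A).det = (1 + t • m).det := by
      rw [ContinuousLinearMap.det, ← LinearMap.det_toMatrix b]
      simp [m]
    rw [h1, ← Polynomial.coe_evalRingHom, RingHom.map_det]
    congr 1
    ext i j
    simp [Matrix.one_apply, apply_ite, add_comm, mul_comm t]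

/-- If `∫ det (1 + t A x) dν` is constant for small `t > 0`, it is constant for all `t`. -/
theorem integral_det_one_add_eq_of_forall_small {E : Type*} [NormedAddCommGroup E]
    [NormedSpace ℝ E] [FiniteDimensional ℝ E] [MeasurableSpace E] (ν : Measure E)
    (A : E → E →L[ℝ] E) {ε V : ℝ} (hε : 0 < ε)
    (hint : ∀ t : ℝ, Integrable (fun x => (ContinuousLinearMap.id ℝ E + t • A x).det) ν)
    (h : ∀ t : ℝ, 0 < t → t ≤ ε →
      ∫ x, (ContinuousLinearMap.id ℝ E + t • A x).det ∂ν = V) (t : ℝ) :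
    ∫ x, (ContinuousLinearMap.id ℝ E + t • A x).det ∂ν = V := by
  classical
  set s := Finset.range (Module.finrank ℝ E + 1)
  let v : ℕ → ℝ := fun k => ε / (k + 1)
  have hv : Set.InjOn v s := by
    intro j _ k _ hjk
    have : (j : ℝ) + 1 = k + 1 := by
      simp only [v] at hjk
      field_simp at hjk
      linarith
    exact_mod_cast add_right_cancel this
  have hs : s.Nonempty := ⟨0, by simp [s]⟩
  have key : ∀ x, (ContinuousLinearMap.id ℝ E + t • A x).det =
      ∑ k ∈ s, (Lagrange.basis s v k).eval t *
        (ContinuousLinearMap.id ℝ E + v k • A x).det := by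
    intro x
    obtain ⟨P, hP, hPe⟩ := exists_polynomial_eval_eq_det_one_add_smul (A x)
    have hd : P.degree < s.card := by
      refine lt_of_le_of_lt Polynomial.degree_le_natDegree ?_
      simp only [s, Finset.card_range]
      exact_mod_cast Nat.lt_succ_of_le hP
    have h1 := Lagrange.eq_interpolate hv hd
    rw [← hPe t]
    conv_lhs => rw [h1]
    simp [Lagrange.interpolate_apply, Polynomial.eval_finsetSum, hPe, mul_comm]
  simp_rw [key]
  rw [integral_finsetSum _ fun k _ => (hint _).const_mul _]
  have hk : ∀ k, ∫ x, (ContinuousLinearMap.id ℝ E + v k • A x).det ∂ν = V := fun k =>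
    h _ (by positivity) (div_le_self hε.le (by simp))
  simp_rw [integral_const_mul, hk, ← Finset.sum_mul, ← Polynomial.eval_finsetSum,
    Lagrange.sum_basis hv hs]
  simp

/-- There is no `C¹` retraction onto the unit sphere. The argument is Milnor's: the volume of the
image of the ball under `x ↦ x + t (r x - x)` is a polynomial in `t`, constant for small `t`. -/
theorem not_exists_contDiff_retraction_sphere {E : Type*} [NormedAddCommGroup E]
    [InnerProductSpace ℝ E] [FiniteDimensional ℝ E] {r : E → E} (hr : ContDiff ℝ 1 r)
    (h1 : ∀ x, ‖r x‖ = 1) (h2 : ∀ x, ‖x‖ = 1 → r x = x) : False := by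
  borelize E
  let B : Set E := Metric.ball 0 1
  let A : E → E →L[ℝ] E := fun x => fderiv ℝ r x - ContinuousLinearMap.id ℝ E
  have hA : Continuous A := (hr.continuous_fderiv one_ne_zero).sub continuous_const
  obtain ⟨C, hC⟩ := (isCompact_closedBall (0 : E) 1).exists_bound_of_continuousOn hA.continuousOn
  let f : ℝ → E → E := fun t x => x + t • (r x - x)
  have hf : ∀ t x, HasStrictFDerivAt (f t) (ContinuousLinearMap.id ℝ E + t • A x) x := fun t x =>
    (hasStrictFDerivAt_id x).add
      (((hr.contDiffAt.hasStrictFDerivAt one_ne_zero).sub (hasStrictFDerivAt_id x)).const_smul t)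
  have hC0 : 0 ≤ C := (norm_nonneg _).trans (hC 0 (by simp))
  have hdet0 : ∀ t : ℝ, 0 ≤ t → t * C < 1 → ∀ x ∈ Metric.closedBall (0 : E) 1,
      (ContinuousLinearMap.id ℝ E + t • A x).ker = ⊥ := by
    intro t ht htC x hx
    rw [LinearMap.ker_eq_bot']
    intro m hm
    have hm' : m = -(t • A x m) := eq_neg_of_add_eq_zero_left (by simpa using hm)
    have : ‖m‖ ≤ t * C * ‖m‖ := by
      calc ‖m‖ = t * ‖A x m‖ := by
            conv_lhs => rw [hm']
            rw [norm_neg, norm_smul, Real.norm_of_nonneg ht]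
        _ ≤ t * (C * ‖m‖) := by gcongr; exact (A x).le_of_opNorm_le (hC x hx) m
        _ = _ := by ring
    by_contra hne
    have : 0 < ‖m‖ := norm_pos_iff.2 hne
    nlinarith
  have hdet : ∀ t : ℝ, 0 ≤ t → t * C < 1 → ∀ x ∈ Metric.closedBall (0 : E) 1,
      0 < (ContinuousLinearMap.id ℝ E + t • A x).det := by
    intro t ht htC x hx
    by_contra hneg
    push Not at hneg
    have hcont : Continuous fun s : ℝ => (ContinuousLinearMap.id ℝ E + s • A x).det :=
      ContinuousLinearMap.continuous_det.comp (by fun_prop)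
    have h0 : (0 : ℝ) ∈ (fun s : ℝ => (ContinuousLinearMap.id ℝ E + s • A x).det) ''
        Set.Icc 0 t := by
      refine intermediate_value_Icc' ht hcont.continuousOn ⟨hneg, ?_⟩
      simp [ContinuousLinearMap.det]
    obtain ⟨s, hs, hs0⟩ := h0
    have := hdet0 s hs.1 (lt_of_le_of_lt (mul_le_mul_of_nonneg_right hs.2 hC0) htC) x hx
    exact (LinearMap.det_eq_zero_iff_ker_ne_bot.1 hs0) this
  have hinj : ∀ t : ℝ, 0 ≤ t → t * C < 1 → Set.InjOn (f t) (Metric.closedBall 0 1) := by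
    intro t ht htC x hx y hy hxy
    have hlip : ‖(r x - x) - (r y - y)‖ ≤ C * ‖x - y‖ :=
      (convex_closedBall (0 : E) 1).norm_image_sub_le_of_norm_hasFDerivWithin_le
        (f := fun x => r x - x) (f' := A)
        (fun z _ => ((hr.differentiable one_ne_zero z).hasFDerivAt.sub
          (hasFDerivAt_id z)).hasFDerivWithinAt) hC hy hx
    have heq : x - y = -(t • ((r x - x) - (r y - y))) := by
      have : x + t • (r x - x) = y + t • (r y - y) := hxy
      rw [smul_sub, ← sub_eq_zero]
      rw [← sub_eq_zero] at this
      rw [← this]; abel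
    have : ‖x - y‖ ≤ t * (C * ‖x - y‖) := by
      conv_lhs => rw [heq]
      rw [norm_neg, norm_smul, Real.norm_of_nonneg ht]
      gcongr
    by_contra hne
    have : 0 < ‖x - y‖ := norm_pos_iff.2 (sub_ne_zero.2 hne)
    nlinarith
  have himage : ∀ t : ℝ, 0 ≤ t → t < 1 → t * C < 1 → f t '' B = B := by
    intro t ht ht1 htC
    have hsub : f t '' B ⊆ B := by
      rintro _ ⟨x, hx, rfl⟩
      have hx' : ‖x‖ < 1 := by simpa [B] using hx
      have : f t x = (1 - t) • x + t • r x := by simp only [f]; module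
      simp only [B, mem_ball_zero_iff, this]
      calc ‖(1 - t) • x + t • r x‖ ≤ ‖(1 - t) • x‖ + ‖t • r x‖ := norm_add_le _ _
        _ = (1 - t) * ‖x‖ + t := by
          rw [norm_smul, norm_smul, Real.norm_of_nonneg ht, Real.norm_of_nonneg (by linarith),
            h1, mul_one]
        _ < 1 := by nlinarith
    refine hsub.antisymm ?_
    have hopen : IsOpen (f t '' B) := by
      rw [isOpen_iff_mem_nhds]
      rintro _ ⟨x, hx, rfl⟩
      have hsurj : (ContinuousLinearMap.id ℝ E + t • A x).range = ⊤ :=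
        LinearMap.ker_eq_bot_iff_range_eq_top.1 (hdet0 t ht htC x (Metric.ball_subset_closedBall hx))
      rw [← (hf t x).map_nhds_eq_of_surj hsurj]
      exact image_mem_map (Metric.isOpen_ball.mem_nhds hx)
    have hcont : Continuous (f t) := by
      have := hr.continuous
      fun_prop
    refine (convex_ball (0 : E) 1).isPreconnected.subset_of_closure_inter_subset hopen
      ⟨f t 0, hsub ⟨0, by simp [B], rfl⟩, 0, by simp [B], rfl⟩ ?_
    rintro y ⟨hy, hyB⟩
    have hcl : closure (f t '' B) ⊆ f t '' Metric.closedBall 0 1 :=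
      closure_minimal (Set.image_mono Metric.ball_subset_closedBall)
        ((isCompact_closedBall _ _).image hcont).isClosed
    obtain ⟨x, hx, rfl⟩ := hcl hy
    rcases (mem_closedBall_zero_iff.1 hx).lt_or_eq with hlt | heq
    · exact ⟨x, by simpa [B] using hlt, rfl⟩
    · have : f t x = x := by simp [f, h2 x heq]
      rw [this] at hyB
      simp [heq] at hyB
  have hint : ∀ t : ℝ, Integrable (fun x => (ContinuousLinearMap.id ℝ E + t • A x).det)
      (volume.restrict B) := by
    intro t
    have hcont : Continuous fun x => (ContinuousLinearMap.id ℝ E + t • A x).det :=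
      ContinuousLinearMap.continuous_det.comp (by fun_prop)
    exact (hcont.continuousOn.integrableOn_compact (isCompact_closedBall 0 1)).mono_set
      Metric.ball_subset_closedBall
  have hsmall : ∀ t : ℝ, 0 < t → t ≤ 1 / (C + 2) →
      ∫ x, (ContinuousLinearMap.id ℝ E + t • A x).det ∂(volume.restrict B) = volume.real B := by
    intro t ht htε
    rw [le_div_iff₀ (by linarith)] at htε
    have htC : t * C < 1 := by nlinarith
    have ht1 : t < 1 := by nlinarith
    have := integral_image_eq_integral_abs_det_fderiv_smul volume
      (s := B) Metric.isOpen_ball.measurableSet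
      (fun x _ => (hf t x).hasFDerivAt.hasFDerivWithinAt)
      ((hinj t ht.le htC).mono Metric.ball_subset_closedBall) (fun _ => (1 : ℝ))
    rw [himage t ht.le ht1 htC] at this
    simp only [integral_const, smul_eq_mul, mul_one, measureReal_restrict_apply_univ] at this
    rw [this]
    refine setIntegral_congr_fun Metric.isOpen_ball.measurableSet fun x hx => ?_
    exact (abs_of_pos (hdet t ht.le htC x (Metric.ball_subset_closedBall hx))).symm
  have hone := integral_det_one_add_eq_of_forall_small (volume.restrict B) A
    (ε := 1 / (C + 2)) (by positivity) hint hsmall 1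
  have hzero : ∀ x, (ContinuousLinearMap.id ℝ E + (1 : ℝ) • A x).det = 0 := by
    intro x
    have hAx : ContinuousLinearMap.id ℝ E + (1 : ℝ) • A x = fderiv ℝ r x := by simp [A]
    rw [hAx]
    by_contra hne
    have hrange : (fderiv ℝ r x).range = ⊤ := by
      rw [← LinearMap.ker_eq_bot_iff_range_eq_top]
      by_contra hk
      exact hne (LinearMap.det_eq_zero_iff_ker_ne_bot.2 hk)
    obtain ⟨v, hv⟩ : r x ∈ (fderiv ℝ r x).range := hrange ▸ Submodule.mem_top
    have hd := (hr.differentiable one_ne_zero x).hasFDerivAt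
    have hn := hd.inner ℝ hd
    have hc : (fun y => inner ℝ (r y) (r y)) = fun _ => (1 : ℝ) := by
      ext y; rw [real_inner_self_eq_norm_sq, h1]; norm_num
    rw [hc] at hn
    have := congrArg (fun L => L v) (hn.unique (hasFDerivAt_const (1 : ℝ) x))
    have hv' : fderiv ℝ r x v = r x := hv
    simp [hv', h1] at this
  simp only [hzero, integral_zero] at hone
  have : 0 < volume.real B :=
    ENNReal.toReal_pos (Metric.measure_ball_pos _ _ one_pos).ne' measure_ball_lt_top.ne
  linarith

theorem exists_fixedPoint_of_norm_le_quarter {E : Type*} [NormedAddCommGroup E]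
    [InnerProductSpace ℝ E] [FiniteDimensional ℝ E] {g : E → E} (hg : Continuous g)
    (hb : ∀ x, ‖g x‖ ≤ 1 / 4) : ∃ x, g x = x := by
  by_contra! hne
  obtain ⟨q, hq⟩ : ∃ q : E → E, ContDiff ℝ 1 q ∧
      ∀ x, q x ∈ Metric.ball (g x) ‖x - g x‖ ∩ Metric.ball 0 (1 / 2) := by
    obtain ⟨q, hq⟩ := exists_contMDiffMap_forall_mem_convex_of_local_const
      (n := 1) (modelWithCornersSelf ℝ E)
      (t := fun x => Metric.ball (g x) ‖x - g x‖ ∩ Metric.ball 0 (1 / 2))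
      (fun x => (convex_ball _ _).inter (convex_ball _ _)) fun x => by
        refine ⟨g x, ?_⟩
        have hlt : ∀ᶠ y in nhds x, dist (g x) (g y) < ‖y - g y‖ := by
          refine ContinuousAt.eventually_lt (by fun_prop) (by fun_prop) ?_
          simpa [sub_eq_zero] using (hne x).symm
        filter_upwards [hlt] with y hy
        refine ⟨hy, ?_⟩
        rw [mem_ball_zero_iff]
        linarith [hb x]
    exact ⟨q, q.contMDiff.contDiff, hq⟩
  obtain ⟨hqs, hq⟩ := hq
  let χ : ContDiffBump (0 : E) := ⟨1 / 2, 1, by norm_num, by norm_num⟩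
  let F : E → E := fun x => x - χ x • q x
  have hF : ContDiff ℝ 1 F := contDiff_id.sub (χ.contDiff.smul hqs)
  have hF0 : ∀ x, F x ≠ 0 := by
    intro x hx
    have hx' : x = χ x • q x := sub_eq_zero.1 hx
    rcases le_or_gt ‖x‖ (1 / 2) with h | h
    · have hχ : χ x = 1 := χ.one_of_mem_closedBall (by simpa [χ] using h)
      rw [hχ, one_smul] at hx'
      have := (hq x).1
      rw [← hx', Metric.mem_ball, dist_eq_norm] at this
      exact lt_irrefl _ this
    · have h2 := mem_ball_zero_iff.1 (hq x).2
      have : ‖x‖ ≤ 1 * ‖q x‖ := by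
        conv_lhs => rw [hx']
        rw [norm_smul, Real.norm_of_nonneg χ.nonneg]
        gcongr
        exact χ.le_one
      linarith
  refine not_exists_contDiff_retraction_sphere (r := fun x => (‖F x‖)⁻¹ • F x)
    (((hF.norm ℝ hF0).inv fun x => norm_ne_zero_iff.2 (hF0 x)).smul hF)
    (fun x => by rw [norm_smul, norm_inv, norm_norm, inv_mul_cancel₀ (norm_ne_zero_iff.2 (hF0 x))])
    fun x hx => ?_
  have hχ : χ x = 0 := χ.zero_of_le_dist (by simp [χ, hx])
  simp [F, hχ, hx]

/-- **Brouwer's fixed point theorem** for bounded continuous self-maps of a Euclidean space. -/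
theorem exists_fixedPoint_of_continuous_of_bounded {E : Type*} [NormedAddCommGroup E]
    [InnerProductSpace ℝ E] [FiniteDimensional ℝ E] {g : E → E} (hg : Continuous g) {C : ℝ}
    (hb : ∀ x, ‖g x‖ ≤ C) : ∃ x, g x = x := by
  have hC : 0 ≤ C := (norm_nonneg _).trans (hb 0)
  have hs : (0 : ℝ) < 4 * (C + 1) := by linarith
  obtain ⟨x, hx⟩ := exists_fixedPoint_of_norm_le_quarter
    (g := fun x => (4 * (C + 1))⁻¹ • g ((4 * (C + 1)) • x)) (by fun_prop) fun x => by
      rw [norm_smul, norm_inv, Real.norm_of_nonneg hs.le, inv_mul_le_iff₀ hs]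
      linarith [hb ((4 * (C + 1)) • x)]
  exact ⟨(4 * (C + 1)) • x, by conv_rhs => rw [← hx, smul_inv_smul₀ hs.ne']⟩

/-- **Brouwer's fixed point theorem** for the standard simplex. -/
theorem exists_fixedPoint_stdSimplex {ι : Type*} [Fintype ι] [Nonempty ι]
    {g : (ι → ℝ) → ι → ℝ} (hg : ContinuousOn g (stdSimplex ℝ ι))
    (hmaps : Set.MapsTo g (stdSimplex ℝ ι) (stdSimplex ℝ ι)) :
    ∃ w ∈ stdSimplex ℝ ι, g w = w := by
  let p : (ι → ℝ) → ι → ℝ := fun w i =>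
    (max 1 (∑ j, max (w j) 0))⁻¹ *
      (max (w i) 0 + (Fintype.card ι : ℝ)⁻¹ * max (1 - ∑ j, max (w j) 0) 0)
  have hpos : ∀ w : ι → ℝ, 0 < max 1 (∑ j, max (w j) 0) := fun w => by positivity
  have hp : Continuous p := by
    refine continuous_pi fun i => Continuous.mul (Continuous.inv₀ (by fun_prop) fun w =>
      (hpos w).ne') (by fun_prop)
  have hpm : ∀ w, p w ∈ stdSimplex ℝ ι := by
    intro w
    refine ⟨fun i => mul_nonneg (inv_nonneg.2 (hpos w).le) (by positivity), ?_⟩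
    simp only [p]
    rw [← Finset.mul_sum, Finset.sum_add_distrib, Finset.sum_const, Finset.card_univ,
      nsmul_eq_mul, mul_inv_cancel_left₀ (by simp), inv_mul_eq_one₀ (hpos w).ne']
    rcases le_total 1 (∑ j, max (w j) 0) with h | h
    · rw [max_eq_right h, max_eq_right (by linarith), add_zero]
    · rw [max_eq_left h, max_eq_left (by linarith)]; ring
  have hpid : ∀ w ∈ stdSimplex ℝ ι, p w = w := by
    intro w hw
    ext i
    simp [p, max_eq_left (hw.1 _), hw.2]
  let e := EuclideanSpace.equiv ι ℝ
  obtain ⟨C, hC⟩ := ((isCompact_stdSimplex ℝ ι).image e.symm.continuous).isBounded.exists_norm_le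
  obtain ⟨x, hx⟩ := exists_fixedPoint_of_continuous_of_bounded
    (g := fun x => e.symm (g (p (e x))))
    (e.symm.continuous.comp (hg.comp_continuous (hp.comp e.continuous) fun x => hpm _))
    (C := C) fun x => hC _ ⟨_, hmaps (hpm _), rfl⟩
  have hx' : g (p (e x)) = e x := by
    conv_rhs => rw [← hx]
    simp
  refine ⟨p (e x), hpm _, ?_⟩
  rw [hx']
  exact (hpid _ (hx' ▸ hmaps (hpm _))).symm

/-- **Schauder's fixed point theorem**. -/
theorem IsCompact.exists_fixedPoint_of_convex {E : Type*} [NormedAddCommGroup E]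
    [NormedSpace ℝ E] {K : Set E} (hK : IsCompact K) (hconv : Convex ℝ K) (hne : K.Nonempty)
    {T : E → E} (hT : ContinuousOn T K) (hmaps : Set.MapsTo T K K) : ∃ x ∈ K, T x = x := by
  have happrox : ∀ ε : ℝ, 0 < ε → ∃ x ∈ K, dist (T x) x < ε := by
    intro ε hε
    obtain ⟨s, hsK, hsfin, hcover⟩ := hK.finite_cover_balls hε
    have : Fintype s := hsfin.fintype
    obtain ⟨x₀, hx₀⟩ := hne
    have : Nonempty s := by
      obtain ⟨y, hy, -⟩ := Set.mem_iUnion₂.1 (hcover hx₀)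
      exact ⟨⟨y, hy⟩⟩
    let φ : (s → ℝ) → E := fun w => ∑ v, w v • (v : E)
    have hφ : Continuous φ := by fun_prop
    have hφK : Set.MapsTo φ (stdSimplex ℝ s) K := fun w hw =>
      hconv.sum_mem (fun v _ => hw.1 v) hw.2 fun v _ => hsK v.2
    let m : s → E → ℝ := fun v y => max (ε - dist y v) 0
    have hm : ∀ v, Continuous (m v) := fun v => by fun_prop
    have hmpos : ∀ y ∈ K, 0 < ∑ v, m v y := by
      intro y hy
      obtain ⟨v, hv, hvy⟩ := Set.mem_iUnion₂.1 (hcover hy)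
      refine Finset.sum_pos' (fun _ _ => le_max_right _ _) ⟨⟨v, hv⟩, Finset.mem_univ _, ?_⟩
      exact lt_max_of_lt_left (sub_pos.2 hvy)
    let g : (s → ℝ) → s → ℝ := fun w v => (∑ v', m v' (T (φ w)))⁻¹ * m v (T (φ w))
    have hTφ : ContinuousOn (fun w => T (φ w)) (stdSimplex ℝ s) := hT.comp hφ.continuousOn hφK
    obtain ⟨w, hw, hgw⟩ := exists_fixedPoint_stdSimplex (g := g)
      (continuousOn_pi.2 fun v => ContinuousOn.mul
        (ContinuousOn.inv₀ (continuousOn_finsetSum _ fun v' _ => (hm v').comp_continuousOn hTφ)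
          fun w hw => (hmpos _ (hmaps (hφK hw))).ne')
        ((hm v).comp_continuousOn hTφ))
      fun w hw => ⟨fun v => mul_nonneg (inv_nonneg.2 (hmpos _ (hmaps (hφK hw))).le)
          (le_max_right _ _), by
        rw [← Finset.mul_sum, inv_mul_cancel₀ (hmpos _ (hmaps (hφK hw))).ne']⟩
    refine ⟨φ w, hφK hw, ?_⟩
    set y := T (φ w) with hy
    have hpos := hmpos y (hmaps (hφK hw))
    have hwv : ∀ v, w v = (∑ v', m v' y)⁻¹ * m v y := fun v => (congrFun hgw v).symm
    have hdiff : y - φ w = ∑ v, w v • (y - v) := by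
      simp only [smul_sub, Finset.sum_sub_distrib, ← Finset.sum_smul, hw.2, one_smul, φ]
    have hterm : ∀ v, w v * ‖y - v‖ ≤ w v * ε ∧ (0 < w v → w v * ‖y - v‖ < w v * ε) := by
      intro v
      have key : 0 < w v → w v * ‖y - v‖ < w v * ε := by
        intro h
        have hmv : 0 < m v y := by
          by_contra hcon
          have : m v y = 0 := le_antisymm (not_lt.1 hcon) (le_max_right _ _)
          rw [hwv, this, mul_zero] at h
          exact lt_irrefl _ h
        have hlt : dist y v < ε := by
          rcases lt_max_iff.1 hmv with h' | h'
          · linarith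
          · exact absurd h' (lt_irrefl _)
        rw [dist_eq_norm] at hlt
        exact mul_lt_mul_of_pos_left hlt h
      refine ⟨?_, key⟩
      rcases (hw.1 v).eq_or_lt with h | h
      · simp [← h]
      · exact (key h).le
    rw [dist_eq_norm, hdiff]
    obtain ⟨v₀, hv₀⟩ : ∃ v, 0 < w v := by
      by_contra! hcon
      have := Finset.sum_nonpos fun v (_ : v ∈ Finset.univ) => hcon v
      rw [hw.2] at this
      linarith
    calc ‖∑ v, w v • (y - v)‖ ≤ ∑ v, w v * ‖y - v‖ := by
          refine (norm_sum_le _ _).trans (Finset.sum_le_sum fun v _ => ?_)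
          rw [norm_smul, Real.norm_of_nonneg (hw.1 v)]
      _ < ∑ v, w v * ε := Finset.sum_lt_sum (fun v _ => (hterm v).1)
          ⟨v₀, Finset.mem_univ _, (hterm v₀).2 hv₀⟩
      _ = ε := by rw [← Finset.sum_mul, hw.2, one_mul]
  obtain ⟨x, hx, hmin⟩ := hK.exists_isMinOn hne
    (f := fun x => dist (T x) x) (continuous_dist.comp_continuousOn (hT.prodMk continuousOn_id))
  refine ⟨x, hx, ?_⟩
  by_contra hcon
  obtain ⟨y, hy, hlt⟩ := happrox _ (dist_pos.2 hcon)
  exact absurd (hmin hy) (not_le.2 hlt)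

/-- A continuous function on `[0, ∞)` which is `ω`-periodic there descends to the circle. -/
theorem exists_addCircle_extension {ω : ℝ} [hω : Fact (0 < ω)] {c : ℝ → ℝ}
    (hc : ContinuousOn c (Set.Ici 0)) (hper : ∀ t ≥ (0 : ℝ), c (t + ω) = c t) :
    ∃ g : C(AddCircle ω, ℝ), ∀ t : ℝ, 0 ≤ t → g t = c t := by
  have h0 : c 0 = c (0 + ω) := (hper 0 le_rfl).symm
  refine ⟨⟨AddCircle.liftIco ω 0 c, AddCircle.liftIco_continuous h0
    (hc.mono Set.Icc_subset_Ici_self)⟩, fun t ht => ?_⟩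
  have hnat : ∀ (k : ℕ) (s : ℝ), 0 ≤ s → c (s + k * ω) = c s := by
    intro k s hs
    induction k with
    | zero => simp
    | succ k ih =>
      rw [← ih, ← hper (s + k * ω) (by have := hω.out; positivity)]
      push_cast
      ring_nf
  have hfr := toIcoMod_mem_Ico hω.out 0 t
  have hdiv : 0 ≤ toIcoDiv hω.out 0 t := by
    rw [toIcoDiv_eq_floor]
    exact Int.floor_nonneg.2 (div_nonneg (by simpa using ht) hω.out.le)
  obtain ⟨k, hk⟩ := Int.eq_ofNat_of_zero_le hdiv
  have heq : t = toIcoMod hω.out 0 t + k * ω := by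
    have := toIcoMod_add_toIcoDiv_zsmul hω.out 0 t
    rw [hk] at this
    simpa using this.symm
  have hcoe : (t : AddCircle ω) = (toIcoMod hω.out 0 t : ℝ) := by
    conv_lhs => rw [heq]
    rw [AddCircle.coe_add, ← nsmul_eq_mul, AddCircle.coe_nsmul, AddCircle.coe_period, smul_zero,
      add_zero]
  change AddCircle.liftIco ω 0 c t = c t
  rw [hcoe, AddCircle.liftIco_coe_apply hfr, ← hnat k _ hfr.1, ← heq]

theorem integrableOn_mul_comp_sub {ω : ℝ} [Fact (0 < ω)] {k : ℝ → ℝ}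
    (hk : IntegrableOn k (Set.Ioi 0)) (z : C(AddCircle ω, ℝ)) (p : AddCircle ω) :
    IntegrableOn (fun u : ℝ => k u * z (p - u)) (Set.Ioi 0) := by
  refine hk.mul_bdd (c := ‖z‖) ?_ (Eventually.of_forall fun u => z.norm_coe_le_norm _)
  exact (z.continuous.comp (continuous_const.sub
    (AddCircle.continuous_mk' ω))).aestronglyMeasurable

/-- Distributed delay with an integrable kernel, as a continuous operator on periodic functions. -/
theorem exists_delayOperator {ω : ℝ} [Fact (0 < ω)] {k : ℝ → ℝ}
    (hk : IntegrableOn k (Set.Ioi 0)) :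
    ∃ D : C(AddCircle ω, ℝ) → C(AddCircle ω, ℝ), Continuous D ∧
      ∀ z p, D z p = ∫ u in Set.Ioi (0 : ℝ), k u * z (p - u) := by
  have hcont : ∀ z : C(AddCircle ω, ℝ),
      Continuous fun p : AddCircle ω => ∫ u in Set.Ioi (0 : ℝ), k u * z (p - u) := by
    intro z
    refine continuous_of_dominated (bound := fun u => ‖k u‖ * ‖z‖)
      (fun p => (integrableOn_mul_comp_sub hk z p).aestronglyMeasurable)
      (fun p => Eventually.of_forall fun u => ?_) (hk.norm.mul_const _)
      (Eventually.of_forall fun u => by fun_prop)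
    rw [norm_mul]
    gcongr
    exact z.norm_coe_le_norm _
  refine ⟨fun z => ⟨_, hcont z⟩, ?_, fun _ _ => rfl⟩
  refine (LipschitzWith.of_dist_le_mul (K := (∫ u in Set.Ioi (0 : ℝ), ‖k u‖).toNNReal)
    fun z z' => ?_).continuous
  have hK0 : 0 ≤ ∫ u in Set.Ioi (0 : ℝ), ‖k u‖ := by positivity
  rw [ContinuousMap.dist_le (by positivity), Real.coe_toNNReal _ hK0]
  intro p
  change dist (∫ u in Set.Ioi (0 : ℝ), k u * z (p - u))
    (∫ u in Set.Ioi (0 : ℝ), k u * z' (p - u)) ≤ _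
  rw [dist_eq_norm, ← integral_sub (integrableOn_mul_comp_sub hk z p)
    (integrableOn_mul_comp_sub hk z' p), ← integral_mul_const]
  refine norm_integral_le_of_norm_le (hk.norm.mul_const _) (Eventually.of_forall fun u => ?_)
  rw [← mul_sub, norm_mul, ← dist_eq_norm (z _)]
  gcongr
  exact ContinuousMap.dist_apply_le_dist _

/-- Convolution with the exponential kernel solves `x' = g - r x`. -/
theorem hasDerivAt_integral_exp_mul_comp_sub {ω : ℝ} [Fact (0 < ω)] {r : ℝ} (hr : 0 < r)
    (g : C(AddCircle ω, ℝ)) (t : ℝ) :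
    HasDerivAt (fun t : ℝ => ∫ u in Set.Ioi (0 : ℝ), Real.exp (-r * u) * g (t - u))
      (g t - r * ∫ u in Set.Ioi (0 : ℝ), Real.exp (-r * u) * g (t - u)) t := by
  have hgc : Continuous fun s : ℝ => g s := g.continuous.comp (AddCircle.continuous_mk' ω)
  have hc : Continuous fun s : ℝ => Real.exp (r * s) * g s := by fun_prop
  have hint : ∀ t, IntegrableOn (fun s : ℝ => Real.exp (r * s) * g s) (Set.Iic t) := fun t =>
    (integrableOn_exp_mul_Iic hr t).mul_bdd (c := ‖g‖) hgc.aestronglyMeasurable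
      (Eventually.of_forall fun s => g.norm_coe_le_norm _)
  have hform : ∀ t : ℝ, ∫ u in Set.Ioi (0 : ℝ), Real.exp (-r * u) * g (t - u) =
      Real.exp (-r * t) * ((∫ s in Set.Iic (0 : ℝ), Real.exp (r * s) * g s) +
        ∫ s in (0 : ℝ)..t, Real.exp (r * s) * g s) := by
    intro t
    rw [← intervalIntegral.integral_Iic_sub_Iic (hint 0) (hint t), add_sub_cancel,
      integral_Iic_eq_integral_Iio, ← integral_indicator measurableSet_Ioi,
      ← integral_indicator measurableSet_Iio,
      ← integral_sub_left_eq_self (fun s => (Set.Iio t).indicator _ s) volume t,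
      ← integral_const_mul]
    congr 1
    ext u
    by_cases hu : 0 < u
    · rw [Set.indicator_of_mem (Set.mem_Ioi.2 hu), Set.indicator_of_mem (by simpa using hu),
        ← mul_assoc, ← Real.exp_add, AddCircle.coe_sub]
      ring_nf
    · rw [Set.indicator_of_notMem (by simpa using hu), Set.indicator_of_notMem (by simpa using hu),
        mul_zero]
  have hF : HasDerivAt (fun t => (∫ s in Set.Iic (0 : ℝ), Real.exp (r * s) * g s) +
      ∫ s in (0 : ℝ)..t, Real.exp (r * s) * g s) (Real.exp (r * t) * g t) t :=
    (intervalIntegral.integral_hasDerivAt_right (hc.intervalIntegrable _ _)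
      (hc.stronglyMeasurableAtFilter _ _) hc.continuousAt).const_add _
  have hexp : HasDerivAt (fun t => Real.exp (-r * t)) (Real.exp (-r * t) * -r) t := by
    simpa using ((hasDerivAt_id t).const_mul (-r)).exp
  simp_rw [hform]
  refine (hexp.mul hF).congr_deriv ?_
  have : Real.exp (-r * t) * Real.exp (r * t) = 1 := by rw [← Real.exp_add]; simp
  linear_combination (g t : ℝ) * this

theorem isCompact_setOf_norm_le_and_lipschitz {ω : ℝ} [Fact (0 < ω)] (R L : ℝ) :
    IsCompact {z : C(AddCircle ω, ℝ) | ‖z‖ ≤ R ∧ ∀ s t : ℝ, |z s - z t| ≤ L * |s - t|} := by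
  let e := ContinuousMap.isometryEquivBoundedOfCompact (AddCircle ω) ℝ
  rw [← e.toHomeomorph.symm.isCompact_preimage]
  have hev : ∀ p : AddCircle ω, Continuous fun z : BoundedContinuousFunction (AddCircle ω) ℝ =>
    z p := fun p => continuous_eval_const p
  have hA : e.toHomeomorph.symm ⁻¹' {z | ‖z‖ ≤ R ∧ ∀ s t : ℝ, |z s - z t| ≤ L * |s - t|} =
      {z | ‖z‖ ≤ R ∧ ∀ s t : ℝ, |z s - z t| ≤ L * |s - t|} := rfl
  rw [hA]
  refine BoundedContinuousFunction.arzela_ascoli₂ (Metric.closedBall 0 R)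
    (isCompact_closedBall 0 R) _ ?_ ?_ ?_
  · simp only [Set.ofPred_and, Set.ofPred_forall]
    refine (isClosed_le continuous_norm continuous_const).inter (isClosed_iInter fun s =>
      isClosed_iInter fun t => isClosed_le ((hev s).sub (hev t)).abs continuous_const)
  · intro z p hz
    rw [mem_closedBall_zero_iff]
    exact (z.norm_coe_le_norm p).trans hz.1
  · intro p
    obtain ⟨s, rfl⟩ := QuotientAddGroup.mk_surjective p
    rw [Metric.equicontinuousAt_iff_right]
    intro ε hε
    have hball : Metric.ball s (ε / (|L| + 1)) ∈ nhds s :=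
      Metric.ball_mem_nhds _ (by positivity)
    filter_upwards [QuotientAddGroup.isOpenMap_coe.image_mem_nhds hball]
    rintro _ ⟨t, ht, rfl⟩ ⟨z, hz⟩
    rw [Metric.mem_ball, dist_comm, Real.dist_eq, lt_div_iff₀ (by positivity)] at ht
    have h1 : |z s - z t| ≤ L * |s - t| := hz.2 s t
    have h2 : L * |s - t| ≤ |L| * |s - t| := by gcongr; exact le_abs_self L
    have h3 := abs_nonneg (s - t)
    change dist (z s) (z t) < ε
    rw [Real.dist_eq]
    nlinarith

/-- A dissipative functional differential equation on the circle has a solution: `x' = H x - r x`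
is solvable as soon as `H` is continuous and maps the box of radius `R` to the one of
radius `r * R`. -/
theorem exists_solution_of_invariant_box {ω : ℝ} [Fact (0 < ω)] {ι : Type*} [Fintype ι]
    {H : (ι → C(AddCircle ω, ℝ)) → ι → C(AddCircle ω, ℝ)} (hH : Continuous H) {r R : ℝ}
    (hr : 0 < r) (hR : 0 ≤ R)
    (hbox : ∀ x, (∀ i, ‖x i‖ ≤ R) → ∀ i, ‖H x i‖ ≤ r * R) :
    ∃ x : ι → C(AddCircle ω, ℝ), ∀ i, ∀ t : ℝ,
      HasDerivAt (fun t : ℝ => x i t) (H x i t - r * x i t) t := by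
  have hexp : IntegrableOn (fun u : ℝ => Real.exp (-r * u)) (Set.Ioi 0) :=
    integrableOn_exp_mul_Ioi (neg_neg_of_pos hr) 0
  obtain ⟨S, hS, hSe⟩ := exists_delayOperator (ω := ω) hexp
  have hderiv : ∀ g, ∀ t : ℝ, HasDerivAt (fun t : ℝ => S g t) (g t - r * S g t) t := fun g t => by
    simpa only [hSe] using hasDerivAt_integral_exp_mul_comp_sub hr g t
  have hSb : ∀ g, ‖g‖ ≤ r * R → ‖S g‖ ≤ R := by
    intro g hg
    rw [ContinuousMap.norm_le _ hR]
    intro p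
    have h1 : ∫ u in Set.Ioi (0 : ℝ), Real.exp (-r * u) * (r * R) = R := by
      rw [integral_mul_const, integral_exp_mul_Ioi (neg_neg_of_pos hr)]
      simp
      field_simp
    rw [hSe, ← h1]
    refine norm_integral_le_of_norm_le (hexp.mul_const _) (Eventually.of_forall fun u => ?_)
    rw [norm_mul, Real.norm_of_nonneg (Real.exp_pos _).le]
    gcongr
    exact (g.norm_coe_le_norm _).trans hg
  let Q : Set C(AddCircle ω, ℝ) :=
    {z | ‖z‖ ≤ R ∧ ∀ s t : ℝ, |z s - z t| ≤ (r * R + r * R) * |s - t|}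
  have hQ : Convex ℝ Q := by
    have h1 : Convex ℝ {z : C(AddCircle ω, ℝ) | ‖z‖ ≤ R} := by
      simpa [Metric.closedBall, dist_zero_right] using convex_closedBall (0 : C(AddCircle ω, ℝ)) R
    have h2 : ∀ s t : ℝ, Convex ℝ {z : C(AddCircle ω, ℝ) |
        |z s - z t| ≤ (r * R + r * R) * |s - t|} := by
      intro s t x hx y hy α β hα hβ hαβ
      simp only [Set.mem_ofPred_eq, ContinuousMap.add_apply, ContinuousMap.smul_apply,
        smul_eq_mul] at *
      rw [abs_le] at *
      constructor <;> nlinarith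
    have : Q = {z | ‖z‖ ≤ R} ∩ ⋂ s : ℝ, ⋂ t : ℝ,
        {z | |z s - z t| ≤ (r * R + r * R) * |s - t|} := by
      ext z; simp [Q]
    rw [this]
    exact h1.inter (convex_iInter fun s => convex_iInter fun t => h2 s t)
  obtain ⟨x, -, hx⟩ := IsCompact.exists_fixedPoint_of_convex
    (K := Set.univ.pi fun _ : ι => Q) (T := fun x i => S (H x i))
    (isCompact_univ_pi fun _ => isCompact_setOf_norm_le_and_lipschitz R _)
    (convex_pi fun _ _ => hQ)
    ⟨0, fun i _ => ⟨by simpa using hR, fun s t => by simp; positivity⟩⟩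
    (by fun_prop) (by
      intro x hx i _
      have hHx := hbox x (fun i => (hx i trivial).1) i
      have hSx := hSb _ hHx
      refine ⟨hSx, fun s t => ?_⟩
      have := convex_univ.norm_image_sub_le_of_norm_hasDerivWithin_le (C := r * R + r * R)
        (fun t _ => (hderiv (H x i) t).hasDerivWithinAt) (fun t _ => ?_)
        (Set.mem_univ t) (Set.mem_univ s)
      · simpa [Real.norm_eq_abs] using this
      · refine (norm_sub_le _ _).trans (add_le_add ((ContinuousMap.norm_coe_le_norm _ _).trans hHx)
          ?_)
        rw [norm_mul, Real.norm_of_nonneg hr.le]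
        gcongr
        exact (ContinuousMap.norm_coe_le_norm _ _).trans hSx)
  refine ⟨x, fun i t => ?_⟩
  have := hderiv (H x i) t
  rwa [show S (H x i) = x i from congrFun hx i] at this

/-- For `R` and then `r` large enough, `x ↦ r x - a x (b x - G)` maps `[-R, R]` to `[-r R, r R]`,
uniformly in bounded `G`. -/
theorem exists_box_bound {a b : ℝ → ℝ} {aU β βs Γ : ℝ} (ha : ∀ u, 0 < a u) (haU : ∀ u, a u ≤ aU)
    (hβ : 0 < β) (hβs : 0 < βs) (hΓ : 0 ≤ Γ)
    (hb : ∀ u v : ℝ, u ≠ v → β ≤ (b u - b v) / (u - v) ∧ (b u - b v) / (u - v) ≤ βs) :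
    ∃ R₁, ∀ R ≥ R₁, ∃ r₁, ∀ r ≥ r₁, ∀ x, |x| ≤ R → ∀ G, |G| ≤ Γ →
      |r * x - a x * b x + a x * G| ≤ r * R := by
  have hpos : ∀ x, 0 ≤ x → b 0 + β * x ≤ b x ∧ b x ≤ b 0 + βs * x := by
    intro x hx
    rcases hx.eq_or_lt with rfl | hx
    · simp
    · obtain ⟨h1, h2⟩ := hb x 0 hx.ne'
      rw [sub_zero, le_div_iff₀ hx] at h1
      rw [sub_zero, div_le_iff₀ hx] at h2
      constructor <;> linarith
  have hneg : ∀ x, x ≤ 0 → b 0 + βs * x ≤ b x ∧ b x ≤ b 0 + β * x := by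
    intro x hx
    rcases hx.eq_or_lt with rfl | hx
    · simp
    · obtain ⟨h1, h2⟩ := hb x 0 hx.ne
      rw [sub_zero, le_div_iff_of_neg hx] at h1
      rw [sub_zero, div_le_iff_of_neg hx] at h2
      constructor <;> linarith
  set R₀ := (|b 0| + Γ) / β with hR₀
  have hR₀0 : 0 ≤ R₀ := by positivity
  have hβR₀ : β * R₀ = |b 0| + Γ := by rw [hR₀]; field_simp
  refine ⟨R₀ + 1, fun R hR => ⟨aU * (|b 0| + βs * R + Γ), fun r hr x hx G hG => ?_⟩⟩
  have haU0 : 0 < aU := (ha 0).trans_le (haU 0)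
  have hR0 : 0 ≤ R := by linarith
  have hr0 : 0 ≤ r := le_trans (by positivity) hr
  rw [abs_le] at hx hG
  have hb0 := abs_le.1 (le_refl |b 0|)
  have hbx : |b x - G| ≤ |b 0| + βs * R + Γ := by
    rw [abs_le]
    rcases le_total 0 x with h | h
    · have := hpos x h
      have : βs * x ≤ βs * R := by gcongr; exact hx.2
      have : 0 ≤ β * x := by positivity
      have : 0 ≤ βs * R := by positivity
      constructor <;> linarith
    · have := hneg x h
      have : -(βs * R) ≤ βs * x := by nlinarith
      have : β * x ≤ 0 := by nlinarith
      have : 0 ≤ βs * R := by positivity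
      constructor <;> linarith
  have hax : |a x * (b x - G)| ≤ r := by
    rw [abs_mul, abs_of_pos (ha x)]
    refine le_trans ?_ hr
    gcongr
    exact haU x
  rw [abs_le] at hax
  have hup : r * x - a x * (b x - G) ≤ r * R := by
    rcases le_total x R₀ with h | h
    · nlinarith
    · have h1 := (hpos x (hR₀0.trans h)).1
      have h2 : β * R₀ ≤ β * x := by gcongr
      have : 0 ≤ a x * (b x - G) := mul_nonneg (ha x).le (by linarith)
      nlinarith
  have hlow : -(r * R) ≤ r * x - a x * (b x - G) := by
    rcases le_total (-R₀) x with h | h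
    · nlinarith
    · have h1 := (hneg x (h.trans (by linarith))).2
      have h2 : β * x ≤ β * -R₀ := by gcongr
      have : 0 ≤ a x * (G - b x) := mul_nonneg (ha x).le (by linarith)
      nlinarith
  rw [abs_le]
  constructor <;> linarith

/-- Existence of an ω-periodic solution of the high-order model (M)
(first part of Corollary 4.6). -/
theorem M_periodic_solution_exists {n : ℕ} (ω : ℝ) (hω : 0 < ω)
    (ρc : Fin (n+1) → ℝ) (a b : Fin (n+1) → ℝ → ℝ)
    (c d : Fin (n+1) → Fin (n+1) → ℝ → ℝ) (e : Fin (n+1) → Fin (n+1) → Fin (n+1) → ℝ → ℝ)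
    (I : Fin (n+1) → ℝ → ℝ) (f : Fin (n+1) → ℝ → ℝ) (K : Fin (n+1) → Fin (n+1) → ℝ → ℝ)
    (aL aU β βs M μ : Fin (n+1) → ℝ)
    (hreg : MRegular n ρc a b c d e I f K)
    (hass : MAssumptions n ω ρc a b c d e I f aL aU β βs M μ)
    (dv : Fin (n+1) → ℝ) (hdv : ∀ i, 0 < dv i)
    (hdom : ∀ i, ∀ t ∈ Set.Icc (0:ℝ) ω,
      (∑ j : Fin (n+1),
        ((|c i j t| + |d i j t|) * μ j * ρc j * (dv j / dv i)
          + ∑ l : Fin (n+1), |e i j l t| *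
            ((dv j / dv i) * M l * μ j * ρc j + (dv l / dv i) * M j * μ l * ρc l)))
        < β i) :
    ∃ xper : Fin (n+1) → ℝ → ℝ,
      (∀ i, Continuous (xper i)) ∧
      (∀ i, ∀ t : ℝ, xper i (t + ω) = xper i t) ∧
      (∀ i, ∀ t : ℝ, 0 < t →
        HasDerivAt (xper i) (Mrhs n ρc a b c d e I f K xper i t) t) := by
  obtain ⟨-, ha, hapos, hb, hc, hd, he, hI, hf, -, -, hK⟩ := hreg
  obtain ⟨hcp, hdp, hep, hIp, -, -, haU, hβ, hβs, hbβ, hM, -, -, hfM⟩ := hass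
  have : Fact (0 < ω) := ⟨hω⟩
  have hKint : ∀ i j, IntegrableOn (K i j) (Set.Ioi 0) := fun i j =>
    not_imp_comm.1 integral_undef (by rw [hK]; exact one_ne_zero)
  choose c' hc' using fun i j => exists_addCircle_extension (hc i j) (hcp i j)
  choose d' hd' using fun i j => exists_addCircle_extension (hd i j) (hdp i j)
  choose e' he' using fun i j l => exists_addCircle_extension (he i j l) (hep i j l)
  choose I' hI' using fun i => exists_addCircle_extension (hI i) (hIp i)
  choose D hD hDe using fun i j => exists_delayOperator (ω := ω) (hKint i j)
  let F : Fin (n+1) → C(AddCircle ω, ℝ) → C(AddCircle ω, ℝ) := fun j z =>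
    (⟨fun s => f j (ρc j * s), (hf j).comp (continuous_const_mul _)⟩ : C(ℝ, ℝ)).comp z
  let a' : Fin (n+1) → C(AddCircle ω, ℝ) → C(AddCircle ω, ℝ) := fun i z =>
    (⟨a i, ha i⟩ : C(ℝ, ℝ)).comp z
  let b' : Fin (n+1) → C(AddCircle ω, ℝ) → C(AddCircle ω, ℝ) := fun i z =>
    (⟨b i, hb i⟩ : C(ℝ, ℝ)).comp z
  have hF : ∀ j, Continuous (F j) := fun j => ContinuousMap.continuous_postcomp _
  have ha' : ∀ j, Continuous (a' j) := fun j => ContinuousMap.continuous_postcomp _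
  have hb' : ∀ j, Continuous (b' j) := fun j => ContinuousMap.continuous_postcomp _
  let G : (Fin (n+1) → C(AddCircle ω, ℝ)) → Fin (n+1) → C(AddCircle ω, ℝ) := fun x i =>
    (∑ j, c' i j * F j (x j)) + (∑ j, d' i j * F j (D i j (x j))) +
      (∑ j, ∑ l, e' i j l * F j (D i j (x j)) * F l (D i l (x l))) + I' i
  have hG : Continuous G := by fun_prop
  have hFM : ∀ j z, ‖F j z‖ ≤ M j := fun j z =>
    (ContinuousMap.norm_le _ (hM j).le).2 fun p => hfM j _
  let Γ : Fin (n+1) → ℝ := fun i => (∑ j, ‖c' i j‖ * M j) + (∑ j, ‖d' i j‖ * M j) +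
    (∑ j, ∑ l, ‖e' i j l‖ * M j * M l) + ‖I' i‖
  have hGΓ : ∀ x i, ‖G x i‖ ≤ Γ i := by
    intro x i
    refine norm_add_le_of_le (norm_add_le_of_le (norm_add_le_of_le ?_ ?_) ?_) le_rfl
    · exact norm_sum_le_of_le _ fun j _ => norm_mul_le_of_le le_rfl (hFM _ _)
    · exact norm_sum_le_of_le _ fun j _ => norm_mul_le_of_le le_rfl (hFM _ _)
    · exact norm_sum_le_of_le _ fun j _ => norm_sum_le_of_le _ fun l _ =>
        norm_mul_le_of_le (norm_mul_le_of_le le_rfl (hFM _ _)) (hFM _ _)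
  choose R₁ hR₁ using fun i => exists_box_bound (hapos i) (fun u => (haU i u).2) (hβ i) (hβs i)
    ((norm_nonneg _).trans (hGΓ 0 i)) (hbβ i)
  obtain ⟨R₂, hR₂⟩ := Finite.exists_le R₁
  choose r₁ hr₁ using fun i => hR₁ i (max R₂ 0) ((hR₂ i).trans (le_max_left _ _))
  obtain ⟨r₂, hr₂⟩ := Finite.exists_le r₁
  have hr0 : 0 < max r₂ 1 := lt_max_of_lt_right one_pos
  obtain ⟨x, hx⟩ := exists_solution_of_invariant_box
    (H := fun x i => max r₂ 1 • x i - a' i (x i) * b' i (x i) + a' i (x i) * G x i)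
    (by fun_prop) hr0 (le_max_right R₂ 0) fun x hx i =>
      (ContinuousMap.norm_le _ (by positivity)).2 fun p =>
        hr₁ i _ ((hr₂ i).trans (le_max_left _ _)) (x i p)
          ((ContinuousMap.norm_coe_le_norm _ p).trans (hx i)) (G x i p)
          ((ContinuousMap.norm_coe_le_norm _ p).trans (hGΓ x i))
  refine ⟨fun i t => x i t, fun i => (x i).continuous.comp (AddCircle.continuous_mk' ω),
    fun i t => by dsimp only; rw [AddCircle.coe_add, AddCircle.coe_period, add_zero], fun i t ht => ?_⟩
  refine (hx i t).congr_deriv ?_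
  simp only [Mrhs, AddCircle.coe_sub, ← hDe, ← hc' _ _ t ht.le, ← hd' _ _ t ht.le,
    ← he' _ _ _ t ht.le, ← hI' _ t ht.le]
  simp only [G, F, a', b', ContinuousMap.add_apply, ContinuousMap.sub_apply,
    ContinuousMap.mul_apply, ContinuousMap.smul_apply, ContinuousMap.sum_apply,
    ContinuousMap.comp_apply, ContinuousMap.coe_mk, smul_eq_mul]
  ring
end
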